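/- Let t ≥ 2, n ≥ 3t, and k ∈ {2t+1, 2t+2}. If G is a 2-connected n-vertex graph with no cycle of length at least k and with more than C(k-t+1,2) + (t-1)(n-k+t-1) edges, then there exists a set A of at most t vertices such that G - A is a star forest. -/

import Mathlib

/-- A graph is 2-connected if it has at least 3 vertices, is connected, and
remains connected after deleting any single vertex. -/
def TwoConnected {V : Type*} [Fintype V] (G : SimpleGraph V) : Prop :=
  3 ≤ Fintype.card V ∧ G.Connected ∧ ∀ v : V, (G.induce {w | w ≠ v}).Connected

/-- A star forest: in each connected component there is a vertex meeting all
edges of that component (so every component is a star, possibly a single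
vertex or a single edge). -/
def IsStarForest {W : Type*} (F : SimpleGraph W) : Prop :=
  ∀ v : W, ∃ x : W, ∀ a b : W, F.Adj a b → F.Reachable a v → (a = x ∨ b = x)

set_option linter.unusedSimpArgs false

namespace StarStability

universe uV
variable {V : Type uV} {G : SimpleGraph V}

/-- `l` lists the vertices of a path of `G` from `a` to `b`. -/
def Pth (G : SimpleGraph V) (a b : V) (l : List V) : Prop :=
  l.IsChain G.Adj ∧ l.head? = some a ∧ l.getLast? = some b ∧ l.Nodup

/-- Every cycle of `G` has fewer than `k` vertices (cycles being closed paths). -/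
def NoLong (G : SimpleGraph V) (k : ℕ) : Prop :=
  ∀ a b l, Pth G a b l → G.Adj b a → l.length < k

/-- Fan-type consequence of 2-connectedness: two sets can be joined avoiding any vertex. -/
def Link (G : SimpleGraph V) : Prop :=
  ∀ (v : V) (S T : Set V), (∃ a ∈ S, a ≠ v) → (∃ b ∈ T, b ≠ v) →
    ∃ a ∈ S, ∃ b ∈ T, ∃ l, Pth G a b l ∧ v ∉ l ∧ (∀ x ∈ l, x ∈ S → x = a) ∧
      (∀ x ∈ l, x ∈ T → x = b)

theorem Pth.single (a : V) : Pth G a a [a] := by simp [Pth]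

theorem Pth.ne_nil {a b : V} {l : List V} (h : Pth G a b l) : l ≠ [] := by
  rintro rfl; simp [Pth] at h

theorem Pth.length_pos {a b : V} {l : List V} (h : Pth G a b l) : 0 < l.length :=
  List.length_pos_iff.2 h.ne_nil

theorem Pth.head_mem {a b : V} {l : List V} (h : Pth G a b l) : a ∈ l :=
  List.mem_of_head? h.2.1

theorem Pth.last_mem {a b : V} {l : List V} (h : Pth G a b l) : b ∈ l :=
  List.mem_of_getLast? h.2.2.1

theorem Pth.nodup {a b : V} {l : List V} (h : Pth G a b l) : l.Nodup := h.2.2.2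

theorem Pth.reverse {a b : V} {l : List V} (h : Pth G a b l) : Pth G b a l.reverse := by
  obtain ⟨h1, h2, h3, h4⟩ := h
  refine ⟨?_, by simpa using h3, by simpa using h2, by simpa using h4⟩
  rw [List.isChain_reverse]
  exact h1.imp fun _ _ h => h.symm

theorem Pth.append {a b c d : V} {l m : List V} (h : Pth G a b l) (h' : Pth G c d m)
    (hbc : G.Adj b c) (hd : ∀ x ∈ l, x ∉ m) : Pth G a d (l ++ m) := by
  obtain ⟨h1, h2, h3, h4⟩ := h
  obtain ⟨g1, g2, g3, g4⟩ := h'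
  refine ⟨?_, ?_, ?_, ?_⟩
  · rw [List.isChain_append]
    refine ⟨h1, g1, ?_⟩
    intro x hx y hy
    rw [h3] at hx; rw [g2] at hy
    simp at hx hy; subst hx; subst hy; exact hbc
  · rw [List.head?_append, h2]; rfl
  · rw [List.getLast?_append, g3]; rfl
  · rw [List.nodup_append]
    exact ⟨h4, g4, fun x hx y hy hxy => hd x hx (hxy ▸ hy)⟩

theorem Pth.cons {a b c : V} {l : List V} (h : Pth G a b l) (hc : G.Adj c a) (hn : c ∉ l) :
    Pth G c b (c :: l) :=
  (Pth.single c).append h hc (by simpa using hn)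

theorem Pth.concat {a b c : V} {l : List V} (h : Pth G a b l) (hc : G.Adj b c) (hn : c ∉ l) :
    Pth G a c (l ++ [c]) :=
  h.append (Pth.single c) hc (by intro x hx; simp; rintro rfl; exact hn hx)

theorem Pth.split {a b x : V} {l m : List V} (h : Pth G a b (l ++ x :: m)) :
    Pth G a x (l ++ [x]) ∧ Pth G x b (x :: m) := by
  obtain ⟨h1, h2, h3, h4⟩ := h
  have e : l ++ x :: m = (l ++ [x]) ++ m := by simp
  refine ⟨⟨?_, ?_, ?_, ?_⟩, ⟨?_, ?_, ?_, ?_⟩⟩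
  · rw [e] at h1; exact h1.left_of_append
  · cases l <;> simpa using h2
  · simp
  · rw [e] at h4; exact h4.of_append_left
  · exact h1.right_of_append
  · simp
  · rw [List.getLast?_append] at h3
    cases hm : (x :: m).getLast? with
    | none => simp at hm
    | some y => rw [hm] at h3; simpa using h3
  · exact h4.of_append_right

/-- Dropping the first vertex of a path with more than one vertex. -/
theorem Pth.tail {a b c : V} {m : List V} (h : Pth G a b (a :: c :: m)) :
    G.Adj a c ∧ Pth G c b (c :: m) ∧ a ∉ c :: m := by
  have h' : Pth G a b ([a] ++ c :: m) := h
  refine ⟨?_, h'.split.2, ?_⟩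
  · have := h.1; simp at this; exact this.1
  · have := h.nodup; simp at this ⊢; tauto

theorem Pth.eq_cons {a b : V} {l : List V} (h : Pth G a b l) : ∃ m, l = a :: m := by
  cases l with
  | nil => exact absurd rfl h.ne_nil
  | cons x m => have := h.2.1; simp at this; exact ⟨m, by rw [this]⟩

theorem Pth.eq_concat {a b : V} {l : List V} (h : Pth G a b l) : ∃ m, l = m ++ [b] := by
  obtain ⟨m, hm⟩ := h.reverse.eq_cons
  exact ⟨m.reverse, by simpa using congrArg List.reverse hm⟩

theorem Pth.singleton_of_eq {a : V} {l : List V} (h : Pth G a a l) : l = [a] := by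
  obtain ⟨m, rfl⟩ := h.eq_cons
  cases m with
  | nil => rfl
  | cons c m =>
    exact absurd h.tail.2.1.last_mem h.tail.2.2

/-- A path meeting sets `S` (at its start) and `T` (at its end) can be trimmed. -/
theorem Pth.trim {a b : V} {l : List V} (h : Pth G a b l) {S T : Set V} (ha : a ∈ S)
    (hb : b ∈ T) : ∃ a' ∈ S, ∃ b' ∈ T, ∃ l', Pth G a' b' l' ∧ (∀ x ∈ l', x ∈ l) ∧
      (∀ x ∈ l', x ∈ S → x = a') ∧ (∀ x ∈ l', x ∈ T → x = b') := by
  classical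
  induction hn : l.length using Nat.strong_induction_on generalizing a b l with
  | _ n ih =>
  subst hn
  by_cases h1 : ∀ x ∈ l, x ∈ S → x = a
  · by_cases h2 : ∀ x ∈ l, x ∈ T → x = b
    · exact ⟨a, ha, b, hb, l, h, fun _ hx => hx, h1, h2⟩
    · push Not at h2
      obtain ⟨x, hx, hxT, hne⟩ := h2
      obtain ⟨p, q, rfl⟩ := List.append_of_mem hx
      have hs := h.split.1
      have hq : q ≠ [] := by
        rintro rfl
        have := h.2.2.1; simp at this; exact hne this
      have hl : (p ++ [x]).length < (p ++ x :: q).length := by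
        have := List.length_pos_iff.2 hq
        simp; omega
      obtain ⟨a', ha', b', hb', l', p1, p2, p3, p4⟩ := ih _ hl hs ha hxT rfl
      refine ⟨a', ha', b', hb', l', p1, fun y hy => ?_, p3, p4⟩
      have := p2 y hy
      simp at this ⊢; tauto
  · push Not at h1
    obtain ⟨x, hx, hxT, hne⟩ := h1
    obtain ⟨p, q, rfl⟩ := List.append_of_mem hx
    have hs := h.split.2
    have hq : p ≠ [] := by
      rintro rfl
      have := h.2.1; simp at this; exact hne this
    have hl : (x :: q).length < (p ++ x :: q).length := by
      have := List.length_pos_iff.2 hq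
      simp; omega
    obtain ⟨a', ha', b', hb', l', p1, p2, p3, p4⟩ := ih _ hl hs hxT hb rfl
    refine ⟨a', ha', b', hb', l', p1, fun y hy => ?_, p3, p4⟩
    have := p2 y hy
    simp at this ⊢; tauto

theorem pth_of_isPath {a b : V} (p : G.Walk a b) (hp : p.IsPath) : Pth G a b p.support := by
  refine ⟨p.isChain_adj_support, ?_, ?_, hp.support_nodup⟩
  · rw [List.head?_eq_some_head p.support_ne_nil, p.head_support]
  · rw [List.getLast?_eq_some_getLast p.support_ne_nil, p.getLast_support]

theorem link_of_twoConnected [Fintype V] (h : TwoConnected G) : Link G := by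
  classical
  rintro v S T ⟨a, ha, hav⟩ ⟨b, hb, hbv⟩
  obtain ⟨p, hp⟩ := ((h.2.2 v).preconnected ⟨a, hav⟩ ⟨b, hbv⟩).exists_isPath
  have hp' := (SimpleGraph.Walk.isPath_map_iff_of_injective
    (f := (SimpleGraph.Embedding.induce {w | w ≠ v} (G := G)).toHom)
    (SimpleGraph.Embedding.induce {w | w ≠ v} (G := G)).injective).2 hp
  have hq := pth_of_isPath _ hp'
  have hv : v ∉ (p.map (SimpleGraph.Embedding.induce {w | w ≠ v} (G := G)).toHom).support := by
    rw [SimpleGraph.Walk.support_map]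
    simp only [List.mem_map, not_exists, not_and]
    rintro ⟨x, hx⟩ _ he
    exact hx he
  obtain ⟨a', ha', b', hb', l', p1, p2, p3, p4⟩ := hq.trim (S := S) (T := T) ha hb
  exact ⟨a', ha', b', hb', l', p1, fun hx => hv (p2 _ hx), p3, p4⟩

theorem noLong_of_isCycle {k : ℕ} (hk : 3 ≤ k)
    (hcyc : ∀ (u : V) (c : G.Walk u u), c.IsCycle → c.length < k) : NoLong G k := by
  intro a b l h hab
  by_cases hl : l.length < 3
  · omega
  obtain ⟨m, rfl⟩ := h.eq_cons
  obtain ⟨h1, h2, h3, h4⟩ := h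
  have hlast : (a :: m).getLast (by simp) = b := by
    rw [List.getLast?_eq_some_getLast (by simp)] at h3; simpa using h3
  let p := (SimpleGraph.Walk.ofSupport (a :: m) (by simp) h1)
  have hps : p.support = a :: m := SimpleGraph.Walk.support_ofSupport _ _
  have hpl : p.length = m.length := by
    have := p.length_support; rw [hps] at this; simpa using this.symm
  have hp : p.IsPath := by rw [SimpleGraph.Walk.isPath_def, hps]; exact h4
  obtain ⟨q, hq, hql⟩ : ∃ q : G.Walk a b, q.IsPath ∧ q.length = m.length := by
    clear_value p
    subst hlast
    exact ⟨p, hp, hpl⟩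
  have hc : (SimpleGraph.Walk.cons hab q).IsCycle := by
    rw [SimpleGraph.Walk.cons_isCycle_iff]
    refine ⟨hq, fun he => ?_⟩
    have hq2 : 2 ≤ q.length := by simp at hl; omega
    cases q with
    | nil => simp at hq2
    | @cons _ w _ hadj r =>
      rw [SimpleGraph.Walk.edges_cons, List.mem_cons] at he
      rw [SimpleGraph.Walk.cons_isPath_iff] at hq
      rcases he with he | he
      · have : b = w := by
          rcases Sym2.eq_iff.1 he with ⟨e1, _⟩ | ⟨e1, _⟩
          · exact absurd e1 hab.ne
          · exact e1
        subst this
        simp at hq2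
        have h0 := SimpleGraph.Walk.length_eq_zero_iff.2 (SimpleGraph.Walk.isPath_iff_nil.1 hq.1)
        omega
      · exact hq.2 (r.snd_mem_support_of_mem_edges he)
  have := hcyc _ _ hc
  simp at this ⊢; omega

/-- The integer interval between `i` and `j`, listed from `i` to `j`. -/
def blk (i j : ℕ) : List ℕ :=
  if i ≤ j then List.range' i (j + 1 - i) else (List.range' j (i + 1 - j)).reverse

theorem mem_blk {i j m : ℕ} : m ∈ blk i j ↔ (i ≤ m ∧ m ≤ j) ∨ (j ≤ m ∧ m ≤ i) := by
  unfold blk; split_ifs <;> simp [List.mem_range'_1] <;> omega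

theorem length_blk (i j : ℕ) : (blk i j).length = (j - i) + (i - j) + 1 := by
  unfold blk; split_ifs <;> simp <;> omega

theorem pth_range' {u : ℕ → V} {i l : ℕ} (hadj : ∀ m, i ≤ m → m < i + l → G.Adj (u m) (u (m + 1)))
    (hinj : ∀ a b, i ≤ a → a ≤ i + l → i ≤ b → b ≤ i + l → u a = u b → a = b) :
    Pth G (u i) (u (i + l)) ((List.range' i (l + 1)).map u) := by
  induction l with
  | zero => simpa using Pth.single (u i)
  | succ l ih =>
    have := ih (fun m h1 h2 => hadj m h1 (by omega))
      (fun a b h1 h2 h3 h4 => hinj a b h1 (by omega) h3 (by omega))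
    rw [List.range'_concat, List.map_append]
    simp only [one_mul, List.map_cons, List.map_nil]
    refine this.concat (hadj _ (by omega) (by omega)) ?_
    simp only [List.mem_map, List.mem_range'_1, not_exists, not_and]
    intro x hx he
    have := hinj x (i + (l + 1)) hx.1 (by omega) (by omega) (by omega) he
    omega

theorem pth_blk {u : ℕ → V} {i j : ℕ}
    (hadj : ∀ m, (i ≤ m ∧ m < j) ∨ (j ≤ m ∧ m < i) → G.Adj (u m) (u (m + 1)))
    (hinj : ∀ a ∈ blk i j, ∀ b ∈ blk i j, u a = u b → a = b) :
    Pth G (u i) (u j) ((blk i j).map u) := by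
  simp only [mem_blk] at hinj
  unfold blk
  split_ifs with h
  · have := pth_range' (G := G) (u := u) (i := i) (l := j - i) (fun m h1 h2 => hadj m (by omega))
      (fun a b h1 h2 h3 h4 he => hinj a (by omega) b (by omega) he)
    rw [show i + (j - i) = j by omega] at this
    rwa [show j + 1 - i = j - i + 1 by omega]
  · have := pth_range' (G := G) (u := u) (i := j) (l := i - j) (fun m h1 h2 => hadj m (by omega))
      (fun a b h1 h2 h3 h4 he => hinj a (by omega) b (by omega) he)
    rw [show j + (i - j) = i by omega] at this
    rw [show i + 1 - j = i - j + 1 by omega, List.map_reverse]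
    exact this.reverse

/-- The indices of two blocks do not overlap. -/
def BlkDisj (p q : ℕ × ℕ) : Prop :=
  (p.1 < q.1 ∧ p.1 < q.2 ∧ p.2 < q.1 ∧ p.2 < q.2) ∨ (q.1 < p.1 ∧ q.1 < p.2 ∧ q.2 < p.1 ∧ q.2 < p.2)

/-- Concatenating blocks of consecutive vertices gives a path. -/
theorem pth_blocks {u : ℕ → V} {M : ℕ} (hinj : ∀ a b, a < M → b < M → u a = u b → a = b)
    (bs : List (ℕ × ℕ)) (b : ℕ × ℕ) (hM : ∀ p ∈ b :: bs, p.1 < M ∧ p.2 < M)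
    (hadj : ∀ p ∈ b :: bs, ∀ m, (p.1 ≤ m ∧ m < p.2) ∨ (p.2 ≤ m ∧ m < p.1) →
      G.Adj (u m) (u (m + 1)))
    (hj : (b :: bs).IsChain (fun p q => G.Adj (u p.2) (u q.1)))
    (hd : (b :: bs).Pairwise BlkDisj) :
    Pth G (u b.1) (u ((b :: bs).getLast (by simp)).2)
      (((b :: bs).flatMap (fun p => blk p.1 p.2)).map u) := by
  induction bs generalizing b with
  | nil =>
    simp only [List.getLast_singleton, List.flatMap_cons, List.flatMap_nil, List.append_nil]
    refine pth_blk (hadj b (by simp)) fun x hx y hy => hinj x y ?_ ?_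
    · have := hM b (by simp); rw [mem_blk] at hx; omega
    · have := hM b (by simp); rw [mem_blk] at hy; omega
  | cons c bs ih =>
    have h2 := ih c (fun p hp => hM p (by simp at hp ⊢; tauto))
      (fun p hp => hadj p (by simp at hp ⊢; tauto))
      (by simp at hj ⊢; tauto) (by simp at hd ⊢; tauto)
    have hMb := hM b (by simp)
    have h1 : Pth G (u b.1) (u b.2) ((blk b.1 b.2).map u) := by
      refine pth_blk (hadj b (by simp)) fun x hx y hy => hinj x y ?_ ?_
      · rw [mem_blk] at hx; omega
      · rw [mem_blk] at hy; omega
    rw [List.flatMap_cons, List.map_append, List.getLast_cons (by simp)]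
    refine h1.append h2 ?_ ?_
    · simp at hj; exact hj.1
    · intro x hx hx'
      rw [List.mem_map] at hx hx'
      obtain ⟨m, hm, rfl⟩ := hx
      obtain ⟨m', hm', he⟩ := hx'
      rw [List.mem_flatMap] at hm'
      obtain ⟨p, hp, hm'⟩ := hm'
      have hMp := hM p (by simp at hp ⊢; tauto)
      have hdp : BlkDisj b p := by
        rw [List.pairwise_cons] at hd; exact hd.1 p hp
      rw [mem_blk] at hm hm'
      have := hinj m' m (by omega) (by omega) he
      unfold BlkDisj at hdp
      omega

theorem length_blocks (bs : List (ℕ × ℕ)) (u : ℕ → V) :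
    ((bs.flatMap (fun p => blk p.1 p.2)).map u).length
      = (bs.map fun p => (p.2 - p.1) + (p.1 - p.2) + 1).sum := by
  simp [length_blk, List.length_flatMap]

/-- A closed sequence of blocks is a cycle, hence short. -/
theorem NoLong.blocks {k : ℕ} (h : NoLong G k) {u : ℕ → V} {M : ℕ}
    (hinj : ∀ a b, a < M → b < M → u a = u b → a = b)
    (b : ℕ × ℕ) (bs : List (ℕ × ℕ)) (hM : ∀ p ∈ b :: bs, p.1 < M ∧ p.2 < M)
    (hadj : ∀ p ∈ b :: bs, ∀ m, (p.1 ≤ m ∧ m < p.2) ∨ (p.2 ≤ m ∧ m < p.1) →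
      G.Adj (u m) (u (m + 1)))
    (hj : (b :: bs).IsChain (fun p q => G.Adj (u p.2) (u q.1)))
    (hd : (b :: bs).Pairwise BlkDisj)
    (hcl : G.Adj (u ((b :: bs).getLast (by simp)).2) (u b.1)) :
    ((b :: bs).map fun p => (p.2 - p.1) + (p.1 - p.2) + 1).sum < k := by
  rw [← length_blocks _ u]
  exact h _ _ _ (pth_blocks hinj bs b hM hadj hj hd) hcl

theorem Pth.rest_ne {a b c : V} {m : List V} (h : Pth G a b (a :: c :: m)) : a ≠ b := by
  rintro rfl
  have := h.singleton_of_eq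
  simp at this

/-- Replacing the part of a path after `x` by another path starting at `x`. -/
theorem Pth.splice {a b x e : V} {l m L : List V} (h : Pth G a b (l ++ x :: m)) (hL : Pth G x e L)
    (hd : ∀ y ∈ l ++ x :: m, y ∈ L → y = x) : Pth G a e (l ++ L) := by
  obtain ⟨L', rfl⟩ := hL.eq_cons
  cases L' with
  | nil =>
    have := hL.2.2.1
    simp at this; subst this
    exact h.split.1
  | cons y L' =>
    obtain ⟨h1, h2, h3⟩ := hL.tail
    have := h.split.1.append h2 h1 (by
      intro z hz hz'
      have : z = x := hd z (by simp at hz ⊢; tauto) (by simp at hz' ⊢; tauto)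
      subst this
      exact h3 hz')
    simpa using this

theorem two_paths_aux (hL : Link G) {S T : Set V} {s t : V} (htT : t ∈ T) (hT : ∃ b ∈ T, b ≠ t)
    (B : List V) : ∀ z, Pth G z t (z :: B) → (∀ x ∈ B, x ∉ S) → (∀ x ∈ z :: B, x ∈ T → x = t) →
    (∃ a₁ a₂ e U W, Pth G a₁ z U ∧ Pth G a₂ e W ∧ (∀ x ∈ U, x ∉ W) ∧ a₁ ∈ S ∧ a₂ ∈ S ∧
      (a₁ = s ∨ a₂ = s) ∧ (e ∈ B ∨ e ∈ T) ∧ (∀ x ∈ U, x ∈ S → x = a₁) ∧ (∀ x ∈ U, x ∉ B) ∧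
      (∀ x ∈ U, x ∈ T → x = z) ∧ (∀ x ∈ W, x ∈ S → x = a₂) ∧ (∀ x ∈ W, x ∈ B ∨ x ∈ T → x = e)) →
    ∃ a₁ a₂ e U W, Pth G a₁ t U ∧ Pth G a₂ e W ∧ (∀ x ∈ U, x ∉ W) ∧ a₁ ∈ S ∧ a₂ ∈ S ∧
      (a₁ = s ∨ a₂ = s) ∧ e ∈ T ∧ (∀ x ∈ U, x ∈ S → x = a₁) ∧
      (∀ x ∈ U, x ∈ T → x = t) ∧ (∀ x ∈ W, x ∈ S → x = a₂) ∧ (∀ x ∈ W, x ∈ T → x = e) := by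
  induction B with
  | nil =>
    rintro z hz - - ⟨a₁, a₂, e, U, W, hU, hW, hd, h1, h2, h3, h4, h5, h6, h7, h8, h9⟩
    have : z = t := by simpa using hz.2.2.1
    subst this
    exact ⟨a₁, a₂, e, U, W, hU, hW, hd, h1, h2, h3, by simpa using h4, h5, h7, h8,
      fun x hx hxT => h9 x hx (Or.inr hxT)⟩
  | cons y B ih =>
    rintro z hz hBS hBT ⟨a₁, a₂, e, U, W, hU, hW, hd, h1, h2, h3, h4, h5, h6, h7, h8, h9⟩
    obtain ⟨hzy, hy, hzn⟩ := hz.tail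
    have hzt : z ≠ t := hz.rest_ne
    have hzT : z ∉ T := fun h => hzt (hBT z (by simp) h)
    have hUT : ∀ x ∈ U, x ∉ T := fun x hx hxT => hzT (h7 x hx hxT ▸ hxT)
    have hyU : y ∉ U := fun h => h6 y h (by simp)
    have hyB : y ∉ B := by have := hy.nodup; simp at this; exact this.1
    have hyS : y ∉ S := hBS y (by simp)
    have hUy : Pth G a₁ y (U ++ [y]) := hU.concat hzy hyU
    refine ih y hy (fun x hx => hBS x (by simp [hx])) (fun x hx => hBT x (by simp at hx ⊢; tauto)) ?_
    by_cases hey : e = y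
    · subst hey
      have htgt : ∃ b ∈ {x | x ∈ B ∨ x ∈ T}, b ≠ e := by
        by_cases het : e = t
        · obtain ⟨b, hb, hbt⟩ := hT
          exact ⟨b, Or.inr hb, het ▸ hbt⟩
        · exact ⟨t, Or.inr htT, fun h => het h.symm⟩
      obtain ⟨x, hx, e', he', L, hLp, hLe, hLS, hLT⟩ := hL e {x | x ∈ S ∨ x ∈ U ∨ x ∈ W}
        {x | x ∈ B ∨ x ∈ T} ⟨z, Or.inr (Or.inl hU.last_mem), by
          rintro rfl; exact hyU hU.last_mem⟩ htgt
      simp only [Set.mem_ofPred_eq] at hx he' hLS hLT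
      have hxL := hLp.head_mem
      by_cases hxU : x ∈ U
      · obtain ⟨U1, U2, rfl⟩ := List.append_of_mem hxU
        have hnew := hU.splice hLp (fun y hy hyL => hLS y hyL (Or.inr (Or.inl hy)))
        refine ⟨a₂, a₁, e', W, U1 ++ L, hW, hnew, ?_, h2, h1, h3.symm, he', h8, ?_, ?_, ?_, ?_⟩
        · intro w hw hw'
          rcases List.mem_append.1 hw' with hw' | hw'
          · exact hd w (by simp [hw']) hw
          · have := hLS w hw' (Or.inr (Or.inr hw))
            subst this; exact hd _ hxU hw
        · intro w hw hwB
          have := h9 w hw (Or.inl (by simp [hwB]))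
          subst this; exact hyB hwB
        · intro w hw hwT
          exact h9 w hw (Or.inr hwT)
        · intro w hw hwS
          rcases List.mem_append.1 hw with hw | hw
          · exact h5 w (by simp [hw]) hwS
          · have := hLS w hw (Or.inl hwS)
            subst this; exact h5 _ hxU hwS
        · intro w hw hwT
          rcases List.mem_append.1 hw with hw | hw
          · exfalso
            rcases hwT with h | h
            · exact h6 w (by simp [hw]) (by simp [h])
            · exact hUT w (by simp [hw]) h
          · exact hLT w hw hwT
      by_cases hxW : x ∈ W
      · obtain ⟨W1, W2, rfl⟩ := List.append_of_mem hxW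
        have hnew := hW.splice hLp (fun y hy hyL => hLS y hyL (Or.inr (Or.inr hy)))
        have hxe : x ≠ e := by rintro rfl; exact hLe hxL
        have heW1 : e ∉ W1 := by
          intro h
          have h' := hW.split.2.last_mem
          have := hW.nodup
          rw [List.nodup_append] at this
          exact this.2.2 e h e h' rfl
        refine ⟨a₁, a₂, e', U ++ [e], W1 ++ L, hUy, hnew, ?_, h1, h2, h3, he', ?_, ?_, ?_, ?_, ?_⟩
        · intro w hw hw'
          simp only [List.mem_append, List.mem_singleton] at hw hw'
          rcases hw with hw | rfl
          · rcases hw' with hw' | hw'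
            · exact hd w hw (by simp [hw'])
            · have := hLS w hw' (Or.inr (Or.inl hw))
              subst this; exact hxU hw
          · rcases hw' with hw' | hw'
            · exact heW1 hw'
            · exact hLe hw'
        · intro w hw hwS
          simp only [List.mem_append, List.mem_singleton] at hw
          rcases hw with hw | rfl
          · exact h5 w hw hwS
          · exact absurd hwS hyS
        · intro w hw hwB
          simp only [List.mem_append, List.mem_singleton] at hw
          rcases hw with hw | rfl
          · exact h6 w hw (by simp [hwB])
          · exact hyB hwB
        · intro w hw hwT
          simp only [List.mem_append, List.mem_singleton] at hw
          rcases hw with hw | rfl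
          · exact absurd hwT (hUT w hw)
          · rfl
        · intro w hw hwS
          rcases List.mem_append.1 hw with hw | hw
          · exact h8 w (by simp [hw]) hwS
          · have := hLS w hw (Or.inl hwS)
            subst this; exact h8 _ hxW hwS
        · intro w hw hwT
          rcases List.mem_append.1 hw with hw | hw
          · exfalso
            have := h9 w (by simp [hw]) (by simp; tauto)
            subst this; exact heW1 hw
          · exact hLT w hw hwT
      have hxS : x ∈ S := by tauto
      by_cases has : a₁ = s
      · refine ⟨a₁, x, e', U ++ [e], L, hUy, hLp, ?_, h1, hxS, Or.inl has, he', ?_, ?_, ?_, ?_, ?_⟩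
        · intro w hw hw'
          simp only [List.mem_append, List.mem_singleton] at hw
          rcases hw with hw | rfl
          · have := hLS w hw' (Or.inr (Or.inl hw))
            subst this; exact hxU hw
          · exact hLe hw'
        · intro w hw hwS
          simp only [List.mem_append, List.mem_singleton] at hw
          rcases hw with hw | rfl
          · exact h5 w hw hwS
          · exact absurd hwS hyS
        · intro w hw hwB
          simp only [List.mem_append, List.mem_singleton] at hw
          rcases hw with hw | rfl
          · exact h6 w hw (by simp [hwB])
          · exact hyB hwB
        · intro w hw hwT
          simp only [List.mem_append, List.mem_singleton] at hw
          rcases hw with hw | rfl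
          · exact absurd hwT (hUT w hw)
          · rfl
        · exact fun w hw hwS => hLS w hw (Or.inl hwS)
        · exact hLT
      · have has2 : a₂ = s := by tauto
        refine ⟨a₂, x, e', W, L, hW, hLp, ?_, h2, hxS, Or.inl has2, he', h8, ?_, ?_, ?_, hLT⟩
        · intro w hw hw'
          have := hLS w hw' (Or.inr (Or.inr hw))
          subst this; exact hxW hw
        · intro w hw hwB
          have := h9 w hw (Or.inl (by simp [hwB]))
          subst this; exact hyB hwB
        · intro w hw hwT
          exact h9 w hw (Or.inr hwT)
        · exact fun w hw hwS => hLS w hw (Or.inl hwS)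
    · refine ⟨a₁, a₂, e, U ++ [y], W, hUy, hW, ?_, h1, h2, h3, ?_, ?_, ?_, ?_, h8, ?_⟩
      · intro w hw hw'
        simp only [List.mem_append, List.mem_singleton] at hw
        rcases hw with hw | rfl
        · exact hd w hw hw'
        · exact hey (h9 w hw' (Or.inl (by simp))).symm
      · rcases h4 with h | h
        · simp at h; tauto
        · exact Or.inr h
      · intro w hw hwS
        simp only [List.mem_append, List.mem_singleton] at hw
        rcases hw with hw | rfl
        · exact h5 w hw hwS
        · exact absurd hwS hyS
      · intro w hw hwB
        simp only [List.mem_append, List.mem_singleton] at hw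
        rcases hw with hw | rfl
        · exact h6 w hw (by simp [hwB])
        · exact hyB hwB
      · intro w hw hwT
        simp only [List.mem_append, List.mem_singleton] at hw
        rcases hw with hw | rfl
        · exact absurd hwT (hUT w hw)
        · rfl
      · intro w hw hwT
        exact h9 w hw (by simp; tauto)

/-- Menger for two paths, keeping the end vertices of a given path. -/
theorem two_paths (hL : Link G) {S T : Set V} {s t : V} {R : List V} (hR : Pth G s t R)
    (hs : s ∈ S) (ht : t ∈ T) (hRS : ∀ x ∈ R, x ∈ S → x = s) (hRT : ∀ x ∈ R, x ∈ T → x = t)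
    (hS : ∃ a ∈ S, a ≠ s) (hT : ∃ b ∈ T, b ≠ t) :
    ∃ a₁ a₂ e U W, Pth G a₁ t U ∧ Pth G a₂ e W ∧ (∀ x ∈ U, x ∉ W) ∧ a₁ ∈ S ∧ a₂ ∈ S ∧
      (a₁ = s ∨ a₂ = s) ∧ e ∈ T ∧ (∀ x ∈ U, x ∈ S → x = a₁) ∧
      (∀ x ∈ U, x ∈ T → x = t) ∧ (∀ x ∈ W, x ∈ S → x = a₂) ∧ (∀ x ∈ W, x ∈ T → x = e) := by
  obtain ⟨B, rfl⟩ := hR.eq_cons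
  have hsB : s ∉ B := by have := hR.nodup; simp at this; exact this.1
  refine two_paths_aux hL ht hT B s hR (fun x hx hxS => ?_) hRT ?_
  · have := hRS x (by simp [hx]) hxS
    subst this; exact hsB hx
  · have htgt : ∃ b ∈ {x | x ∈ B ∨ x ∈ T}, b ≠ s := by
      by_cases hst : s = t
      · obtain ⟨b, hb, hbt⟩ := hT
        exact ⟨b, Or.inr hb, hst ▸ hbt⟩
      · exact ⟨t, Or.inr ht, fun h => hst h.symm⟩
    obtain ⟨a, ha, e, he, L, h1, h2, h3, h4⟩ := hL s S _ hS htgt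
    refine ⟨s, a, e, [s], L, Pth.single s, h1, by simpa using h2, hs, ha, Or.inl rfl, he, ?_, ?_,
      ?_, h3, h4⟩ <;> simp [hsB]

theorem exists_two_paths (hL : Link G) {S T : Set V} {s s' t t' : V} (hs : s ∈ S) (hs' : s' ∈ S)
    (hss : s ≠ s') (ht : t ∈ T) (ht' : t' ∈ T) (htt : t ≠ t') :
    ∃ a₁ a₂ b₁ b₂ U W, Pth G a₁ b₁ U ∧ Pth G a₂ b₂ W ∧ (∀ x ∈ U, x ∉ W) ∧ a₁ ∈ S ∧ a₂ ∈ S ∧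
      b₁ ∈ T ∧ b₂ ∈ T ∧ (∀ x ∈ U, x ∈ S → x = a₁) ∧
      (∀ x ∈ U, x ∈ T → x = b₁) ∧ (∀ x ∈ W, x ∈ S → x = a₂) ∧ (∀ x ∈ W, x ∈ T → x = b₂) := by
  have other : ∀ {X : Set V} {x y : V} (z : V), x ∈ X → y ∈ X → x ≠ y → ∃ a ∈ X, a ≠ z := by
    intro X x y z hx hy hxy
    by_cases h : x = z
    · exact ⟨y, hy, fun h' => hxy (h.trans h'.symm)⟩
    · exact ⟨x, hx, h⟩
  obtain ⟨a, ha, b, hb, R, h1, h2, h3, h4⟩ := hL s S T (other s hs hs' hss) (other s ht ht' htt)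
  obtain ⟨a₁, a₂, e, U, W, g1, g2, g3, g4, g5, -, g6, g7, g8, g9, g10⟩ :=
    two_paths hL h1 ha hb h3 h4 (other a hs hs' hss) (other b ht ht' htt)
  exact ⟨a₁, a₂, b, e, U, W, g1, g2, g3, g4, g5, hb, g6, g7, g8, g9, g10⟩

theorem Pth.unconcat {a b : V} {l : List V} (h : Pth G a b l) (hab : a ≠ b) :
    ∃ m y, l = m ++ [b] ∧ Pth G a y m ∧ G.Adj y b ∧ b ∉ m := by
  obtain ⟨m, hm⟩ := h.reverse.eq_cons
  have hl : l = m.reverse ++ [b] := by simpa using congrArg List.reverse hm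
  cases m with
  | nil =>
    subst hl
    have := h.2.1
    simp at this; exact absurd this.symm hab
  | cons c m =>
    have h' := h.reverse
    rw [hm] at h'
    obtain ⟨h1, h2, h3⟩ := h'.tail
    exact ⟨(c :: m).reverse, c, hl, h2.reverse, h1.symm, by simpa [and_comm] using h3⟩

theorem isStarForest_of_no_path {W : Type*} {F : SimpleGraph W}
    (htri : ∀ a b c, F.Adj a b → F.Adj b c → F.Adj a c → False)
    (hpath : ∀ a b c d, F.Adj a b → F.Adj b c → F.Adj c d → a ≠ c → b ≠ d → a ≠ d → False) :
    IsStarForest F := by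
  intro v
  obtain ⟨x, hvx, hx⟩ : ∃ x, (v = x ∨ F.Adj x v) ∧ ∀ y, F.Adj x y → ∀ z, F.Adj y z → z = x := by
    by_cases h0 : ∃ y, F.Adj v y
    · obtain ⟨y, hy⟩ := h0
      by_cases h1 : ∃ y', F.Adj v y' ∧ y' ≠ y
      · obtain ⟨y', hy', hne⟩ := h1
        refine ⟨v, Or.inl rfl, fun p hp z hz => ?_⟩
        by_contra hzv
        obtain ⟨q, hq, hqp⟩ : ∃ q, F.Adj v q ∧ q ≠ p := by
          by_cases h : y = p
          · exact ⟨y', hy', h ▸ hne⟩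
          · exact ⟨y, hy, h⟩
        by_cases hqz : q = z
        · subst hqz; exact htri _ _ _ hp hz hq
        · exact hpath q v p z hq.symm hp hz hqp (fun h => hzv h.symm) hqz
      · push Not at h1
        refine ⟨y, Or.inr hy.symm, fun p hp z hz => ?_⟩
        by_contra hzy
        by_cases hpv : p = v
        · subst hpv; exact hzy (h1 z hz)
        by_cases hzv : z = v
        · subst hzv; exact hp.ne (h1 p hz.symm).symm
        · exact hpath v y p z hy hp hz (fun h => hpv h.symm) (fun h => hzy h.symm)
            (fun h => hzv h.symm)
    · exact ⟨v, Or.inl rfl, fun y hy => absurd ⟨y, hy⟩ h0⟩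
  have hcomp : ∀ a b, F.Reachable a b → (a = x ∨ F.Adj x a) → (b = x ∨ F.Adj x b) := by
    rintro a b ⟨p⟩
    induction p with
    | nil => exact id
    | cons h p ih =>
      intro ha
      apply ih
      rcases ha with rfl | ha
      · exact Or.inr h
      · exact Or.inl (hx _ ha _ h)
  refine ⟨x, fun a b hab har => ?_⟩
  rcases hcomp v a har.symm (by tauto) with h | h
  · exact Or.inl h
  · exact Or.inr (hx a h b hab)

/-- If every path of `G - A` attached to two distinct vertices of `A` has at most two
vertices, then `G - A` is a star forest. -/
theorem isStarForest_of_attached (hL : Link G) (A : Finset V) {α β : V} (hα : α ∈ A) (hβ : β ∈ A)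
    (hαβ : α ≠ β)
    (hQ : ∀ x y Q, Pth G x y Q → (∀ z ∈ Q, z ∉ A) → ∀ a ∈ A, ∀ b ∈ A, a ≠ b → G.Adj a x →
      G.Adj y b → Q.length ≤ 2) : IsStarForest (G.induce {v : V | v ∉ A}) := by
  have half : ∀ w₁ w₂ w₃ w₄ a b, G.Adj w₁ w₂ → G.Adj w₂ w₃ → G.Adj w₃ w₄ → w₁ ≠ w₃ → w₁ ≠ w₄ →
      w₂ ≠ w₄ → w₁ ∉ A → w₂ ∉ A → w₃ ∉ A → w₄ ∉ A → a ∈ A → b ∈ A → a ≠ b → G.Adj w₂ a →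
      G.Adj w₃ b → G.Adj w₁ b := by
    intro w₁ w₂ w₃ w₄ a b h12 h23 h34 n13 n14 n24 o1 o2 o3 o4 ha hb hab h2a h3b
    obtain ⟨s, hs, t, ht, L, hLp, hL2, -, hLT⟩ := hL w₂ {w₁} {x | x = w₃ ∨ x = w₄ ∨ x ∈ A}
      ⟨w₁, rfl, h12.ne⟩ ⟨w₃, Or.inl rfl, h23.ne'⟩
    simp only [Set.mem_singleton_iff] at hs
    subst hs
    simp only [Set.mem_ofPred_eq] at ht hLT
    by_cases htA : t ∈ A
    · obtain ⟨L', y, rfl, hL', hyt, htL'⟩ := hLp.unconcat (fun h => o1 (h ▸ htA))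
      have offA : ∀ z ∈ L', z ∉ A := fun z hz hzA =>
        htL' (hLT z (by simp [hz]) (Or.inr (Or.inr hzA)) ▸ hz)
      have hw2 : w₂ ∉ L' := fun h => hL2 (by simp [h])
      have hw3 : w₃ ∉ L' := fun h => htL' (hLT w₃ (by simp [h]) (Or.inl rfl) ▸ h)
      have hP2 := hL'.cons h12.symm hw2
      by_cases htb : t = b
      · subst htb
        have := hQ _ _ _ hP2 (by simp [o2]; exact offA) a ha t hb hab h2a.symm hyt
        have h1 : L'.length ≤ 1 := by simp at this; omega
        obtain ⟨m, rfl⟩ := hL'.eq_cons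
        have : m = [] := by simpa using h1
        subst this
        have := hL'.2.2.1
        simp at this; subst this; exact hyt
      · exfalso
        have hP3 := hP2.cons h23.symm (by simp [h23.ne', hw3])
        have := hQ _ _ _ hP3 (by simp [o2, o3]; exact offA) b hb t htA (Ne.symm htb) h3b.symm hyt
        have := hL'.length_pos
        simp only [List.length_cons, List.length_append, List.length_nil] at *; omega
    · exfalso
      have offA : ∀ z ∈ L, z ∉ A := fun z hz hzA =>
        htA (hLT z hz (Or.inr (Or.inr hzA)) ▸ hzA)
      have hP2 := hLp.cons h12.symm hL2
      rcases ht with rfl | rfl | ht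
      · have := hQ _ _ _ hP2 (by simp [o2]; exact offA) a ha b hb hab h2a.symm h3b
        obtain ⟨L', y, rfl, hL', -, -⟩ := hLp.unconcat n13
        have := hL'.length_pos
        simp only [List.length_cons, List.length_append, List.length_nil] at *; omega
      · have hw3 : w₃ ∉ L := fun h => h34.ne (hLT _ h (Or.inl rfl))
        have hP3 := hP2.concat h34.symm (by simp [h23.ne', hw3])
        have := hQ _ _ _ hP3 (by
          intro z hz
          simp at hz
          rcases hz with rfl | hz | rfl
          exacts [o2, offA _ hz, o3]) a ha b hb hab h2a.symm h3b
        have := hLp.length_pos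
        simp only [List.length_cons, List.length_append, List.length_nil] at *; omega
      · exact htA ht
  have core23 : ∀ w₁ w₂ w₃ w₄ a b, G.Adj w₁ w₂ → G.Adj w₂ w₃ → G.Adj w₃ w₄ → w₁ ≠ w₃ → w₁ ≠ w₄ →
      w₂ ≠ w₄ → w₁ ∉ A → w₂ ∉ A → w₃ ∉ A → w₄ ∉ A → a ∈ A → b ∈ A → a ≠ b → G.Adj w₂ a →
      G.Adj w₃ b → False := by
    intro w₁ w₂ w₃ w₄ a b h12 h23 h34 n13 n14 n24 o1 o2 o3 o4 ha hb hab h2a h3b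
    have h1 := half w₁ w₂ w₃ w₄ a b h12 h23 h34 n13 n14 n24 o1 o2 o3 o4 ha hb hab h2a h3b
    have h4 := half w₄ w₃ w₂ w₁ b a h34.symm h23.symm h12.symm n24.symm n14.symm n13.symm
      o4 o3 o2 o1 hb ha hab.symm h3b h2a
    have := hQ w₁ w₄ [w₁, w₂, w₃, w₄] (by
      simp [Pth, h12, h23, h34, n13, n14, n24, h12.ne, h23.ne, h34.ne]) (by simp [*]) b hb a ha
      hab.symm h1.symm h4
    simp at this
  have core12 : ∀ w₁ w₂ w₃ w₄ a b, G.Adj w₁ w₂ → G.Adj w₂ w₃ → G.Adj w₃ w₄ → w₁ ≠ w₃ → w₁ ≠ w₄ →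
      w₂ ≠ w₄ → w₁ ∉ A → w₂ ∉ A → w₃ ∉ A → w₄ ∉ A → a ∈ A → b ∈ A → a ≠ b → G.Adj w₁ a →
      G.Adj w₂ b → False := by
    intro w₁ w₂ w₃ w₄ a b h12 h23 h34 n13 n14 n24 o1 o2 o3 o4 ha hb hab h1a h2b
    obtain ⟨s, hs, t, ht, L, hLp, hL2, hLS, hLT⟩ := hL w₂ {x | x = w₃ ∨ x = w₄} {x | x = w₁ ∨ x ∈ A}
      ⟨w₃, Or.inl rfl, h23.ne'⟩ ⟨w₁, Or.inl rfl, h12.ne⟩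
    simp only [Set.mem_ofPred_eq] at hs ht hLS hLT
    have hsA : s ∉ A := by rcases hs with rfl | rfl <;> assumption
    by_cases htA : t ∈ A
    · have ht1 : t ≠ w₁ := fun h => o1 (h ▸ htA)
      obtain ⟨L', y, rfl, hL', hyt, htL'⟩ := hLp.unconcat (fun h => hsA (h ▸ htA))
      have offA : ∀ z ∈ L', z ∉ A := fun z hz hzA =>
        htL' (hLT z (by simp [hz]) (Or.inr hzA) ▸ hz)
      have hw2 : w₂ ∉ L' := fun h => hL2 (by simp [h])
      have hw1 : w₁ ∉ L' := fun h => htL' (hLT w₁ (by simp [h]) (Or.inl rfl) ▸ h)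
      obtain ⟨M, hM, hMw, hML⟩ : ∃ M, Pth G w₃ y M ∧ (∀ z ∈ M, z = w₃ ∨ z ∈ L') ∧
          (M.length = 1 → G.Adj w₃ t) := by
        rcases hs with rfl | rfl
        · refine ⟨L', hL', fun z hz => Or.inr hz, fun h => ?_⟩
          obtain ⟨m, rfl⟩ := hL'.eq_cons
          have : m = [] := by simpa using h
          subst this
          have := hL'.2.2.1
          simp at this; subst this; exact hyt
        · have hw3 : w₃ ∉ L' := fun h => h34.ne (hLS w₃ (by simp [h]) (Or.inl rfl))
          refine ⟨w₃ :: L', hL'.cons h34 hw3, fun z hz => by simpa using hz, fun h => ?_⟩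
          have := hL'.length_pos
          simp at h; simp [h] at this
      have hMA : ∀ z ∈ M, z ∉ A := fun z hz => by
        rcases hMw z hz with rfl | h
        exacts [o3, offA z h]
      have hP2 := hM.cons h23 (by
        intro h; rcases hMw _ h with h | h
        exacts [h23.ne h, hw2 h])
      by_cases hta : t = a
      · subst hta
        have := hQ _ _ _ hP2 (by simp [o2]; exact hMA) b hb t ha hab.symm h2b.symm hyt
        have h1 := hM.length_pos
        have h3t := hML (by simp at this; omega)
        exact core23 w₁ w₂ w₃ w₄ b t h12 h23 h34 n13 n14 n24 o1 o2 o3 o4 hb ha hab.symm h2b h3t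
      · have hP1 := hP2.cons h12 (by
          intro h
          rcases List.mem_cons.1 h with h | h
          · exact h12.ne h
          rcases hMw _ h with h | h
          exacts [n13 h, hw1 h])
        have := hQ _ _ _ hP1 (by simp [o1, o2]; exact hMA) a ha t htA (Ne.symm hta) h1a.symm hyt
        have h1 := hM.length_pos
        simp only [List.length_cons, List.length_append, List.length_nil] at this; omega
    · have ht1 : t = w₁ := by tauto
      subst ht1
      have offA : ∀ z ∈ L, z ∉ A := fun z hz hzA =>
        htA (hLT z hz (Or.inr hzA) ▸ hzA)
      obtain ⟨M, hM, hMw⟩ : ∃ M, Pth G w₃ t M ∧ (∀ z ∈ M, z = w₃ ∨ z ∈ L) := by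
        rcases hs with rfl | rfl
        · exact ⟨L, hLp, fun z hz => Or.inr hz⟩
        · have hw3 : w₃ ∉ L := fun h => h34.ne (hLS w₃ h (Or.inl rfl))
          exact ⟨w₃ :: L, hLp.cons h34 hw3, fun z hz => by simpa using hz⟩
      have hMA : ∀ z ∈ M, z ∉ A := fun z hz => by
        rcases hMw z hz with rfl | h
        exacts [o3, offA z h]
      have hP2 := hM.cons h23 (by
        intro h; rcases hMw _ h with h | h
        exacts [h23.ne h, hL2 h])
      have := hQ _ _ _ hP2 (by simp [o2]; exact hMA) b hb a ha hab.symm h2b.symm h1a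
      obtain ⟨M', y, rfl, hM', -, -⟩ := hM.unconcat n13.symm
      have h1 := hM'.length_pos
      simp only [List.length_cons, List.length_append, List.length_nil] at this; omega
  have twoAtt : ∀ (S : Set V) (s s' : V), s ∈ S → s' ∈ S → s ≠ s' → (∀ z ∈ S, z ∉ A) →
      ∃ x ∈ S, ∃ y ∈ S, ∃ a ∈ A, ∃ b ∈ A, a ≠ b ∧ x ≠ y ∧ ∃ x' y' U W, Pth G x' x U ∧ Pth G y y' W ∧
        G.Adj a x' ∧ G.Adj y' b ∧ (∀ z ∈ U, z ∈ S → z = x) ∧ (∀ z ∈ W, z ∈ S → z = y) ∧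
        (∀ z ∈ U, z ∉ W) ∧ (∀ z ∈ U, z ∉ A) ∧ (∀ z ∈ W, z ∉ A) := by
    intro S s s' hs hs' hss hSA
    obtain ⟨x, y, a, b, U, W, hU, hW, hd, hx, hy, ha, hb, h1, h2, h3, h4⟩ :=
      exists_two_paths hL (T := {x | x ∈ A}) hs hs' hss hα hβ hαβ
    simp only [Set.mem_ofPred_eq] at ha hb h2 h4
    obtain ⟨U', x', rfl, hU', hxa, haU⟩ := hU.unconcat (fun h => hSA x hx (h ▸ ha))
    obtain ⟨W', y', rfl, hW', hyb, hbW⟩ := hW.unconcat (fun h => hSA y hy (h ▸ hb))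
    refine ⟨x, hx, y, hy, a, ha, b, hb, ?_, ?_, x', y', U'.reverse, W', hU'.reverse, hW', hxa.symm,
      hyb, ?_, ?_, ?_, ?_, ?_⟩
    · rintro rfl; exact hd a (by simp) (by simp)
    · rintro rfl; exact hd x hU.head_mem hW.head_mem
    · intro z hz; exact h1 z (by simp at hz; simp [hz])
    · intro z hz; exact h3 z (by simp [hz])
    · intro z hz hz'; exact hd z (by simp at hz; simp [hz]) (by simp [hz'])
    · intro z hz hzA
      simp at hz
      have := h2 z (by simp [hz]) hzA
      subst this; exact haU hz
    · intro z hz hzA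
      have := h4 z (by simp [hz]) hzA
      subst this; exact hbW hz
  have long : ∀ (S : Set V) (x y : V), x ∈ S → y ∈ S → ∀ a ∈ A, ∀ b ∈ A, a ≠ b → ∀ x' y' U W,
      Pth G x' x U → Pth G y y' W →
        G.Adj a x' → G.Adj y' b → (∀ z ∈ U, z ∈ S → z = x) → (∀ z ∈ W, z ∈ S → z = y) →
        (∀ z ∈ U, z ∉ W) → (∀ z ∈ U, z ∉ A) → (∀ z ∈ W, z ∉ A) → ∀ p q M, Pth G p q M →
        (∀ z ∈ M, z ∈ S ∧ z ≠ x ∧ z ≠ y) → G.Adj x p → G.Adj q y → (∀ z ∈ S, z ∉ A) → False := by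
    intro S x y hx hy a ha b hb hab x' y' U W hU hW hax hyb h1 h2 h3 h4 h5 p q M hM hMS hxp hqy hSA
    have hP := (hU.append hM hxp (fun z hz hz' => (hMS z hz').2.1 (h1 z hz (hMS z hz').1))).append hW
      hqy (by
        intro z hz hz'
        rcases List.mem_append.1 hz with h | h
        · exact h3 z h hz'
        · exact (hMS z h).2.2 (h2 z hz' (hMS z h).1))
    have := hQ _ _ _ hP (by
      intro z hz
      simp at hz
      rcases hz with h | h | h
      exacts [h4 z h, hSA z (hMS z h).1, h5 z h]) a ha b hb hab hax hyb
    have l1 := hU.length_pos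
    have l2 := hW.length_pos
    have l3 := hM.length_pos
    simp at this; omega
  apply isStarForest_of_no_path
  · rintro ⟨p, hp⟩ ⟨q, hq⟩ ⟨r, hr⟩ hpq hqr hpr
    simp only [SimpleGraph.comap_adj, Function.Embedding.subtype_apply] at hpq hqr hpr
    simp only [Set.mem_ofPred_eq] at hp hq hr
    have hSA : ∀ z ∈ ({p, q, r} : Set V), z ∉ A := by
      rintro z (rfl | rfl | rfl) <;> assumption
    obtain ⟨x, hx, y, hy, a, ha, b, hb, hab, hxy, x', y', U, W, hU, hW, hax, hyb, h1, h2, h3, h4, h5⟩ :=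
      twoAtt {p, q, r} p q (by simp) (by simp) hpq.ne hSA
    obtain ⟨c, hc, hcx, hcy⟩ : ∃ c ∈ ({p, q, r} : Set V), c ≠ x ∧ c ≠ y := by
      by_cases h1 : p ≠ x ∧ p ≠ y
      · exact ⟨p, by simp, h1⟩
      by_cases h2 : q ≠ x ∧ q ≠ y
      · exact ⟨q, by simp, h2⟩
      refine ⟨r, by simp, ?_, ?_⟩ <;> rintro rfl
      · have := hpr.ne; have := hqr.ne; have := hpq.ne; grind
      · have := hpr.ne; have := hqr.ne; have := hpq.ne; grind
    have hadj : ∀ u ∈ ({p, q, r} : Set V), ∀ v ∈ ({p, q, r} : Set V), u ≠ v → G.Adj u v := by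
      rintro u (rfl | rfl | rfl) v (rfl | rfl | rfl) h <;>
        first | exact absurd rfl h | assumption | (apply SimpleGraph.Adj.symm; assumption)
    exact long _ x y hx hy a ha b hb hab x' y' U W hU hW hax hyb h1 h2 h3 h4 h5 c c [c]
      (Pth.single c) (by simp; exact ⟨by simpa using hc, hcx, hcy⟩) (hadj x hx c hc hcx.symm)
      (hadj c hc y hy hcy) hSA
  · rintro ⟨w₁, o1⟩ ⟨w₂, o2⟩ ⟨w₃, o3⟩ ⟨w₄, o4⟩ h12 h23 h34 n13 n24 n14
    simp only [SimpleGraph.comap_adj, Function.Embedding.subtype_apply] at h12 h23 h34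
    simp only [Set.mem_ofPred_eq] at o1 o2 o3 o4
    simp only [ne_eq, Subtype.mk.injEq] at n13 n14 n24
    have hSA : ∀ z ∈ ({w₁, w₂, w₃, w₄} : Set V), z ∉ A := by
      rintro z (rfl | rfl | rfl | rfl) <;> assumption
    obtain ⟨x, hx, y, hy, a, ha, b, hb, hab, hxy, x', y', U, W, hU, hW, hax, hyb, h1, h2, h3, h4, h5⟩ :=
      twoAtt {w₁, w₂, w₃, w₄} w₁ w₂ (by simp) (by simp) h12.ne hSA
    have adj : G.Adj x y → G.Adj x a ∧ G.Adj y b := by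
      intro hxy'
      have := hQ _ _ _ (hU.append hW hxy' h3) (by
        intro z hz
        rcases List.mem_append.1 hz with h | h
        exacts [h4 z h, h5 z h]) a ha b hb hab hax hyb
      have l1 := hU.length_pos
      have l2 := hW.length_pos
      rw [List.length_append] at this
      obtain ⟨m, rfl⟩ := hU.eq_cons
      obtain ⟨m', rfl⟩ := hW.eq_cons
      simp at this
      have e1 : m = [] := List.eq_nil_of_length_eq_zero (by omega)
      have e2 : m' = [] := List.eq_nil_of_length_eq_zero (by omega)
      subst e1 e2
      have i1 := hU.2.2.1
      have i2 := hW.2.2.1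
      simp at i1 i2
      subst i1 i2
      exact ⟨hax.symm, hyb⟩
    have far : ∀ p q M, Pth G p q M →
        (∀ z ∈ M, z ∈ ({w₁, w₂, w₃, w₄} : Set V) ∧ z ≠ x ∧ z ≠ y) → G.Adj x p → G.Adj q y → False :=
      fun p q M hM hMS hxp hqy => long _ x y hx hy a ha b hb hab x' y' U W hU hW hax hyb h1 h2 h3 h4
        h5 p q M hM hMS hxp hqy hSA
    have P23 : Pth G w₂ w₃ [w₂, w₃] := by simp [Pth, h23, h23.ne]
    have m12 := h12.ne
    have m23 := h23.ne
    have m34 := h34.ne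
    simp only [Set.mem_insert_iff, Set.mem_singleton_iff] at hx hy
    rcases hx with rfl | rfl | rfl | rfl <;> rcases hy with rfl | rfl | rfl | rfl
    · exact hxy rfl
    · obtain ⟨g1, g2⟩ := adj h12
      exact core12 _ _ _ _ a b h12 h23 h34 n13 n14 n24 o1 o2 o3 o4 ha hb hab g1 g2
    · exact far w₂ w₂ [w₂] (Pth.single _) (by simp; grind) h12 h23
    · exact far w₂ w₃ [w₂, w₃] P23 (by simp; grind) h12 h34
    · obtain ⟨g1, g2⟩ := adj h12.symm
      exact core12 _ _ _ _ b a h12 h23 h34 n13 n14 n24 o1 o2 o3 o4 hb ha hab.symm g2 g1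
    · exact hxy rfl
    · obtain ⟨g1, g2⟩ := adj h23
      exact core23 _ _ _ _ a b h12 h23 h34 n13 n14 n24 o1 o2 o3 o4 ha hb hab g1 g2
    · exact far w₃ w₃ [w₃] (Pth.single _) (by simp; grind) h23 h34
    · exact far w₂ w₂ [w₂] (Pth.single _) (by simp; grind) h23.symm h12.symm
    · obtain ⟨g1, g2⟩ := adj h23.symm
      exact core23 _ _ _ _ b a h12 h23 h34 n13 n14 n24 o1 o2 o3 o4 hb ha hab.symm g2 g1
    · exact hxy rfl
    · obtain ⟨g1, g2⟩ := adj h34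
      exact core12 _ _ _ _ b a h34.symm h23.symm h12.symm (Ne.symm n24) (Ne.symm n14) (Ne.symm n13)
        o4 o3 o2 o1 hb ha hab.symm g2 g1
    · exact far w₃ w₂ [w₂, w₃].reverse P23.reverse (by simp; grind) h34.symm h12.symm
    · exact far w₃ w₃ [w₃] (Pth.single _) (by simp; grind) h34.symm h23.symm
    · obtain ⟨g1, g2⟩ := adj h34.symm
      exact core12 _ _ _ _ a b h34.symm h23.symm h12.symm (Ne.symm n24) (Ne.symm n14) (Ne.symm n13)
        o4 o3 o2 o1 ha hb hab g1 g2
    · exact hxy rfl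

/-- `R` lists the interior vertices of a connection from `x` to `y`. -/
def Conn (G : SimpleGraph V) (x y : V) (R : List V) : Prop :=
  (x :: (R ++ [y])).IsChain G.Adj ∧ R.Nodup

theorem conn_nil {x y : V} : Conn G x y [] ↔ G.Adj x y := by simp [Conn]

theorem Conn.symm {x y : V} {R : List V} (h : Conn G x y R) : Conn G y x R.reverse := by
  refine ⟨?_, by simpa using h.2⟩
  have : y :: (R.reverse ++ [x]) = (x :: (R ++ [y])).reverse := by simp
  rw [this, List.isChain_reverse]
  exact h.1.imp fun _ _ h => h.symm

theorem Conn.split {x y z : V} {R R' : List V} (h : Conn G x y (R ++ z :: R')) :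
    Conn G x z R ∧ Conn G z y R' := by
  obtain ⟨h1, h2⟩ := h
  refine ⟨⟨?_, h2.of_append_left⟩, ⟨?_, ?_⟩⟩
  · have : x :: (R ++ z :: R' ++ [y]) = (x :: (R ++ [z])) ++ (R' ++ [y]) := by simp
    rw [this] at h1; exact h1.left_of_append
  · have : x :: (R ++ z :: R' ++ [y]) = (x :: R) ++ (z :: (R' ++ [y])) := by simp
    rw [this] at h1; exact h1.right_of_append
  · have := h2.of_append_right
    simp at this; exact this.2

theorem Pth.conn {a b x y : V} {l : List V} (h : Pth G a b l) (hx : G.Adj x a) (hy : G.Adj b y) :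
    Conn G x y l := by
  refine ⟨?_, h.nodup⟩
  have h1 := h.1
  obtain ⟨m, rfl⟩ := h.eq_cons
  rw [List.cons_append, List.isChain_cons_cons]
  refine ⟨hx, ?_⟩
  rw [← List.cons_append, List.isChain_append]
  refine ⟨h1, by simp, ?_⟩
  intro p hp q hq
  rw [h.2.2.1] at hp
  simp at hp hq; subst hp; subst hq; exact hy

theorem Conn.pth {x y : V} {R : List V} (h : Conn G x y R) (hR : R ≠ []) :
    ∃ p q, G.Adj x p ∧ Pth G p q R ∧ G.Adj q y := by
  obtain ⟨h1, h2⟩ := h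
  rw [List.isChain_cons] at h1
  obtain ⟨h1, h3⟩ := h1
  rw [List.isChain_append] at h3
  refine ⟨R.head hR, R.getLast hR, ?_, ⟨h3.1, List.head?_eq_some_head hR,
    List.getLast?_eq_some_getLast hR, h2⟩, ?_⟩
  · apply h1; rw [List.head?_append, List.head?_eq_some_head hR]; rfl
  · apply h3.2.2 _ (List.getLast?_eq_some_getLast hR); simp

theorem Pth.join {a x y b : V} {l R m : List V} (h : Pth G a x l) (hR : Conn G x y R)
    (h' : Pth G y b m) (h1 : ∀ z ∈ R, z ∉ l) (h2 : ∀ z ∈ R, z ∉ m) (h3 : ∀ z ∈ l, z ∉ m) :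
    Pth G a b (l ++ R ++ m) := by
  by_cases hn : R = []
  · subst hn
    simpa using h.append h' (conn_nil.1 hR) h3
  · obtain ⟨p, q, g1, g2, g3⟩ := hR.pth hn
    refine (h.append g2 g1 fun z hz hz' => h1 z hz' hz).append h' g3 ?_
    intro z hz
    rcases List.mem_append.1 hz with hz | hz
    exacts [h3 z hz, h2 z hz]

theorem NoLong.close {k : ℕ} (hN : NoLong G k) {a b : V} {l R : List V} (h : Pth G a b l)
    (hR : Conn G b a R) (h1 : ∀ z ∈ R, z ∉ l) : l.length + R.length < k := by
  by_cases hn : R = []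
  · subst hn
    simpa using hN _ _ _ h (conn_nil.1 hR)
  · obtain ⟨p, q, g1, g2, g3⟩ := hR.pth hn
    have := hN _ _ _ (h.append g2 g1 fun z hz hz' => h1 z hz' hz) g3
    simpa using this

theorem split_first (p : V → Prop) (l : List V) :
    (∀ x ∈ l, ¬ p x) ∨ ∃ l₁ y l₂, l = l₁ ++ y :: l₂ ∧ p y ∧ ∀ x ∈ l₁, ¬ p x := by
  induction l with
  | nil => simp
  | cons a l ih =>
    by_cases ha : p a
    · exact Or.inr ⟨[], a, l, by simp, ha, by simp⟩
    · rcases ih with h | ⟨l₁, y, l₂, rfl, hy, h⟩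
      · exact Or.inl (by simpa [ha] using h)
      · exact Or.inr ⟨a :: l₁, y, l₂, by simp, hy, by simpa [ha] using h⟩

/-- `isStarForest_of_attached` in terms of connections. -/
theorem isStarForest_of_conn (hL : Link G) (A : Finset V) {α β : V} (hα : α ∈ A) (hβ : β ∈ A)
    (hαβ : α ≠ β)
    (hQ : ∀ Q, (∀ z ∈ Q, z ∉ A) → ∀ a ∈ A, ∀ b ∈ A, a ≠ b → Conn G a b Q → Q.length ≤ 2) :
    IsStarForest (G.induce {v : V | v ∉ A}) :=
  isStarForest_of_attached hL A hα hβ hαβ fun _ _ Q hP hA a ha b hb hab h1 h2 =>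
    hQ Q hA a ha b hb hab (hP.conn h1 h2)

/-- Cycle `u 0, …, u (c-1)` of maximum length `c ∈ {2t, 2t+1}` and an outside vertex `u c`. -/
structure Wheel (G : SimpleGraph V) (u : ℕ → V) (c t : ℕ) : Prop where
  noLong : NoLong G (c + 1)
  two_le : 2 ≤ t
  len : c = 2 * t ∨ c = 2 * t + 1
  inj : ∀ a b, a < c + 1 → b < c + 1 → u a = u b → a = b
  adj : ∀ m, m + 1 < c → G.Adj (u m) (u (m + 1))
  wrap : G.Adj (u (c - 1)) (u 0)
  hub : ∀ i < t, G.Adj (u (2 * i)) (u c)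

namespace Wheel

variable {u : ℕ → V} {c t : ℕ}

theorem pth (h : Wheel G u c t) (b : ℕ × ℕ) (bs : List (ℕ × ℕ))
    (h1 : ∀ p ∈ b :: bs, (p.1 < c ∧ p.2 < c) ∨ (p.1 = c ∧ p.2 = c))
    (hj : (b :: bs).IsChain (fun p q => G.Adj (u p.2) (u q.1)))
    (hd : (b :: bs).Pairwise BlkDisj) :
    Pth G (u b.1) (u ((b :: bs).getLast (by simp)).2)
      (((b :: bs).flatMap (fun p => blk p.1 p.2)).map u) := by
  refine pth_blocks h.inj bs b (fun p hp => ?_) (fun p hp m hm => h.adj m ?_) hj hd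
  · have := h1 p hp; omega
  · have := h1 p hp; omega

theorem mem_of_blocks {bs : List (ℕ × ℕ)} (h1 : ∀ p ∈ bs, (p.1 < c ∧ p.2 < c) ∨ (p.1 = c ∧ p.2 = c))
    {z : V} (hz : z ∈ (bs.flatMap (fun p => blk p.1 p.2)).map u) : ∃ m ≤ c, u m = z := by
  obtain ⟨m, hm, rfl⟩ := List.mem_map.1 hz
  obtain ⟨p, hp, hm⟩ := List.mem_flatMap.1 hm
  have := h1 p hp
  rw [mem_blk] at hm
  exact ⟨m, by omega, rfl⟩

theorem cyc (h : Wheel G u c t) (b : ℕ × ℕ) (bs : List (ℕ × ℕ)) (R : List V)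
    (hR : Conn G (u ((b :: bs).getLast (by simp)).2) (u b.1) R) (hoff : ∀ m ≤ c, u m ∉ R)
    (h1 : ∀ p ∈ b :: bs, (p.1 < c ∧ p.2 < c) ∨ (p.1 = c ∧ p.2 = c))
    (hd : (b :: bs).Pairwise BlkDisj)
    (hj : (b :: bs).IsChain (fun p q => G.Adj (u p.2) (u q.1))) :
    ((b :: bs).map fun p => (p.2 - p.1) + (p.1 - p.2) + 1).sum + R.length ≤ c := by
  have := h.noLong.close (h.pth b bs h1 hj hd) hR (by
    intro z hz hz'
    obtain ⟨m, hm, rfl⟩ := mem_of_blocks h1 hz'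
    exact hoff m hm hz)
  rw [length_blocks] at this
  omega

theorem cyc₂ (h : Wheel G u c t) (b : ℕ × ℕ) (bs : List (ℕ × ℕ)) (b' : ℕ × ℕ) (bs' : List (ℕ × ℕ))
    (R R' : List V)
    (hR : Conn G (u ((b :: bs).getLast (by simp)).2) (u b'.1) R) (hoff : ∀ m ≤ c, u m ∉ R)
    (hR' : Conn G (u ((b' :: bs').getLast (by simp)).2) (u b.1) R') (hoff' : ∀ m ≤ c, u m ∉ R')
    (hRR : ∀ z ∈ R, z ∉ R')
    (h1 : ∀ p ∈ (b :: bs) ++ (b' :: bs'), (p.1 < c ∧ p.2 < c) ∨ (p.1 = c ∧ p.2 = c))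
    (hd : ((b :: bs) ++ (b' :: bs')).Pairwise BlkDisj)
    (hj : (b :: bs).IsChain (fun p q => G.Adj (u p.2) (u q.1)))
    (hj' : (b' :: bs').IsChain (fun p q => G.Adj (u p.2) (u q.1))) :
    ((b :: bs).map fun p => (p.2 - p.1) + (p.1 - p.2) + 1).sum + R.length +
      ((b' :: bs').map fun p => (p.2 - p.1) + (p.1 - p.2) + 1).sum + R'.length ≤ c := by
  have h1a := fun p hp => h1 p (List.mem_append_left _ hp)
  have h1b := fun p hp => h1 p (List.mem_append_right _ hp)
  rw [List.pairwise_append] at hd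
  have hp := (h.pth b bs h1a hj hd.1).join hR (h.pth b' bs' h1b hj' hd.2.1) (by
      intro z hz hz'
      obtain ⟨m, hm, rfl⟩ := mem_of_blocks h1a hz'
      exact hoff m hm hz) (by
      intro z hz hz'
      obtain ⟨m, hm, rfl⟩ := mem_of_blocks h1b hz'
      exact hoff m hm hz) (by
      intro z hz hz'
      obtain ⟨m, hm, rfl⟩ := List.mem_map.1 hz
      obtain ⟨p, hp, hm⟩ := List.mem_flatMap.1 hm
      obtain ⟨m', hm', he⟩ := List.mem_map.1 hz'
      obtain ⟨p', hp', hm'⟩ := List.mem_flatMap.1 hm'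
      have g1 := h1a p hp
      have g2 := h1b p' hp'
      rw [mem_blk] at hm hm'
      have := h.inj m' m (by omega) (by omega) he
      have := hd.2.2 p hp p' hp'
      unfold BlkDisj at this
      omega)
  have := h.noLong.close hp hR' (by
    intro z hz hz'
    rw [List.mem_append, List.mem_append] at hz'
    rcases hz' with (hz' | hz') | hz'
    · obtain ⟨m, hm, rfl⟩ := mem_of_blocks h1a hz'
      exact hoff' m hm hz
    · exact hRR z hz' hz
    · obtain ⟨m, hm, rfl⟩ := mem_of_blocks h1b hz'
      exact hoff' m hm hz)
  rw [List.length_append, List.length_append, length_blocks, length_blocks] at this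
  omega

theorem hub' (h : Wheel G u c t) {m : ℕ} (hm : m < 2 * t) (he : m % 2 = 0) : G.Adj (u m) (u c) := by
  have := h.hub (m / 2) (by omega)
  rwa [show 2 * (m / 2) = m by omega] at this

theorem wrap' (h : Wheel G u c t) {m : ℕ} (hm : m + 1 = c) : G.Adj (u m) (u 0) := by
  have := h.wrap
  rwa [show c - 1 = m by omega] at this

/-- Two vertices outside the hub's neighbourhood are joined outside the wheel only if they are the
two vertices of the exceptional slot, and then only by an edge. -/
theorem conn_slots (h : Wheel G u c t) {m m' : ℕ} (hlt : m < m') (hm' : m' ≤ c)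
    (he : m % 2 = 1 ∨ 2 * t ≤ m) (he' : m' % 2 = 1 ∨ 2 * t ≤ m') {R : List V}
    (hR : Conn G (u m) (u m') R) (hoff : ∀ m ≤ c, u m ∉ R) :
    R = [] ∧ c = 2 * t + 1 ∧ m = 2 * t - 1 ∧ m' = 2 * t := by
  have ht := h.two_le
  have hc := h.len
  by_cases hw : m' = c
  · exfalso
    subst hw
    by_cases hmo : m = 2 * t
    · have := h.cyc (m', m') [(0, m)] R hR hoff (by simp; omega) (by simp [BlkDisj]; omega)
        (by simp; exact (h.hub' (by omega) (by omega)).symm)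
      simp at this; omega
    · have := h.cyc (m', m') [(m - 1, 0), (m' - 1, m)] R hR hoff (by simp; omega)
        (by simp [BlkDisj]; omega)
        (by simp; exact ⟨(h.hub' (by omega) (by omega)).symm, h.wrap.symm⟩)
      simp at this; omega
  · by_cases ho : m' % 2 = 1
    · exfalso
      have := h.cyc (m', c - 1) [(0, m - 1), (c, c), (m' - 1, m)] R hR hoff (by simp; omega)
        (by simp [BlkDisj]; omega)
        (by simp; exact ⟨h.wrap, h.hub' (by omega) (by omega), (h.hub' (by omega) (by omega)).symm⟩)
      simp at this; omega
    · have e1 : m' = 2 * t := by omega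
      subst e1
      have hc' : c = 2 * t + 1 := by omega
      by_cases hm2 : m = 2 * t - 1
      · refine ⟨?_, hc', hm2, rfl⟩
        have := h.cyc (2 * t, 2 * t) [(0, m)] R hR hoff (by simp; omega)
          (by simp [BlkDisj]; omega) (by simp; exact h.wrap' (by omega))
        simp at this
        exact List.eq_nil_of_length_eq_zero (by omega)
      · exfalso
        have := h.cyc (2 * t, m + 1) [(c, c), (0, m)] R hR hoff (by simp; omega)
          (by simp [BlkDisj]; omega)
          (by simp; exact ⟨h.hub' (by omega) (by omega), (h.hub' (by omega) (by omega)).symm⟩)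
        simp at this; omega

/-- Connections between two neighbours of the hub outside the wheel are short. -/
theorem conn_free (h : Wheel G u c t) {i j : ℕ} (hij : i < j) (hj : j < t) {R : List V}
    (hR : Conn G (u (2 * j)) (u (2 * i)) R) (hoff : ∀ m ≤ c, u m ∉ R) : R.length ≤ 2 := by
  have ht := h.two_le
  have hc := h.len
  by_cases hj' : j + 1 < t
  · have := h.cyc (2 * i, 0) [(c - 1, 2 * j + 2), (c, c), (2 * i + 2, 2 * j)] R hR hoff
      (by simp; omega) (by simp [BlkDisj]; omega) (by
        simp
        exact ⟨h.wrap.symm, h.hub' (by omega) (by omega), (h.hub' (by omega) (by omega)).symm⟩)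
    simp at this; omega
  · have := h.cyc (2 * i, 0) [(c, c), (2 * i + 2, 2 * j)] R hR hoff
      (by simp; omega) (by simp [BlkDisj]; omega) (by
        simp
        exact ⟨h.hub' (by omega) (by omega), (h.hub' (by omega) (by omega)).symm⟩)
    simp at this; omega

theorem conn_hub (h : Wheel G u c t) {i : ℕ} (hi : i < t) {R : List V}
    (hR : Conn G (u (2 * i)) (u c) R) (hoff : ∀ m ≤ c, u m ∉ R) : R.length = 0 := by
  have ht := h.two_le
  have hc := h.len
  by_cases hj' : i + 1 < t
  · have := h.cyc (c, c) [(2 * i + 2, c - 1), (0, 2 * i)] R hR hoff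
      (by simp; omega) (by simp [BlkDisj]; omega) (by
        simp
        exact ⟨(h.hub' (by omega) (by omega)).symm, h.wrap⟩)
    simp at this; omega
  · have := h.cyc (c, c) [(2 * i - 2, 0), (c - 1, 2 * i)] R hR hoff
      (by simp; omega) (by simp [BlkDisj]; omega) (by
        simp
        exact ⟨(h.hub' (by omega) (by omega)).symm, h.wrap.symm⟩)
    simp at this; omega

/-- Connections from a one-vertex slot. -/
theorem conn_single (h : Wheel G u c t) {p i : ℕ} (hi : i < t) (hp : p % 2 = 1) (hpt : p < 2 * t)
    (hps : p < 2 * t - 1 ∨ c = 2 * t) {R : List V}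
    (hR : Conn G (u (2 * i)) (u p) R) (hoff : ∀ m ≤ c, u m ∉ R) :
    R.length = 0 ∨ (R.length = 1 ∧ c = 2 * t + 1 ∧
      ((2 * i = p + 1 ∧ i + 1 = t) ∨ (p = 1 ∧ i = 0))) := by
  have ht := h.two_le
  have hc := h.len
  rcases lt_trichotomy (2 * i) (p - 1) with hlt | heq | hgt
  · left
    by_cases hpc : p = c - 1
    · have := h.cyc (p, 2 * i + 2) [(c, c), (0, 2 * i)] R hR hoff
        (by simp; omega) (by simp [BlkDisj]; omega) (by
          simp
          exact ⟨h.hub' (by omega) (by omega), (h.hub' (by omega) (by omega)).symm⟩)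
      simp at this; omega
    · have := h.cyc (p, 2 * i + 2) [(c, c), (p + 1, c - 1), (0, 2 * i)] R hR hoff
        (by simp; omega) (by simp [BlkDisj]; omega) (by
          simp
          exact ⟨h.hub' (by omega) (by omega), (h.hub' (by omega) (by omega)).symm, h.wrap⟩)
      simp at this; omega
  · by_cases hi0 : i = 0
    · subst hi0
      have := h.cyc (p, 2 * t - 2) [(c, c), (0, 0)] R hR hoff
        (by simp; omega) (by simp [BlkDisj]; omega) (by
          simp
          exact ⟨h.hub' (by omega) (by omega), (h.hub' (by omega) (by omega)).symm⟩)
      simp at this; omega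
    · left
      have := h.cyc (p, c - 1) [(0, 2 * i - 2), (c, c), (2 * i, 2 * i)] R hR hoff
        (by simp; omega) (by simp [BlkDisj]; omega) (by
          simp
          exact ⟨h.wrap, h.hub' (by omega) (by omega), (h.hub' (by omega) (by omega)).symm⟩)
      simp at this; omega
  · by_cases hit : i + 1 < t
    · left
      have := h.cyc (p, 0) [(c - 1, 2 * i + 2), (c, c), (p + 1, 2 * i)] R hR hoff
        (by simp; omega) (by simp [BlkDisj]; omega) (by
          simp
          exact ⟨h.wrap.symm, h.hub' (by omega) (by omega), (h.hub' (by omega) (by omega)).symm⟩)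
      simp at this; omega
    · by_cases hip : 2 * i = p + 1
      · have := h.cyc (p, 0) [(c, c), (p + 1, 2 * i)] R hR hoff
          (by simp; omega) (by simp [BlkDisj]; omega) (by
            simp
            exact ⟨h.hub' (by omega) (by omega), (h.hub' (by omega) (by omega)).symm⟩)
        simp at this; omega
      · left
        have := h.cyc (p, 2 * i - 2) [(c, c), (p - 1, 0), (c - 1, 2 * i)] R hR hoff
          (by simp; omega) (by simp [BlkDisj]; omega) (by
            simp
            exact ⟨h.hub' (by omega) (by omega), (h.hub' (by omega) (by omega)).symm, h.wrap.symm⟩)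
        simp at this; omega

/-- Connections from the first vertex of the two-vertex slot. -/
theorem conn_fst (h : Wheel G u c t) (hc : c = 2 * t + 1) {i : ℕ} (hi : i < t) {R : List V}
    (hR : Conn G (u (2 * i)) (u (2 * t - 1)) R) (hoff : ∀ m ≤ c, u m ∉ R) :
    R.length = 0 ∨ (R.length = 1 ∧ i = 0) := by
  have ht := h.two_le
  by_cases hi0 : i = 0
  · subst hi0
    have := h.cyc (2 * t - 1, 2) [(c, c), (0, 0)] R hR hoff
      (by simp; omega) (by simp [BlkDisj]; omega) (by
        simp
        exact ⟨h.hub' (by omega) (by omega), (h.hub' (by omega) (by omega)).symm⟩)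
    simp at this; omega
  · have := h.cyc (2 * t - 1, 2 * t) [(0, 2 * i - 2), (c, c), (2 * t - 2, 2 * i)] R hR hoff
      (by simp; omega) (by simp [BlkDisj]; omega) (by
        simp
        exact ⟨h.wrap' (by omega), h.hub' (by omega) (by omega), (h.hub' (by omega) (by omega)).symm⟩)
    simp at this; omega

/-- Connections from the second vertex of the two-vertex slot. -/
theorem conn_snd (h : Wheel G u c t) (hc : c = 2 * t + 1) {i : ℕ} (hi : i < t) {R : List V}
    (hR : Conn G (u (2 * i)) (u (2 * t)) R) (hoff : ∀ m ≤ c, u m ∉ R) :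
    R.length = 0 ∨ (R.length = 1 ∧ i + 1 = t) := by
  have ht := h.two_le
  by_cases hi0 : i + 1 = t
  · have := h.cyc (2 * t, 2 * t) [(0, 2 * t - 4), (c, c), (2 * i, 2 * i)] R hR hoff
      (by simp; omega) (by simp [BlkDisj]; omega) (by
        simp
        exact ⟨h.wrap' (by omega), h.hub' (by omega) (by omega), (h.hub' (by omega) (by omega)).symm⟩)
    simp at this; omega
  · have := h.cyc (2 * t, 2 * i + 2) [(c, c), (0, 2 * i)] R hR hoff
      (by simp; omega) (by simp [BlkDisj]; omega) (by
        simp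
        exact ⟨h.hub' (by omega) (by omega), (h.hub' (by omega) (by omega)).symm⟩)
    simp at this; omega

/-- A connection through both vertices of the two-vertex slot. -/
theorem conn_double (h : Wheel G u c t) (hc : c = 2 * t + 1) {i j : ℕ} (hi : i < t) (hj : j < t)
    (hij : i ≠ j) {R R' : List V} (hR : Conn G (u (2 * i)) (u (2 * t - 1)) R)
    (hoff : ∀ m ≤ c, u m ∉ R) (hR' : Conn G (u (2 * t)) (u (2 * j)) R')
    (hoff' : ∀ m ≤ c, u m ∉ R') (hRR : ∀ z ∈ R, z ∉ R') : R.length + R'.length = 0 := by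
  have ht := h.two_le
  have h1 := h.conn_fst hc hi hR hoff
  have h2 := h.conn_snd hc hj hR'.symm (by simpa using hoff')
  simp only [List.length_reverse] at h2
  rcases h1 with h1 | ⟨h1, rfl⟩
  · rcases h2 with h2 | ⟨h2, hjt⟩
    · omega
    · exfalso
      have hR0 : R = [] := List.eq_nil_of_length_eq_zero h1
      subst hR0
      have := h.cyc (2 * j, 2 * i + 2) [(c, c), (0, 2 * i), (2 * t - 1, 2 * t)] R' hR' hoff'
        (by simp; omega) (by simp [BlkDisj]; omega) (by
          simp
          exact ⟨h.hub' (by omega) (by omega), (h.hub' (by omega) (by omega)).symm, conn_nil.1 hR⟩)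
      simp at this; omega
  · rcases h2 with h2 | ⟨h2, hjt⟩
    · exfalso
      have hR0 : R' = [] := List.eq_nil_of_length_eq_zero h2
      subst hR0
      have := h.cyc (2 * t - 1, 2 * t) [(2 * j, 2 * t - 2), (c, c), (2 * j - 2, 0)] R hR hoff
        (by simp; omega) (by simp [BlkDisj]; omega) (by
          simp
          exact ⟨conn_nil.1 hR', h.hub' (by omega) (by omega), (h.hub' (by omega) (by omega)).symm⟩)
      simp at this; omega
    · exfalso
      have := h.cyc₂ (2 * j, 0) [] (2 * t - 1, 2 * t) [] R R' (by simpa using hR) hoff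
        (by simpa using hR') hoff' hRR (by simp; omega) (by simp [BlkDisj]; omega) (by simp) (by simp)
      simp at this; omega

/-- Deleting the hub's neighbours leaves a star forest. -/
theorem isStarForest [DecidableEq V] (h : Wheel G u c t) (hL : Link G) :
    IsStarForest (G.induce {v : V | v ∉ (Finset.range t).image fun i => u (2 * i)}) := by
  have ht := h.two_le
  have hc := h.len
  refine isStarForest_of_conn hL _ (α := u (2 * 0)) (β := u (2 * 1))
    (Finset.mem_image_of_mem _ (by simp; omega)) (Finset.mem_image_of_mem _ (by simp; omega)) ?_ ?_
  · intro he
    have := h.inj _ _ (by omega) (by omega) he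
    omega
  intro Q hQ a ha b hb hab hconn
  obtain ⟨i, hi, rfl⟩ := Finset.mem_image.1 ha
  obtain ⟨j, hj, rfl⟩ := Finset.mem_image.1 hb
  rw [Finset.mem_range] at hi hj
  have hij : i ≠ j := fun he => hab (by rw [he])
  have hslot : ∀ m ≤ c, u m ∈ Q → m % 2 = 1 ∨ 2 * t ≤ m := by
    intro m hm hmQ
    by_contra hcon
    refine hQ _ hmQ (Finset.mem_image.2 ⟨m / 2, by simp; omega, ?_⟩)
    rw [show 2 * (m / 2) = m by omega]
  have hnod := hconn.2
  have offOf : ∀ R : List V, (∀ x ∈ R, ¬ ∃ m ≤ c, u m = x) → ∀ m ≤ c, u m ∉ R :=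
    fun R h m hm hmR => h _ hmR ⟨m, hm, rfl⟩
  rcases split_first (fun x => ∃ m ≤ c, u m = x) Q with hfree | ⟨Q₁, y, Q₂, rfl, ⟨m, hm, rfl⟩, hQ1⟩
  · rcases Nat.lt_or_gt_of_ne hij with hlt | hgt
    · simpa using h.conn_free hlt hj hconn.symm (by simpa using offOf Q hfree)
    · exact h.conn_free hgt hi hconn (offOf Q hfree)
  · obtain ⟨hc1, hc2⟩ := hconn.split
    have hm2 := hslot m hm (by simp)
    have o1 := offOf _ hQ1
    rcases split_first (fun x => ∃ m ≤ c, u m = x) Q₂ with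
      hQ2 | ⟨R, y, Q₃, rfl, ⟨m', hm', rfl⟩, hR⟩
    · have o2 := offOf _ hQ2
      have o2' : ∀ m ≤ c, u m ∉ Q₂.reverse := by simpa using o2
      have hdis : ∀ z ∈ Q₁, z ∉ Q₂.reverse := by
        intro z hz hz'
        rw [List.nodup_append] at hnod
        exact hnod.2.2 z hz z (by simp at hz'; simp [hz']) rfl
      rw [List.length_append, List.length_cons]
      have l2 : Q₂.reverse.length = Q₂.length := List.length_reverse
      by_cases hmc : m = c
      · subst hmc
        have e1 := h.conn_hub hi hc1 o1
        have e2 := h.conn_hub hj hc2.symm o2'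
        omega
      by_cases hmd : m = 2 * t
      · subst hmd
        have e1 := h.conn_snd (by omega) hi hc1 o1
        have e2 := h.conn_snd (by omega) hj hc2.symm o2'
        omega
      by_cases hmd' : m = 2 * t - 1 ∧ c = 2 * t + 1
      · obtain ⟨rfl, hc'⟩ := hmd'
        have e1 := h.conn_fst (by omega) hi hc1 o1
        have e2 := h.conn_fst (by omega) hj hc2.symm o2'
        omega
      have e1 := h.conn_single hi (by omega) (by omega) (by omega) hc1 o1
      have e2 := h.conn_single hj (by omega) (by omega) (by omega) hc2.symm o2'
      by_contra hbig
      have ht2 : t = 2 := by omega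
      have hm1 : m = 1 := by omega
      subst ht2 hm1
      have hcc : c = 5 := by omega
      subst hcc
      rcases (show (i = 0 ∧ j = 1) ∨ (i = 1 ∧ j = 0) by omega) with ⟨rfl, rfl⟩ | ⟨rfl, rfl⟩
      · have := h.cyc₂ (1, 1) [] (2, 2) [(5, 5), (0, 0)] Q₂ Q₁ (by simpa using hc2) o2
          (by simpa using hc1) o1 (by
            intro z hz hz'; exact hdis z hz' (by simpa using hz)) (by simp) (by simp [BlkDisj])
          (by simp) (by
          simp
          exact ⟨h.hub' (by omega) (by omega), (h.hub' (by omega) (by omega)).symm⟩)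
        simp at this; omega
      · have := h.cyc₂ (1, 1) [] (0, 0) [(5, 5), (2, 2)] Q₂ Q₁ (by simpa using hc2) o2
          (by simpa using hc1) o1 (by
            intro z hz hz'; exact hdis z hz' (by simpa using hz)) (by simp) (by simp [BlkDisj])
          (by simp) (by
          simp
          exact ⟨h.hub' (by omega) (by omega), (h.hub' (by omega) (by omega)).symm⟩)
        simp at this; omega
    · obtain ⟨hc3, hc4⟩ := hc2.split
      have hm2' := hslot m' hm' (by simp)
      have o2 := offOf _ hR
      have key : ∀ m m', m ≤ c → m' ≤ c → m ≠ m' → (m % 2 = 1 ∨ 2 * t ≤ m) →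
          (m' % 2 = 1 ∨ 2 * t ≤ m') → ∀ R, Conn G (u m) (u m') R → (∀ m ≤ c, u m ∉ R) →
          R = [] ∧ c = 2 * t + 1 ∧ ((m = 2 * t - 1 ∧ m' = 2 * t) ∨ (m' = 2 * t - 1 ∧ m = 2 * t)) := by
        intro m m' hm hm' hne h1 h2 R hR hoff
        rcases Nat.lt_or_gt_of_ne hne with hlt | hgt
        · obtain ⟨g1, g2, g3, g4⟩ := h.conn_slots hlt hm' h1 h2 hR hoff
          exact ⟨g1, g2, Or.inl ⟨g3, g4⟩⟩
        · obtain ⟨g1, g2, g3, g4⟩ := h.conn_slots hgt hm h2 h1 hR.symm (by simpa using hoff)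
          exact ⟨by simpa using g1, g2, Or.inr ⟨g3, g4⟩⟩
      have hne : m ≠ m' := by
        rintro rfl
        simp [List.nodup_append] at hnod
      obtain ⟨rfl, hc', hcase⟩ := key m m' hm hm' hne hm2 hm2' R hc3 o2
      rcases split_first (fun x => ∃ m ≤ c, u m = x) Q₃ with
        hQ3 | ⟨R', y, Q₄, rfl, ⟨m'', hm'', rfl⟩, hR'⟩
      · have o3 := offOf _ hQ3
        have hdis : ∀ z ∈ Q₁, z ∉ Q₃ := by
          intro z hz hz'
          rw [List.nodup_append] at hnod
          exact hnod.2.2 z hz z (by simp [hz']) rfl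
        rcases hcase with ⟨rfl, rfl⟩ | ⟨rfl, rfl⟩
        · have := h.conn_double hc' hi hj hij hc1 o1 hc4 o3 hdis
          simp; omega
        · have := h.conn_double hc' hj hi hij.symm hc4.symm (by simpa using o3) hc1.symm
            (by simpa using o1) (by
              intro z hz hz'; simp at hz hz'; exact hdis z hz' hz)
          simp at this ⊢; simp [this]
      · exfalso
        have hm2'' := hslot m'' hm'' (by simp)
        have hne' : m' ≠ m'' := by
          rintro rfl
          simp [List.nodup_append] at hnod
        have hne'' : m ≠ m'' := by
          rintro rfl
          simp [List.nodup_append] at hnod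
        obtain ⟨-, -, hcase'⟩ := key m' m'' hm' hm'' hne' hm2' hm2'' R' hc4.split.1 (offOf _ hR')
        omega

end Wheel

/-- A cycle of length `c`, as a `c`-periodic sequence. -/
structure Cyc (G : SimpleGraph V) (f : ℕ → V) (c : ℕ) : Prop where
  pos : 0 < c
  per : ∀ i, f (i + c) = f i
  inj : ∀ i j, i < c → j < c → f i = f j → i = j
  adj : ∀ i, G.Adj (f i) (f (i + 1))

theorem Pth.adj_getElem {a b : V} {l : List V} (h : Pth G a b l) (i : ℕ) (hi : i + 1 < l.length) :
    G.Adj l[i] l[i + 1] := by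
  exact List.isChain_iff_getElem.1 h.1 i (by omega)

theorem Pth.getElem_zero {a b : V} {l : List V} (h : Pth G a b l) :
    l[0]'h.length_pos = a := by
  obtain ⟨m, rfl⟩ := h.eq_cons; rfl

theorem Pth.getElem_last {a b : V} {l : List V} (h : Pth G a b l) :
    l[l.length - 1]'(by have := h.length_pos; omega) = b := by
  obtain ⟨m, rfl⟩ := h.eq_concat; simp

theorem Pth.cyc {a b : V} {l : List V} (h : Pth G a b l) (hab : G.Adj b a) :
    ∃ f, Cyc G f l.length ∧ ∀ x, x ∈ l ↔ ∃ i < l.length, f i = x := by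
  have hp := h.length_pos
  have hm : ∀ i, i % l.length < l.length := fun i => Nat.mod_lt _ hp
  refine ⟨fun i => l[i % l.length]'(hm i), ⟨hp, fun i => by simp, ?_, ?_⟩, ?_⟩
  · intro i j hi hj he
    have := (List.Nodup.getElem_inj_iff h.nodup).1 he
    rwa [Nat.mod_eq_of_lt hi, Nat.mod_eq_of_lt hj] at this
  · intro i
    by_cases hi : i % l.length + 1 < l.length
    · have e : (i + 1) % l.length = i % l.length + 1 := by
        rw [Nat.add_mod, Nat.mod_eq_of_lt (show 1 < l.length by omega), Nat.mod_eq_of_lt hi]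
      simp only [e]
      exact h.adj_getElem _ hi
    · have e0 := hm i
      have e : (i + 1) % l.length = 0 := by
        have : (i + 1) = i % l.length + 1 + l.length * (i / l.length) := by
          have := Nat.mod_add_div i l.length; omega
        rw [this, show i % l.length + 1 = l.length by omega]; simp
      have e' : i % l.length = l.length - 1 := by omega
      simp only [e, e']
      rw [h.getElem_last, h.getElem_zero]; exact hab
  · intro x
    constructor
    · intro hx
      obtain ⟨i, hi, rfl⟩ := List.getElem_of_mem hx
      exact ⟨i, hi, by simp [Nat.mod_eq_of_lt hi]⟩
    · rintro ⟨i, hi, rfl⟩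
      exact List.getElem_mem _

namespace Cyc

variable {f : ℕ → V} {c : ℕ}

theorem mod (h : Cyc G f c) (i : ℕ) : f (i % c) = f i := by
  have : ∀ q j, f (j + c * q) = f j := by
    intro q
    induction q with
    | zero => simp
    | succ q ih => intro j; rw [Nat.mul_succ, ← Nat.add_assoc, h.per, ih]
  conv_rhs => rw [← Nat.mod_add_div i c]
  rw [this]

theorem eq_iff (h : Cyc G f c) (i j : ℕ) : f i = f j ↔ i % c = j % c := by
  constructor
  · intro he
    rw [← h.mod i, ← h.mod j] at he
    exact h.inj _ _ (Nat.mod_lt _ h.pos) (Nat.mod_lt _ h.pos) he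
  · intro he
    rw [← h.mod i, ← h.mod j, he]

theorem shift (h : Cyc G f c) (r : ℕ) : Cyc G (fun i => f (i + r)) c where
  pos := h.pos
  per i := by
    show f (i + c + r) = f (i + r)
    rw [show i + c + r = i + r + c by omega, h.per]
  inj i j hi hj he := by
    have := (h.eq_iff _ _).1 he
    have : i ≡ j [MOD c] := Nat.ModEq.add_right_cancel' r this
    rwa [Nat.ModEq, Nat.mod_eq_of_lt hi, Nat.mod_eq_of_lt hj] at this
  adj i := by
    have := h.adj (i + r)
    rwa [show i + r + 1 = i + 1 + r by omega] at this

theorem pth (h : Cyc G f c) (hc : 0 < c) : Pth G (f 0) (f (c - 1)) ((blk 0 (c - 1)).map f) := by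
  refine pth_blk (fun m _ => h.adj m) ?_
  intro a ha b hb
  rw [mem_blk] at ha hb
  exact h.inj a b (by omega) (by omega)

/-- Adding an outside vertex: a common indexing. -/
theorem wheel (h : Cyc G f c) {t : ℕ} {w : V} (hN : NoLong G (c + 1)) (ht : 2 ≤ t)
    (hc : c = 2 * t ∨ c = 2 * t + 1) (hw : ∀ i, f i ≠ w) (hub : ∀ i < t, G.Adj (f (2 * i)) w) :
    Wheel G (fun i => if i < c then f i else w) c t where
  noLong := hN
  two_le := ht
  len := hc
  inj a b ha hb he := by
    split_ifs at he with h1 h2 h2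
    · exact h.inj a b h1 h2 he
    · exact absurd he (hw a)
    · exact absurd he.symm (hw b)
    · omega
  adj m hm := by
    rw [if_pos (by omega), if_pos hm]; exact h.adj m
  wrap := by
    have hp := h.pos
    rw [if_pos (by omega), if_pos hp]
    have := h.adj (c - 1)
    rwa [show c - 1 + 1 = 0 + c by omega, h.per] at this
  hub i hi := by
    rw [if_pos (by omega), if_neg (by omega)]; exact hub i hi

end Cyc

/-- A vertex with at least `t` neighbours on a longest cycle of length `2t` or `2t+1`. -/
theorem exists_of_many_neighbors (hL : Link G) {f : ℕ → V} {c t : ℕ} (h : Cyc G f c)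
    (hN : NoLong G (c + 1)) (ht : 2 ≤ t) (hc : c = 2 * t ∨ c = 2 * t + 1) {w : V}
    (hw : ∀ i, f i ≠ w) (S : Finset V) (hS : ∀ x ∈ S, G.Adj x w) (hSf : ∀ x ∈ S, ∃ i, f i = x)
    (hcard : t ≤ S.card) :
    ∃ A : Finset V, A.card ≤ t ∧ IsStarForest (G.induce {v : V | v ∉ A}) := by
  classical
  have hpos := h.pos
  let N := (Finset.range c).filter fun i => G.Adj (f i) w
  let N' := (Finset.range c).filter fun i => G.Adj (f (i + c - 1)) w
  have hnc : ∀ i, G.Adj (f i) w → G.Adj (f (i + 1)) w → False := by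
    intro i h1 h2
    have hs := h.shift (i + 1)
    have hp := (hs.pth hpos).conn (x := w) (y := w) (by simpa using h2.symm) (by
      rw [show c - 1 + (i + 1) = i + c by omega, h.per]; exact h1)
    have := hN.close (Pth.single w) hp (by
      intro z hz hz'
      simp at hz hz'
      obtain ⟨j, _, hj⟩ := hz
      exact hw _ (hj.trans hz'))
    simp [length_blk] at this; omega
  have hNcard : t ≤ N.card := by
    refine hcard.trans ?_
    have : S ⊆ N.image f := by
      intro x hx
      obtain ⟨i, rfl⟩ := hSf x hx
      refine Finset.mem_image.2 ⟨i % c, ?_, h.mod i⟩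
      simp only [N, Finset.mem_filter, Finset.mem_range]
      exact ⟨Nat.mod_lt _ hpos, by rw [h.mod]; exact hS _ hx⟩
    exact (Finset.card_le_card this).trans Finset.card_image_le
  have hN'card : N.card ≤ N'.card := by
    refine Finset.card_le_card_of_injOn (fun i => (i + 1) % c) ?_ ?_
    · intro i hi
      simp only [N, N', Finset.coe_filter, Finset.mem_range, Set.mem_ofPred_eq] at hi ⊢
      refine ⟨Nat.mod_lt _ hpos, ?_⟩
      have : f ((i + 1) % c + c - 1) = f i := by
        rw [h.eq_iff]
        by_cases h1 : i + 1 < c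
        · rw [Nat.mod_eq_of_lt h1, show i + 1 + c - 1 = i + c by omega, Nat.add_mod_right]
        · have : i + 1 = c := by omega
          rw [this, Nat.mod_self, show 0 + c - 1 = i by omega]
      rw [this]; exact hi.2
    · intro i hi j hj he
      simp only [N, Finset.coe_filter, Finset.mem_range, Set.mem_ofPred_eq] at hi hj
      have : i ≡ j [MOD c] := Nat.ModEq.add_right_cancel' 1 he
      rwa [Nat.ModEq, Nat.mod_eq_of_lt hi.1, Nat.mod_eq_of_lt hj.1] at this
  have hdisj : Disjoint N N' := by
    rw [Finset.disjoint_left]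
    intro i hi hi'
    simp only [N, N', Finset.mem_filter, Finset.mem_range] at hi hi'
    refine hnc (i + c - 1) hi'.2 ?_
    rw [show i + c - 1 + 1 = i + c by omega, h.per]; exact hi.2
  have hsub : N ∪ N' ⊆ Finset.range c :=
    Finset.union_subset (Finset.filter_subset _ _) (Finset.filter_subset _ _)
  have hun := Finset.card_union_of_disjoint hdisj
  have hrest : (Finset.range c \ (N ∪ N')).card = c - (N ∪ N').card := by
    rw [Finset.card_sdiff_of_subset hsub, Finset.card_range]
  obtain ⟨r, hr0, hr⟩ : ∃ r, G.Adj (f r) w ∧ ∀ i, 0 < i → i < 2 * t →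
      (G.Adj (f (r + i)) w ∨ G.Adj (f (r + i - 1)) w) := by
    have gen : ∀ j, j % c ∉ Finset.range c \ (N ∪ N') → 0 < j →
        (G.Adj (f j) w ∨ G.Adj (f (j - 1)) w) := by
      intro j hj hj0
      have hlt := Nat.mod_lt j hpos
      simp only [N, N', Finset.mem_sdiff, Finset.mem_range, hlt, Finset.mem_union,
        Finset.mem_filter, true_and, not_not, h.mod] at hj
      refine hj.imp id fun hj => ?_
      have : f (j % c + c - 1) = f (j - 1) := by
        rw [h.eq_iff]
        have e1 : j % c + c - 1 + 1 = j % c + c := by omega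
        have e2 : j - 1 + 1 = j := by omega
        have : j % c + c - 1 ≡ j - 1 [MOD c] := by
          apply Nat.ModEq.add_right_cancel' 1
          rw [e1, e2]
          simp [Nat.ModEq]
        exact this
      rwa [this] at hj
    by_cases hD : (Finset.range c \ (N ∪ N')).Nonempty
    · obtain ⟨x, hx⟩ := hD
      have hone : (Finset.range c \ (N ∪ N')).card ≤ 1 := by omega
      have hcard' := Finset.card_pos.2 ⟨x, hx⟩
      have huniq : ∀ y ∈ Finset.range c \ (N ∪ N'), y = x := fun y hy =>
        Finset.card_le_one.1 hone y hy x hx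
      have hxc : x < c := by simp at hx; exact hx.1
      have hc2 : c = 2 * t + 1 := by omega
      have hnx : ¬ G.Adj (f x) w := by
        intro hh
        simp only [Finset.mem_sdiff, Finset.mem_union, N, Finset.mem_filter] at hx
        exact hx.2 (Or.inl ⟨hx.1, hh⟩)
      have hmodne : ∀ i, 0 < i → i < 2 * t + 1 → (x + i) % c ≠ x := by
        intro i hi hi2 he
        have : x + i ≡ x + 0 [MOD c] := by simp [Nat.ModEq, he, Nat.mod_eq_of_lt hxc]
        have := Nat.ModEq.add_left_cancel' x this
        rw [Nat.ModEq, Nat.mod_eq_of_lt (by omega), Nat.mod_eq_of_lt (by omega)] at this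
        omega
      refine ⟨x + 1, ?_, ?_⟩
      · rcases gen (x + 1) (fun hh => hmodne 1 (by omega) (by omega) (huniq _ hh)) (by omega) with g | g
        · exact g
        · exact absurd g hnx
      · intro i hi hi2
        have := gen (x + 1 + i) (fun hh => hmodne (1 + i) (by omega) (by omega)
          (by rw [← Nat.add_assoc]; exact huniq _ hh)) (by omega)
        exact this
    · rw [Finset.not_nonempty_iff_eq_empty] at hD
      obtain ⟨r, hr⟩ := Finset.card_pos.1 (show 0 < N.card by omega)
      refine ⟨r, ?_, fun i hi _ => gen _ (by rw [hD]; simp) (by omega)⟩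
      simp only [N, Finset.mem_filter] at hr; exact hr.2
  have heven : ∀ i < t, G.Adj (f (2 * i + r)) w := by
    intro i
    induction i with
    | zero => intro _; simpa using hr0
    | succ i ih =>
      intro hi
      have h1 := ih (by omega)
      have h2 := hr (2 * (i + 1)) (by omega) (by omega)
      rw [show r + 2 * (i + 1) = 2 * (i + 1) + r by omega] at h2
      rcases h2 with h2 | h2
      · exact h2
      · exfalso
        rw [show 2 * (i + 1) + r - 1 = 2 * i + r + 1 by omega] at h2
        exact hnc _ h1 h2
  have hW := (h.shift r).wheel (t := t) hN ht hc (fun i => hw _) heven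
  exact ⟨_, Finset.card_image_le.trans (by simp), hW.isStarForest hL⟩

theorem NoLong.mono {k k' : ℕ} (h : NoLong G k) (hk : k ≤ k') : NoLong G k' :=
  fun a b l hp hab => (h a b l hp hab).trans_le hk

theorem Conn.append {x y z : V} {R R' : List V} (h : Conn G x z R) (h' : Conn G z y R')
    (hn : (R ++ z :: R').Nodup) : Conn G x y (R ++ z :: R') := by
  refine ⟨?_, hn⟩
  have e : x :: (R ++ z :: R' ++ [y]) = (x :: R) ++ (z :: (R' ++ [y])) := by simp
  rw [e, List.isChain_append]
  have h1 := h.1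
  rw [← List.cons_append, List.isChain_append] at h1
  refine ⟨h1.1, h'.1, fun p hp q hq => h1.2.2 p hp q ?_⟩
  simpa using hq

theorem Pth.conn_tail {a b : V} {m : List V} (h : Pth G a b (a :: (m ++ [b]))) : Conn G a b m := by
  refine ⟨h.1, ?_⟩
  have := h.nodup
  rw [List.nodup_cons, List.nodup_append] at this
  exact this.2.1

/-- Any set with two vertices that misses a vertex has an ear. -/
theorem exists_ear (hL : Link G) {S : Set V} {s s' v : V} (hs : s ∈ S) (hs' : s' ∈ S) (hss : s ≠ s')
    (hv : v ∉ S) : ∃ a ∈ S, ∃ b ∈ S, a ≠ b ∧ ∃ Q, Q ≠ [] ∧ Conn G a b Q ∧ ∀ z ∈ Q, z ∉ S := by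
  obtain ⟨x, hx, a, ha, R, hR, -, -, hRS⟩ := hL s {v} S ⟨v, rfl, fun h => hv (h ▸ hs)⟩
    ⟨s', hs', hss.symm⟩
  simp only [Set.mem_singleton_iff] at hx
  subst hx
  have hb : ∃ b ∈ S, b ≠ a := by
    by_cases h : s = a
    · exact ⟨s', hs', fun h' => hss (h.trans h'.symm)⟩
    · exact ⟨s, hs, h⟩
  obtain ⟨y, hy, b, hbS, L, hLp, hLa, hLR, hLS⟩ := hL a {z | z ∈ R} S
    ⟨x, hR.head_mem, fun h => hv (h ▸ ha)⟩ hb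
  simp only [Set.mem_ofPred_eq] at hy hLR
  have hyS : y ∉ S := by
    intro h
    have := hRS y hy h
    subst this; exact hLa hLp.head_mem
  obtain ⟨R₁, R₂, rfl⟩ := List.append_of_mem hy
  have h2 := hR.split.2
  have hya : y ≠ a := fun h => hyS (h ▸ ha)
  obtain ⟨M, p, hM, hMp, hpa, haM⟩ := h2.unconcat hya
  obtain ⟨M', rfl⟩ := hMp.eq_cons
  obtain ⟨L', q, rfl, hL', hqb, hbL'⟩ := hLp.unconcat (fun h => hyS (h ▸ hbS))
  obtain ⟨L'', rfl⟩ := hL'.eq_cons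
  have hRM : ∀ z ∈ y :: M', z ∈ R₁ ++ y :: R₂ := by
    intro z hz
    have : z ∈ y :: R₂ := by rw [hM]; exact List.mem_append_left _ hz
    exact List.mem_append_right _ this
  have hbc : Conn G b y L''.reverse := by
    have : Conn G y b L'' := by
      have := hLp
      rw [List.cons_append] at this
      exact this.conn_tail
    exact this.symm
  have hca : Conn G y a M' := by
    rw [hM, List.cons_append] at h2; exact h2.conn_tail
  refine ⟨b, hbS, a, ha, ?_, L''.reverse ++ y :: M', by simp, hbc.append hca ?_, ?_⟩
  · rintro rfl; exact hLa hLp.last_mem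
  · rw [List.nodup_append]
    have n1 := hL'.nodup
    rw [List.nodup_cons] at n1
    refine ⟨by simpa using n1.2, hMp.nodup, ?_⟩
    rintro z hz w hw rfl
    simp at hz
    have := hLR z (by simp [hz]) (hRM z hw)
    subst this; exact n1.1 hz
  · intro z hz hzS
    rw [List.mem_append] at hz
    rcases hz with hz | hz
    · simp at hz
      have := hLS z (by simp [hz]) hzS
      subst this; exact hbL' (by simp [hz])
    · have := hRS z (hRM z hz) hzS
      subst this; exact haM hz

namespace Cyc

variable {f : ℕ → V} {c : ℕ}

theorem inj_of_close (h : Cyc G f c) {i j : ℕ} (h1 : i < j + c) (h2 : j < i + c) (he : f i = f j) :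
    i = j := by
  rw [h.eq_iff] at he
  rcases Nat.le_total i j with hle | hle
  · have := (Nat.modEq_iff_dvd' hle).1 he
    have := Nat.eq_zero_of_dvd_of_lt this (by omega)
    omega
  · have := (Nat.modEq_iff_dvd' hle).1 he.symm
    have := Nat.eq_zero_of_dvd_of_lt this (by omega)
    omega

theorem pth_blk (h : Cyc G f c) {i j : ℕ} (h1 : i < j + c) (h2 : j < i + c) :
    Pth G (f i) (f j) ((blk i j).map f) := by
  refine StarStability.pth_blk (fun m _ => h.adj m) ?_
  intro a ha b hb he
  rw [mem_blk] at ha hb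
  exact h.inj_of_close (by omega) (by omega) he

theorem ear_le (h : Cyc G f c) {k : ℕ} (hN : NoLong G k) {i j : ℕ} (hij : i ≤ j) (hj : j < i + c)
    {Q : List V}
    (hQ : Conn G (f i) (f j) Q) (hoff : ∀ z ∈ Q, ∀ m, f m ≠ z) : j - i + 1 + Q.length < k := by
  have := hN.close (h.pth_blk (i := j) (j := i) (by omega) (by omega)) hQ (by
    intro z hz hz'
    obtain ⟨m, _, rfl⟩ := List.mem_map.1 hz'
    exact hoff _ hz m rfl)
  simp [length_blk] at this; omega

theorem ear_le' (h : Cyc G f c) {k : ℕ} (hN : NoLong G k) {i j : ℕ} (hij : i < j) (hj : j < i + c)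
    {Q : List V}
    (hQ : Conn G (f i) (f j) Q) (hoff : ∀ z ∈ Q, ∀ m, f m ≠ z) : c - (j - i) + 1 + Q.length < k := by
  have := h.ear_le hN (i := j) (j := i + c) (by omega) (by omega) (Q := Q.reverse)
    (by rw [h.per]; exact hQ.symm) (by simpa using hoff)
  simp at this; omega

end Cyc

theorem exists_longest [Finite V] (hL : Link G) {k : ℕ} (hN : NoLong G k) (hn : 3 ≤ Nat.card V) :
    ∃ f c, Cyc G f c ∧ NoLong G (c + 1) ∧ 2 ≤ c ∧ c < k := by
  classical
  let P := fun c => ∃ a b l, Pth G a b l ∧ G.Adj b a ∧ l.length = c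
  have hP2 : P 2 := by
    have := Fintype.ofFinite V
    rw [Nat.card_eq_fintype_card] at hn
    obtain ⟨x, y, z, hxy, hxz, hyz⟩ := Fintype.two_lt_card_iff.1 (show 2 < Fintype.card V by omega)
    obtain ⟨a, ha, b, hb, l, hl, -, hlS, hlT⟩ := hL z {x} {v | v ≠ x} ⟨x, rfl, hxz⟩ ⟨y, hxy.symm, hyz⟩
    simp only [Set.mem_singleton_iff] at ha
    subst ha
    obtain ⟨m, p, rfl, hm, hpb, hbm⟩ := hl.unconcat (fun h => hb h.symm)
    have : p = a := by
      by_contra hne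
      have := hlT p (by simp [hm.last_mem]) hne
      subst this; exact hbm hm.last_mem
    subst this
    exact ⟨p, b, [p, b], by simp [Pth, hpb, hpb.ne], hpb.symm, rfl⟩
  have hb : ∀ c, P c → c < k := by
    rintro c ⟨a, b, l, h1, h2, rfl⟩; exact hN a b l h1 h2
  obtain ⟨hc1, hc2⟩ : P (Nat.findGreatest P k) ∧ ∀ c, P c → c ≤ Nat.findGreatest P k :=
    ⟨Nat.findGreatest_spec (hb 2 hP2).le hP2, fun c hc => Nat.le_findGreatest (hb c hc).le hc⟩
  obtain ⟨a, b, l, h1, h2, h3⟩ := hc1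
  obtain ⟨f, hf, -⟩ := h1.cyc h2
  rw [h3] at hf
  exact ⟨f, _, hf, fun a b l h1 h2 => Nat.lt_succ_of_le (hc2 _ ⟨a, b, l, h1, h2, rfl⟩), hc2 2 hP2,
    hb _ ⟨a, b, l, h1, h2, h3⟩⟩

theorem Cyc.exists_off [Finite V] {f : ℕ → V} {c : ℕ} (h : Cyc G f c) (hn : c < Nat.card V) :
    ∃ v, ∀ m, f m ≠ v := by
  classical
  have := Fintype.ofFinite V
  rw [Nat.card_eq_fintype_card] at hn
  by_contra hcon
  push Not at hcon
  have : (Finset.univ : Finset V) ⊆ (Finset.range c).image f := by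
    intro v _
    obtain ⟨m, rfl⟩ := hcon v
    exact Finset.mem_image.2 ⟨m % c, by simpa using Nat.mod_lt _ h.pos, h.mod m⟩
  have := Finset.card_le_card this
  have := this.trans Finset.card_image_le
  simp at this; omega

/-- An ear of a longest cycle, with normalised positions. -/
theorem Cyc.exists_ear [Finite V] (hL : Link G) {f : ℕ → V} {c : ℕ} (h : Cyc G f c)
    (hN : NoLong G (c + 1)) (hn : c < Nat.card V) :
    ∃ i j Q, i < j ∧ j < c ∧ Q ≠ [] ∧ Conn G (f i) (f j) Q ∧ (∀ z ∈ Q, ∀ m, f m ≠ z) ∧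
      Q.length + 1 ≤ j - i ∧ Q.length + 1 ≤ c - (j - i) := by
  obtain ⟨v, hv⟩ := h.exists_off hn
  obtain ⟨a, ⟨i, rfl⟩, b, ⟨j, rfl⟩, hab, Q, hQ0, hQ, hoff⟩ := StarStability.exists_ear hL
    (S := Set.range f) ⟨0, rfl⟩ ⟨1, rfl⟩ (h.adj 0).ne (v := v) (by simpa using hv)
  have hoff' : ∀ z ∈ Q, ∀ m, f m ≠ z := fun z hz m he => hoff z hz ⟨m, he⟩
  obtain ⟨i', j', Q', h1, h2, h3, h4, h5⟩ : ∃ i j Q, i < j ∧ j < c ∧ Q ≠ [] ∧ Conn G (f i) (f j) Q ∧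
      (∀ z ∈ Q, ∀ m, f m ≠ z) := by
    rw [← h.mod i, ← h.mod j] at hQ hab
    have hi := Nat.mod_lt i h.pos
    have hj := Nat.mod_lt j h.pos
    rcases Nat.lt_trichotomy (i % c) (j % c) with hlt | heq | hgt
    · exact ⟨_, _, Q, hlt, hj, hQ0, hQ, hoff'⟩
    · exact absurd (by rw [heq]) hab
    · exact ⟨_, _, Q.reverse, hgt, hi, by simpa using hQ0, hQ.symm, by simpa using hoff'⟩
  refine ⟨i', j', Q', h1, h2, h3, h4, h5, ?_, ?_⟩
  · have := h.ear_le' hN h1 (by omega) h4 h5; omega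
  · have := h.ear_le hN h1.le (by omega) h4 h5; omega

/-- 2-connected graphs on at least six vertices without cycles of length six or more. -/
theorem exists_of_noLong_six [Finite V] (hL : Link G) (hN : NoLong G 6) (hn : 6 ≤ Nat.card V) :
    ∃ A : Finset V, A.card ≤ 2 ∧ IsStarForest (G.induce {v : V | v ∉ A}) := by
  classical
  obtain ⟨f, c, hf, hNc, hc2, hck⟩ := exists_longest hL hN (by omega)
  obtain ⟨i, j, Q, hij, hjc, hQ0, hQ, hoff, h1, h2⟩ := hf.exists_ear hL hNc (by omega)
  have hQ1 := List.length_pos_iff.2 hQ0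
  obtain ⟨w, rfl⟩ := List.length_eq_one_iff.1 (show Q.length = 1 by omega)
  have hs := (Conn.split (R := []) (R' := []) hQ)
  have hne : f i ≠ f j := fun he => by
    have := hf.inj i j (by omega) hjc he
    omega
  refine exists_of_many_neighbors hL hf hNc (t := 2) le_rfl ?_ (w := w) (fun m => hoff w (by simp) m)
    {f i, f j} ?_ ?_ ?_
  · simp at h1 h2; omega
  · intro x hx
    simp at hx
    rcases hx with rfl | rfl
    · exact conn_nil.1 hs.1
    · exact (conn_nil.1 hs.2).symm
  · intro x hx
    simp at hx
    rcases hx with rfl | rfl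
    exacts [⟨_, rfl⟩, ⟨_, rfl⟩]
  · rw [Finset.card_pair hne]

theorem split_last (p : V → Prop) (l : List V) :
    (∀ x ∈ l, ¬ p x) ∨ ∃ l₁ y l₂, l = l₁ ++ y :: l₂ ∧ p y ∧ ∀ x ∈ l₂, ¬ p x := by
  rcases split_first p l.reverse with h | ⟨l₁, y, l₂, h1, h2, h3⟩
  · exact Or.inl (by simpa using h)
  · refine Or.inr ⟨l₂.reverse, y, l₁.reverse, ?_, h2, by simpa using h3⟩
    have := congrArg List.reverse h1
    simpa using this

/-- All connections between `a` and `b` have at most three interior vertices. -/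
def Short (G : SimpleGraph V) (a b : V) : Prop :=
  ∀ R, Conn G a b R → a ∉ R → b ∉ R → R.length ≤ 3

theorem Short.symm {a b : V} (h : Short G a b) : Short G b a := by
  intro R hR h1 h2
  have := h _ hR.symm (by simpa using h2) (by simpa using h1)
  simpa using this

/-- A connection `a, p, q, r, b`. -/
structure Trio (G : SimpleGraph V) (a b p q r : V) : Prop where
  short : Short G a b
  ap : G.Adj a p
  pq : G.Adj p q
  qr : G.Adj q r
  rb : G.Adj r b
  nd : [a, b, p, q, r].Nodup

namespace Trio

variable {a b p q r : V}

theorem symm (h : Trio G a b p q r) : Trio G b a r q p := by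
  refine ⟨h.short.symm, h.rb.symm, h.qr.symm, h.pq.symm, h.ap.symm, ?_⟩
  have := h.nd
  simp at this ⊢
  grind

/-- `z` is none of the five distinguished vertices. -/
def Off (a b p q r z : V) : Prop := z ≠ a ∧ z ≠ b ∧ z ≠ p ∧ z ≠ q ∧ z ≠ r

theorem Off.symm {z : V} (h : Off a b p q r z) : Off b a r q p z := by
  unfold Off at *; tauto

theorem four (h : Trio G a b p q r) {R : List V} (hR : Conn G a b R) (ha : a ∉ R) (hb : b ∉ R)
    (h4 : 4 ≤ R.length) : False := by
  have := h.short R hR ha hb; omega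

theorem no_ear (h : Trio G a b p q r) {W : List V} (hW : Conn G r b W) (h0 : W ≠ [])
    (ho : ∀ z ∈ W, Off a b p q r z) : False := by
  have nd := h.nd
  have hc : Conn G a b ([p, q] ++ r :: W) := by
    refine Conn.append (by have := h.ap; have := h.pq; have := h.qr; simp [Conn, *]; simp at nd; tauto) hW ?_
    have := hW.2
    unfold Off at ho
    simp at nd ⊢
    grind
  have := List.length_pos_iff.2 h0
  unfold Off at ho
  refine h.four hc ?_ ?_ (by simp; omega)
  · simp at nd ⊢; grind
  · simp at nd ⊢; grind

/-- A detour to `b` avoiding `r`. -/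
def Ext (G : SimpleGraph V) (a b p q r : V) : Prop :=
  ∃ T, (∀ z ∈ T, Off a b p q r z) ∧ (Conn G p b T ∨ Conn G q b T)

theorem ext_of_conn (h : Trio G a b p q r) {x : V} {R : List V} (hR : Conn G x b R)
    (ho : ∀ z ∈ R, z ≠ a ∧ z ≠ b ∧ z ≠ r) :
    (∀ z ∈ R, Off a b p q r z) ∨ Ext G a b p q r := by
  rcases split_last (fun z => z = p ∨ z = q) R with h1 | ⟨l₁, y, l₂, rfl, hy, h2⟩
  · left
    intro z hz
    have := ho z hz
    have := h1 z hz
    unfold Off; tauto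
  · right
    refine ⟨l₂, fun z hz => ?_, ?_⟩
    · have := ho z (by simp [hz])
      have := h2 z hz
      unfold Off; tauto
    · have := hR.split.2
      rcases hy with rfl | rfl
      exacts [Or.inl this, Or.inr this]

theorem disj (h : Trio G a b p q r) {x y : V} {U T : List V} (hU : Conn G x r U) (hT : Conn G y b T)
    (hUo : ∀ z ∈ U, Off a b p q r z) (hTo : ∀ z ∈ T, Off a b p q r z) : ∀ z ∈ U, z ∉ T := by
  rcases split_last (· ∈ T) U with h1 | ⟨l₁, z, l₂, rfl, hz, h2⟩
  · exact h1
  · exfalso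
    obtain ⟨m₁, m₂, rfl⟩ := List.append_of_mem hz
    have c1 := hU.split.2.symm
    have c2 := hT.split.2
    refine h.no_ear (c1.append c2 ?_) (by simp) ?_
    · have n1 := hU.2
      have n2 := hT.2
      simp at n1 n2 h2 ⊢
      grind
    · intro w hw
      simp at hw
      rcases hw with hw | hw | hw
      · exact hUo _ (by simp [hw])
      · exact hTo _ (by simp [hw])
      · exact hTo _ (by simp [hw])

theorem no_both (h : Trio G a b p q r) {U : List V} (hU : Conn G a r U) (hUo : ∀ z ∈ U, Off a b p q r z)
    (h0 : U ≠ []) (hE : Ext G a b p q r) (hc : 2 ≤ U.length ∨ G.Adj p r) : False := by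
  obtain ⟨T, hTo, hT⟩ := hE
  have hl := List.length_pos_iff.2 h0
  have nd := h.nd
  have pq := h.pq
  have qr := h.qr
  have n1 := hU.2
  rcases hT with hT | hT
  · have hd := h.disj hU hT hUo hTo
    have n2 := hT.2
    unfold Off at hUo hTo
    have c1 : Conn G r b ([q] ++ p :: T) := Conn.append (by simp [Conn, qr.symm, pq.symm]) hT (by
      simp at nd ⊢; grind)
    refine h.four (hU.append c1 ?_) ?_ ?_ (by simp; omega)
    all_goals simp at nd ⊢; grind
  · have hd := h.disj hU hT hUo hTo
    have n2 := hT.2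
    unfold Off at hUo hTo
    rcases hc with hc | hc
    · have c1 : Conn G r b ([] ++ q :: T) := Conn.append (by simp [Conn, qr.symm]) hT (by
        simp at nd ⊢; grind)
      refine h.four (hU.append c1 ?_) ?_ ?_ (by simp; omega)
      all_goals simp at nd ⊢; grind
    · have c1 : Conn G r b ([p] ++ q :: T) := Conn.append (by simp [Conn, pq, hc.symm]) hT (by
        simp at nd ⊢; grind)
      refine h.four (hU.append c1 ?_) ?_ ?_ (by simp; omega)
      all_goals simp at nd ⊢; grind

/-- A common neighbour of `p` and `r` outside the trio. -/
def Mid (G : SimpleGraph V) (a b p q r : V) : Prop := ∃ z, Off a b p q r z ∧ G.Adj z p ∧ G.Adj z r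

theorem Mid.symm (h : Mid G a b p q r) : Mid G b a r q p := by
  obtain ⟨z, h1, h2, h3⟩ := h
  exact ⟨z, h1.symm, h3, h2⟩

theorem mid_of_conn {U : List V} (hU : Conn G p r U) (hl : U.length = 1)
    (ho : ∀ z ∈ U, z ≠ a ∧ z ≠ b ∧ z ≠ p ∧ z ≠ q ∧ z ≠ r) : Mid G a b p q r := by
  obtain ⟨z, rfl⟩ := List.length_eq_one_iff.1 hl
  simp [Conn] at hU
  exact ⟨z, ho z (by simp), hU.1.symm, hU.2⟩

theorem mid_of_bad_left (h : Trio G a b p q r) (hE : Ext G a b p q r) {R : List V}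
    (hR : Conn G a q R) (ho : ∀ z ∈ R, z ≠ a ∧ z ≠ b ∧ z ≠ q) (hl : 3 ≤ R.length) :
    Mid G a b p q r := by
  have nd := h.nd
  have pq := h.pq
  have qr := h.qr
  have ap := h.ap
  have rb := h.rb
  have n1 := hR.2
  by_cases hr : r ∈ R
  swap
  · exfalso
    have c1 : Conn G q b [r] := by simp [Conn, qr, rb]
    refine h.four (hR.append c1 ?_) ?_ ?_ (by simp; omega)
    all_goals simp at nd ⊢; grind
  obtain ⟨U, W, rfl⟩ := List.append_of_mem hr
  obtain ⟨hU, hW⟩ := hR.split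
  by_cases hpU : p ∈ U
  · obtain ⟨U₁, U₂, rfl⟩ := List.append_of_mem hpU
    obtain ⟨hU1, hU2⟩ := hU.split
    have e1 : U₁ = [] := by
      by_contra hne
      have := List.length_pos_iff.2 hne
      have c1 : Conn G p b [q, r] := by simp [Conn, qr, rb, pq]; simp at nd; tauto
      refine h.four (hU1.append c1 ?_) ?_ ?_ (by simp; omega)
      all_goals simp at nd n1 ⊢; grind
    subst e1
    have e2 : W = [] := by
      by_contra hne
      have := List.length_pos_iff.2 hne
      have c0 : Conn G a q [p] := by simp [Conn, ap, pq]
      have c1 : Conn G q b (W.reverse ++ r :: []) :=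
        hW.symm.append (by simp [Conn, rb]) (by simp at n1 ⊢; grind)
      refine h.four (c0.append c1 ?_) ?_ ?_ (by simp; omega)
      all_goals simp at nd n1 ho ⊢; grind
    subst e2
    have : U₂.length ≤ 1 := by
      by_contra hne
      refine h.four (hU.append (conn_nil.2 rb) ?_) ?_ ?_ (by simp; omega)
      all_goals simp at nd n1 ho ⊢; grind
    refine mid_of_conn hU2 ?_ ?_
    · simp at hl; omega
    · simp at n1 ho ⊢; grind
  by_cases hpW : p ∈ W
  · obtain ⟨W₁, W₂, rfl⟩ := List.append_of_mem hpW
    obtain ⟨hW1, hW2⟩ := hW.split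
    have e2 : W₂ = [] := by
      by_contra hne
      have := List.length_pos_iff.2 hne
      have c1 : Conn G q b ([r]) := by simp [Conn, qr, rb]
      have c2 : Conn G a q ([] ++ p :: W₂) := (conn_nil.2 ap).append hW2 (by simp at n1 ⊢; grind)
      refine h.four (c2.append c1 ?_) ?_ ?_ (by simp; omega)
      all_goals simp at nd n1 ho ⊢; grind
    subst e2
    have e3 : W₁.length ≤ 1 := by
      by_contra hne
      have c2 : Conn G a r ([] ++ p :: W₁.reverse) :=
        (conn_nil.2 ap).append hW1.symm (by simp at n1 ⊢; grind)
      refine h.four (c2.append (conn_nil.2 rb) ?_) ?_ ?_ (by simp; omega)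
      all_goals simp at nd n1 ho ⊢; grind
    rcases Nat.lt_or_ge W₁.length 1 with hlt | hge
    · exfalso
      have e4 : W₁ = [] := List.length_eq_zero_iff.1 (by omega)
      subst e4
      refine h.no_both hU ?_ ?_ hE (Or.inr (conn_nil.1 hW1).symm)
      · unfold Off; simp at n1 ho ⊢; grind
      · rintro rfl; simp at hl
    · refine mid_of_conn hW1.symm (by simp; omega) ?_
      simp at n1 ho ⊢; grind
  · exfalso
    have e2 : W = [] := by
      by_contra hne
      have := List.length_pos_iff.2 hne
      have c0 : Conn G a q [p] := by simp [Conn, ap, pq]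
      have c1 : Conn G q b (W.reverse ++ r :: []) :=
        hW.symm.append (by simp [Conn, rb]) (by
          have n3 := List.nodup_cons.1 n1.of_append_right
          rw [List.nodup_append]
          refine ⟨by simpa using n3.2, by simp, ?_⟩
          simp; grind)
      refine h.four (c0.append c1 ?_) ?_ ?_ (by simp; omega)
      all_goals simp at nd n1 ho ⊢; grind
    subst e2
    refine h.no_both hU ?_ ?_ hE (Or.inl ?_)
    · unfold Off; simp at n1 ho ⊢; grind
    · rintro rfl; simp at hl
    · simp at hl; omega

theorem mid_of_bad_mid (h : Trio G a b p q r) (hE : Ext G a b p q r) {R : List V}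
    (hR : Conn G a b R) (ho : ∀ z ∈ R, z ≠ a ∧ z ≠ b ∧ z ≠ q) (hl : R.length = 3) (hr : r ∈ R) :
    Mid G a b p q r := by
  have nd := h.nd
  have pq := h.pq
  have qr := h.qr
  have ap := h.ap
  have rb := h.rb
  have n1 := hR.2
  obtain ⟨U, W, rfl⟩ := List.append_of_mem hr
  obtain ⟨hU, hW⟩ := hR.split
  by_cases hpW : p ∈ W
  · obtain ⟨W₁, W₂, rfl⟩ := List.append_of_mem hpW
    obtain ⟨hW1, hW2⟩ := hW.split
    by_cases h1 : W₁.length = 1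
    · refine mid_of_conn hW1.symm (by simp; omega) ?_
      simp at n1 ho ⊢; grind
    · exfalso
      have c1 : Conn G r b ([q] ++ p :: W₂) := Conn.append (by simp [Conn, qr.symm, pq.symm]) hW2 (by
        simp at nd n1 ho ⊢; grind)
      simp at hl
      refine h.four (hU.append c1 ?_) ?_ ?_ (by simp; omega)
      all_goals simp at nd n1 ho ⊢; grind
  have e : W = [] := by
    by_contra hne
    refine h.no_ear hW hne ?_
    unfold Off; simp at n1 ho ⊢; grind
  subst e
  by_cases hpU : p ∈ U
  · obtain ⟨U₁, U₂, rfl⟩ := List.append_of_mem hpU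
    obtain ⟨hU1, hU2⟩ := hU.split
    have e1 : U₁ = [] := by
      by_contra hne
      have := List.length_pos_iff.2 hne
      have c1 : Conn G p b [q, r] := by simp [Conn, qr, rb, pq]; simp at nd; tauto
      refine h.four (hU1.append c1 ?_) ?_ ?_ (by simp; omega)
      all_goals simp at nd n1 ⊢; grind
    subst e1
    refine mid_of_conn hU2 ?_ ?_
    · simp at hl; omega
    · simp at n1 ho ⊢; grind
  · exfalso
    refine h.no_both hU ?_ ?_ hE (Or.inl ?_)
    · unfold Off; simp at n1 ho ⊢; grind
    · rintro rfl; simp at hl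
    · simp at hl; omega

theorem adj_of_mid (h : Trio G a b p q r) (hE : Ext G a b p q r) (hE' : Ext G b a r q p)
    (hM : Mid G a b p q r) : G.Adj p b ∧ G.Adj a r := by
  have nd := h.nd
  have pq := h.pq
  have qr := h.qr
  have ap := h.ap
  have rb := h.rb
  have key : ∀ {a b p q r : V} (h : Trio G a b p q r) (hE : Ext G a b p q r) (hM : Mid G a b p q r),
      ∃ T, (∀ z ∈ T, Off a b p q r z) ∧ Conn G p b T := by
    clear nd pq qr ap rb hM hE hE' h
    intro a b p q r h hE hM
    have nd := h.nd
    have qr := h.qr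
    have ap := h.ap
    obtain ⟨T, hTo, hT | hT⟩ := hE
    · exact ⟨T, hTo, hT⟩
    obtain ⟨z, hz, hzp, hzr⟩ := hM
    exfalso
    have hd := h.disj (U := [z]) (x := p) (by simp [Conn, hzp.symm, hzr]) hT (by simpa using hz) hTo
    have n2 := hT.2
    unfold Off at *
    have c1 : Conn G r b ([] ++ q :: T) := Conn.append (by simp [Conn, qr.symm]) hT (by
        simp at nd ⊢; grind)
    have c2 : Conn G a r [p, z] := by simp [Conn, ap, hzp.symm, hzr]; tauto
    refine h.four (c2.append c1 ?_) ?_ ?_ (by simp)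
    all_goals simp at nd hd ⊢; grind
  obtain ⟨T, hTo, hT⟩ := key h hE hM
  obtain ⟨U, hUo, hU⟩ := key h.symm hE' hM.symm
  have hUo' : ∀ z ∈ U.reverse, Off a b p q r z := fun z hz => (hUo z (by simpa using hz)).symm
  have hd := h.disj hU.symm hT hUo' hTo
  by_cases hl : T = [] ∧ U = []
  · obtain ⟨rfl, rfl⟩ := hl
    exact ⟨conn_nil.1 hT, (conn_nil.1 hU).symm⟩
  · exfalso
    have n1 := hU.2
    have n2 := hT.2
    have c1 : Conn G r b ([q] ++ p :: T) := Conn.append (by simp [Conn, qr.symm, pq.symm]) hT (by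
      unfold Off at *; simp at nd ⊢; grind)
    have : 1 ≤ T.length + U.length := by
      by_contra hlt
      exact hl ⟨List.length_eq_zero_iff.1 (by omega), List.length_eq_zero_iff.1 (by omega)⟩
    refine h.four (hU.symm.append c1 ?_) ?_ ?_ (by simp; omega)
    · have n3 : U.reverse.Nodup := by simpa using n1
      rw [List.nodup_append]
      refine ⟨n3, c1.2.cons ?_, ?_⟩
      all_goals unfold Off at *; simp at nd hd ⊢; grind
    all_goals unfold Off at *; simp at nd hd ⊢; grind

theorem no_bad_of_mid (h : Trio G a b p q r) (hM : Mid G a b p q r)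
    (har : G.Adj a r) {R : List V} (hR : Conn G a b R) (hRa : a ∉ R) (hRb : b ∉ R) (hRr : r ∉ R)
    (hl : R.length = 3) : p ∉ R ∧ q ∉ R := by
  have nd := h.nd
  have pq := h.pq
  have qr := h.qr
  have ap := h.ap
  have rb := h.rb
  obtain ⟨z, hz, hzp, hzr⟩ := hM
  have no4 : ∀ w x y u, Conn G a b [w, x, y, u] → a ∉ [w, x, y, u] → b ∉ [w, x, y, u] → False :=
    fun w x y u h1 h2 h3 => h.four h1 h2 h3 (by simp)
  have no5 : ∀ w x y u v, Conn G a b [w, x, y, u, v] → a ∉ [w, x, y, u, v] → b ∉ [w, x, y, u, v] →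
    False := fun w x y u v h1 h2 h3 => h.four h1 h2 h3 (by simp)
  obtain ⟨x, y, u, rfl⟩ := List.length_eq_three.1 hl
  unfold Off at hz
  simp only [Conn, List.cons_append, List.nil_append, List.isChain_cons_cons, List.isChain_singleton,
    List.nodup_cons, List.mem_cons, List.not_mem_nil, or_false, not_or, List.nodup_nil] at *
  have hzb : ¬ G.Adj z b := fun hh => no4 p q r z (by grind [SimpleGraph.adj_comm]) (by grind) (by grind)
  have hza : ¬ G.Adj a z := fun hh => no4 z p q r (by grind [SimpleGraph.adj_comm]) (by grind) (by grind)
  have hqb : ¬ G.Adj q b := fun hh => no4 p z r q (by grind [SimpleGraph.adj_comm]) (by grind) (by grind)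
  have hqa : ¬ G.Adj a q := fun hh => no4 q p z r (by grind [SimpleGraph.adj_comm]) (by grind) (by grind)
  have hxq : q ≠ x := by grind
  have huq : q ≠ u := by grind
  have hxz : z ≠ x := by grind
  have huz : z ≠ u := by grind
  have hyq : q ≠ y := by
    rintro rfl
    by_cases hpu : p = u
    · subst hpu
      exact no5 x q p z r (by grind [SimpleGraph.adj_comm]) (by grind) (by grind)
    · exact no5 p z r q u (by grind [SimpleGraph.adj_comm]) (by grind) (by grind)
  have hpx : p ≠ x := by
    rintro rfl
    exact no5 r q p y u (by grind [SimpleGraph.adj_comm]) (by grind) (by grind)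
  have hpu : p ≠ u := by
    rintro rfl
    exact no5 x y p q r (by grind [SimpleGraph.adj_comm]) (by grind) (by grind)
  have hpy : p ≠ y := by
    rintro rfl
    exact no4 r q p u (by grind [SimpleGraph.adj_comm]) (by grind) (by grind)
  grind

end Trio

/-- If all connections between `a` and `b` have at most three interior vertices and those with
three interior vertices pairwise intersect, then one further vertex suffices. -/
theorem exists_of_short (hL : Link G) {a b : V} (hab : a ≠ b) (hS : Short G a b)
    (hI : ∀ R R', Conn G a b R → Conn G a b R' → a ∉ R → b ∉ R → a ∉ R' → b ∉ R' →
      R.length = 3 → R'.length = 3 → ∃ z ∈ R, z ∈ R') :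
    ∃ A : Finset V, A.card ≤ 3 ∧ IsStarForest (G.induce {v : V | v ∉ A}) := by
  classical
  by_cases h2 : ∀ R, Conn G a b R → a ∉ R → b ∉ R → R.length ≤ 2
  · refine ⟨{a, b}, Finset.card_le_two.trans (by omega), isStarForest_of_conn hL _ (α := a) (β := b)
      (by simp) (by simp) hab ?_⟩
    intro Q hQ x hx y hy hxy hc
    have ha : a ∉ Q := fun hh => hQ a hh (by simp)
    have hb : b ∉ Q := fun hh => hQ b hh (by simp)
    simp only [Finset.mem_insert, Finset.mem_singleton] at hx hy
    rcases hx with rfl | rfl <;> rcases hy with rfl | rfl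
    · exact absurd rfl hxy
    · exact h2 Q hc ha hb
    · simpa using h2 _ hc.symm (by simpa using ha) (by simpa using hb)
    · exact absurd rfl hxy
  push Not at h2
  obtain ⟨R, hR, hRa, hRb, hRl⟩ := h2
  have hR3 : R.length = 3 := by have := hS R hR hRa hRb; omega
  obtain ⟨p, q, r, rfl⟩ := List.length_eq_three.1 hR3
  have ht : Trio G a b p q r := by
    obtain ⟨hc, hn⟩ := hR
    simp at hc hn hRa hRb
    exact ⟨hS, hc.1, hc.2.1, hc.2.2.1, hc.2.2.2, by simp; grind⟩
  have hmeet : ∀ Q, Conn G a b Q → a ∉ Q → b ∉ Q → 3 ≤ Q.length → Q.length = 3 ∧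
      (p ∈ Q ∨ q ∈ Q ∨ r ∈ Q) := by
    intro Q hQ h1 h2 h3
    have h4 : Q.length = 3 := by have := hS Q hQ h1 h2; omega
    obtain ⟨z, hz, hz'⟩ := hI _ _ hR hQ hRa hRb h1 h2 hR3 h4
    simp at hz
    refine ⟨h4, ?_⟩
    rcases hz with rfl | rfl | rfl <;> simp [hz']
  -- reduction to forbidden connections for a candidate third vertex
  have red : ∀ v, v ≠ a → v ≠ b →
      (∀ Q, (∀ z ∈ Q, z ≠ a ∧ z ≠ b ∧ z ≠ v) → 3 ≤ Q.length → ¬ Conn G a b Q) →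
      (∀ Q, (∀ z ∈ Q, z ≠ a ∧ z ≠ b ∧ z ≠ v) → 3 ≤ Q.length → ¬ Conn G a v Q) →
      (∀ Q, (∀ z ∈ Q, z ≠ a ∧ z ≠ b ∧ z ≠ v) → 3 ≤ Q.length → ¬ Conn G b v Q) →
      ∃ A : Finset V, A.card ≤ 3 ∧ IsStarForest (G.induce {v : V | v ∉ A}) := by
    intro v _ _ h1 h2 h3
    refine ⟨{a, b, v}, Finset.card_le_three, isStarForest_of_conn hL _ (α := a) (β := b)
      (by simp) (by simp) hab ?_⟩
    intro Q hQ x hx y hy hxy hc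
    by_contra hlt
    have hQ' : ∀ z ∈ Q, z ≠ a ∧ z ≠ b ∧ z ≠ v := by simpa using hQ
    have hQ'' : ∀ z ∈ Q.reverse, z ≠ a ∧ z ≠ b ∧ z ≠ v := by simpa using hQ
    have hl : 3 ≤ Q.reverse.length := by simp; omega
    simp only [Finset.mem_insert, Finset.mem_singleton] at hx hy
    rcases hx with rfl | rfl | rfl <;> rcases hy with rfl | rfl | rfl
    · exact absurd rfl hxy
    · exact h1 Q hQ' (by omega) hc
    · exact h2 Q hQ' (by omega) hc
    · exact h1 _ hQ'' hl hc.symm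
    · exact absurd rfl hxy
    · exact h3 Q hQ' (by omega) hc
    · exact h2 _ hQ'' hl hc.symm
    · exact h3 _ hQ'' hl hc.symm
    · exact absurd rfl hxy
  have nd := ht.nd
  simp only [List.nodup_cons, List.mem_cons, List.not_mem_nil, or_false, not_or] at nd
  by_contra hcon
  have hE : Trio.Ext G a b p q r := by
    by_contra hne
    refine hcon (red r (by tauto) (by tauto) ?_ ?_ ?_)
    · intro Q hQ hl hc
      obtain ⟨h3, hm⟩ := hmeet Q hc (fun hh => (hQ _ hh).1 rfl) (fun hh => (hQ _ hh).2.1 rfl) hl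
      rcases ht.ext_of_conn hc hQ with h4 | h4
      · rcases hm with hm | hm | hm
        · exact (h4 _ hm).2.2.1 rfl
        · exact (h4 _ hm).2.2.2.1 rfl
        · exact (h4 _ hm).2.2.2.2 rfl
      · exact hne h4
    · intro Q hQ hl hc
      have n1 := hc.2
      refine ht.four (hc.append (conn_nil.2 ht.rb) ?_) ?_ ?_ (by simp; omega)
      · rw [List.nodup_append]; simp; grind
      · simp; grind
      · simp; grind
    · intro Q hQ hl hc
      rcases ht.ext_of_conn hc.symm (by simpa using hQ) with h4 | h4
      · exact ht.no_ear hc.symm (by rintro hh; simp at hh; simp [hh] at hl) h4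
      · exact hne h4
  have hE' : Trio.Ext G b a r q p := by
    by_contra hne
    refine hcon (red p (by tauto) (by tauto) ?_ ?_ ?_)
    · intro Q hQ hl hc
      obtain ⟨h3, hm⟩ := hmeet Q hc (fun hh => (hQ _ hh).1 rfl) (fun hh => (hQ _ hh).2.1 rfl) hl
      rcases ht.symm.ext_of_conn hc.symm (fun z hz => by have := hQ z (by simpa using hz); tauto)
        with h4 | h4
      · have h5 : ∀ z ∈ Q, Trio.Off b a r q p z := by simpa using h4
        rcases hm with hm | hm | hm
        · exact (h5 _ hm).2.2.2.2 rfl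
        · exact (h5 _ hm).2.2.2.1 rfl
        · exact (h5 _ hm).2.2.1 rfl
      · exact hne h4
    · intro Q hQ hl hc
      rcases ht.symm.ext_of_conn hc.symm (fun z hz => by have := hQ z (by simpa using hz); tauto)
        with h4 | h4
      · exact ht.symm.no_ear hc.symm (by rintro hh; simp at hh; simp [hh] at hl) h4
      · exact hne h4
    · intro Q hQ hl hc
      have n1 := hc.2
      refine ht.symm.four (hc.append (conn_nil.2 ht.ap.symm) ?_) ?_ ?_ (by simp; omega)
      · rw [List.nodup_append]; simp; grind
      · simp; grind
      · simp; grind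
  have hM : Trio.Mid G a b p q r := by
    by_contra hne
    refine hcon (red q (by tauto) (by tauto) ?_ ?_ ?_)
    · intro Q hQ hl hc
      obtain ⟨h3, hm⟩ := hmeet Q hc (fun hh => (hQ _ hh).1 rfl) (fun hh => (hQ _ hh).2.1 rfl) hl
      rcases hm with hm | hm | hm
      · refine hne (ht.symm.mid_of_bad_mid hE' hc.symm (fun z hz => ?_) (by simpa using h3)
          (by simpa using hm)).symm
        have := hQ z (by simpa using hz); tauto
      · exact (hQ _ hm).2.2 rfl
      · exact hne (ht.mid_of_bad_mid hE hc hQ h3 hm)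
    · intro Q hQ hl hc
      exact hne (ht.mid_of_bad_left hE hc hQ hl)
    · intro Q hQ hl hc
      exact hne (ht.symm.mid_of_bad_left hE' hc (fun z hz => by have := hQ z hz; tauto) hl).symm
  obtain ⟨hpb, har⟩ := ht.adj_of_mid hE hE' hM
  refine hcon (red r (by tauto) (by tauto) ?_ ?_ ?_)
  · intro Q hQ hl hc
    obtain ⟨h3, hm⟩ := hmeet Q hc (fun hh => (hQ _ hh).1 rfl) (fun hh => (hQ _ hh).2.1 rfl) hl
    have := ht.no_bad_of_mid hM har hc (fun hh => (hQ _ hh).1 rfl) (fun hh => (hQ _ hh).2.1 rfl)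
      (fun hh => (hQ _ hh).2.2 rfl) h3
    have : r ∉ Q := fun hh => (hQ _ hh).2.2 rfl
    tauto
  · intro Q hQ hl hc
    have n1 := hc.2
    refine ht.four (hc.append (conn_nil.2 ht.rb) ?_) ?_ ?_ (by simp; omega)
    · rw [List.nodup_append]; simp; grind
    · simp; grind
    · simp; grind
  · intro Q hQ hl hc
    have n1 := hc.2
    refine ht.symm.four (hc.append (conn_nil.2 har.symm) ?_) ?_ ?_ (by simp; omega)
    · rw [List.nodup_append]; simp; grind
    · simp; grind
    · simp; grind

open Classical in
/-- The neighbours of `v` inside `S`. -/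
noncomputable def nb (G : SimpleGraph V) (S : Finset V) (v : V) : Finset V := S.filter (G.Adj v)

/-- The number of neighbours of `v` inside `S`. -/
noncomputable def dg (G : SimpleGraph V) (S : Finset V) (v : V) : ℕ := (nb G S v).card

/-- The degree sum of the subgraph induced by `S`. -/
noncomputable def ds (G : SimpleGraph V) (S : Finset V) : ℕ := ∑ v ∈ S, dg G S v

theorem mem_nb {S : Finset V} {v w : V} : w ∈ nb G S v ↔ w ∈ S ∧ G.Adj v w := by
  classical
  simp [nb]

theorem dg_insert [DecidableEq V] {S : Finset V} {v w : V} (hv : v ∉ S) :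
    dg G (insert v S) w = dg G S w + (open Classical in if G.Adj w v then 1 else 0) := by
  classical
  unfold dg
  split_ifs with h
  · have : nb G (insert v S) w = insert v (nb G S w) := by
      ext x; simp only [mem_nb, Finset.mem_insert]
      constructor
      · rintro ⟨rfl | h1, h2⟩ <;> simp [*]
      · rintro (rfl | h1) <;> simp [*]
    rw [this, Finset.card_insert_of_notMem]
    simp [mem_nb, hv]
  · have : nb G (insert v S) w = nb G S w := by
      ext x; simp only [mem_nb, Finset.mem_insert]
      constructor
      · rintro ⟨rfl | h1, h2⟩
        · exact absurd h2 h
        · exact ⟨h1, h2⟩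
      · rintro ⟨h1, h2⟩; exact ⟨Or.inr h1, h2⟩
    rw [this]; simp

theorem ds_insert [DecidableEq V] {S : Finset V} {v : V} (hv : v ∉ S) :
    ds G (insert v S) = ds G S + 2 * dg G S v := by
  classical
  unfold ds
  rw [Finset.sum_insert hv, Finset.sum_congr rfl fun w _ => dg_insert hv, Finset.sum_add_distrib,
    dg_insert hv]
  have : (∑ w ∈ S, if G.Adj w v then 1 else 0) = dg G S v := by
    rw [dg, nb, Finset.card_filter]
    exact Finset.sum_congr rfl fun w _ => by simp [G.adj_comm]
  simp only [G.loopless, SimpleGraph.irrefl, if_false]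
  simp at this ⊢
  omega

theorem ds_erase [DecidableEq V] {S : Finset V} {v : V} (hv : v ∈ S) :
    ds G S = ds G (S.erase v) + 2 * dg G S v := by
  conv_lhs => rw [← Finset.insert_erase hv]
  rw [ds_insert (Finset.notMem_erase v S)]
  congr 2
  unfold dg
  congr 1
  ext w
  simp only [mem_nb, Finset.mem_erase]
  constructor
  · rintro ⟨⟨-, h1⟩, h2⟩; exact ⟨h1, h2⟩
  · rintro ⟨h1, h2⟩; exact ⟨⟨h2.ne', h1⟩, h2⟩

theorem dg_lt {S : Finset V} {v : V} (hv : v ∈ S) : dg G S v < S.card := by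
  refine Finset.card_lt_card ⟨fun w hw => (mem_nb.1 hw).1, fun h => ?_⟩
  exact G.irrefl (mem_nb.1 (h hv)).2

theorem ds_univ [Fintype V] : ds G Finset.univ = 2 * G.edgeSet.ncard := by
  classical
  unfold ds
  have h := G.sum_degrees_eq_twice_card_edges
  rw [← Set.ncard_coe_finset, SimpleGraph.coe_edgeFinset] at h
  rw [← h]
  refine Finset.sum_congr rfl fun v _ => ?_
  rw [← G.card_neighborFinset_eq_degree, dg]
  congr 1
  ext w; simp [mem_nb]

theorem ds_le_of_degenerate [DecidableEq V] {C : Finset V} {d : ℕ} (U : Finset V) (hU : Disjoint C U)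
    (h : ∀ T ⊆ U, T.Nonempty → ∃ v ∈ T, dg G (C ∪ T) v ≤ d) :
    ds G (C ∪ U) ≤ ds G C + 2 * d * U.card := by
  induction hn : U.card generalizing U with
  | zero => rw [Finset.card_eq_zero.1 hn]; simp
  | succ n ih =>
    obtain ⟨v, hv, hd⟩ := h U subset_rfl (Finset.card_pos.1 (by omega))
    have hvC : v ∉ C := fun hh => Finset.disjoint_left.1 hU hh hv
    have h1 := ih (U.erase v) (hU.mono_right (Finset.erase_subset v U))
      (fun T hT => h T (hT.trans (Finset.erase_subset v U)))
      (by rw [Finset.card_erase_of_mem hv]; omega)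
    have h2 : (C ∪ U).erase v = C ∪ U.erase v := by
      ext w; simp only [Finset.mem_erase, Finset.mem_union]
      constructor
      · rintro ⟨a, b | b⟩ <;> simp [*]
      · rintro (a | a)
        · exact ⟨fun hh => hvC (hh ▸ a), Or.inl a⟩
        · exact ⟨a.1, Or.inr a.2⟩
    rw [ds_erase (Finset.mem_union_right C hv), h2]
    nlinarith

namespace Cyc

variable {f : ℕ → V} {c : ℕ}

theorem ds_add_card_le [DecidableEq V] (h : Cyc G f c) (M : Finset (ℕ × ℕ))
    (hM : ∀ x ∈ M, x.1 < c ∧ x.2 < c ∧ ¬ G.Adj (f x.1) (f x.2)) :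
    ds G ((Finset.range c).image f) + M.card ≤ c * c := by
  classical
  have hinj : Set.InjOn f (Finset.range c) := fun i hi j hj he =>
    h.inj i j (by simpa using hi) (by simpa using hj) he
  have h1 : ds G ((Finset.range c).image f) =
      ((Finset.range c ×ˢ Finset.range c).filter fun x => G.Adj (f x.1) (f x.2)).card := by
    unfold ds
    rw [Finset.sum_image hinj, Finset.card_filter, Finset.sum_product]
    refine Finset.sum_congr rfl fun i _ => ?_
    rw [dg, nb, Finset.filter_image, Finset.card_image_of_injOn
      (hinj.mono (Finset.coe_subset.2 (Finset.filter_subset _ _))), Finset.card_filter]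
  have h2 : M ⊆ (Finset.range c ×ˢ Finset.range c).filter fun x => ¬ G.Adj (f x.1) (f x.2) := by
    intro x hx
    have := hM x hx
    simp [this]
  have h3 := Finset.card_le_card h2
  have h4 := Finset.card_filter_add_card_filter_not (s := Finset.range c ×ˢ Finset.range c)
    (fun x => G.Adj (f x.1) (f x.2))
  simp only [Finset.card_product, Finset.card_range] at h4
  omega

theorem ds_add_two_mul_card_le [DecidableEq V] (h : Cyc G f c) (M : Finset (ℕ × ℕ))
    (hM : ∀ x ∈ M, x.1 < x.2 ∧ x.2 < c ∧ ¬ G.Adj (f x.1) (f x.2)) :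
    ds G ((Finset.range c).image f) + (2 * M.card + c) ≤ c * c := by
  have hd : ∀ x ∈ (Finset.range c).image fun i => (i, i), x.1 = x.2 ∧ x.1 < c := by
    intro x hx
    obtain ⟨i, hi, rfl⟩ := Finset.mem_image.1 hx
    exact ⟨rfl, by simpa using hi⟩
  have hs : ∀ x ∈ M.image Prod.swap, x.2 < x.1 ∧ x.1 < c ∧ ¬ G.Adj (f x.1) (f x.2) := by
    intro x hx
    obtain ⟨y, hy, rfl⟩ := Finset.mem_image.1 hx
    have := hM y hy
    exact ⟨this.1, this.2.1, fun hh => this.2.2 hh.symm⟩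
  have := h.ds_add_card_le (M ∪ M.image Prod.swap ∪ (Finset.range c).image fun i => (i, i)) (by
    intro x hx
    rcases Finset.mem_union.1 hx with hx | hx
    · rcases Finset.mem_union.1 hx with hx | hx
      · have := hM x hx; exact ⟨by omega, this.2⟩
      · have := hs x hx; exact ⟨by omega, by omega, this.2.2⟩
    · have := hd x hx
      refine ⟨this.2, by omega, ?_⟩
      rw [this.1]; exact G.irrefl)
  rw [Finset.card_union_of_disjoint, Finset.card_union_of_disjoint,
    Finset.card_image_of_injective _ Prod.swap_injective,
    Finset.card_image_of_injective _ (fun a b h => (Prod.ext_iff.1 h).1), Finset.card_range] at this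
  · omega
  · rw [Finset.disjoint_left]
    intro x hx hx'
    have := hM x hx
    have := hs x hx'
    omega
  · rw [Finset.disjoint_left]
    intro x hx hx'
    have := hd x hx'
    rcases Finset.mem_union.1 hx with hx | hx
    · have := hM x hx; omega
    · have := hs x hx; omega

/-- An ear of a longest cycle excludes spanning paths of the cycle between its ends. -/
theorem no_spanning_path (h : Cyc G f c) (hN : NoLong G (c + 1)) {i j : ℕ} {Q : List V}
    (hQ : Conn G (f i) (f j) Q) (hQ0 : Q ≠ []) (hoff : ∀ z ∈ Q, ∀ m, f m ≠ z) (l : List ℕ)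
    (hi : l.head? = some i) (hj : l.getLast? = some j) (hnd : l.Nodup) (hl : ∀ x ∈ l, x < c)
    (hc : l.length = c) : ¬ (l.map f).IsChain G.Adj := by
  intro hch
  have hp : Pth G (f i) (f j) (l.map f) := by
    refine ⟨hch, by simp [hi], by simp [hj], ?_⟩
    exact List.Nodup.map_on (fun x hx y hy he => h.inj x y (hl x hx) (hl y hy) he) hnd
  have := hN.close hp hQ.symm (by
    intro z hz hz'
    obtain ⟨m, -, rfl⟩ := List.mem_map.1 hz'
    exact hoff _ (by simpa using hz) m rfl)
  have := List.length_pos_iff.2 hQ0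
  simp at *; omega

theorem ds_le_of_ear_six [DecidableEq V] (h : Cyc G f 6) (hN : NoLong G 7) {b : ℕ}
    (hb : b = 2 ∨ b = 3) {Q : List V} (hQ : Conn G (f 0) (f b) Q) (hQ0 : Q ≠ [])
    (hoff : ∀ z ∈ Q, ∀ m, f m ≠ z) : ds G ((Finset.range 6).image f) ≤ 24 := by
  have a0 : G.Adj (f 0) (f 1) := h.adj 0
  have a1 : G.Adj (f 1) (f 2) := h.adj 1
  have a2 : G.Adj (f 2) (f 3) := h.adj 2
  have a3 : G.Adj (f 3) (f 4) := h.adj 3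
  have a4 : G.Adj (f 4) (f 5) := h.adj 4
  have a5 : G.Adj (f 0) (f 5) := by have := h.adj 5; rw [h.per 0] at this; exact this.symm
  have key : ∀ l : List ℕ, (l.map f).IsChain G.Adj → l.head? = some 0 → l.getLast? = some b →
      l.Nodup → (∀ x ∈ l, x < 6) → l.length = 6 → False := fun l h1 h2 h3 h4 h5 h6 =>
    h.no_spanning_path hN hQ hQ0 hoff l h2 h3 h4 h5 h6 h1
  have count := h.ds_add_two_mul_card_le
  rcases hb with rfl | rfl
  · have n13 : ¬ G.Adj (f 1) (f 3) := fun hh => key [0, 5, 4, 3, 1, 2]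
      (by simp [a0, a1, a2, a3, a4, a5, a0.symm, a1.symm, a2.symm, a3.symm, a4.symm, a5.symm, hh, hh.symm])
      (by decide) (by decide) (by decide) (by decide) (by decide)
    have n15 : ¬ G.Adj (f 1) (f 5) := fun hh => key [0, 1, 5, 4, 3, 2]
      (by simp [a0, a1, a2, a3, a4, a5, a0.symm, a1.symm, a2.symm, a3.symm, a4.symm, a5.symm, hh, hh.symm])
      (by decide) (by decide) (by decide) (by decide) (by decide)
    have n1435 : ¬ G.Adj (f 1) (f 4) ∨ ¬ G.Adj (f 3) (f 5) := by
      by_contra! hh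
      exact key [0, 1, 4, 5, 3, 2]
        (by simp [a0, a1, a2, a3, a4, a5, a0.symm, a1.symm, a2.symm, a3.symm, a4.symm, a5.symm, hh.1, hh.1.symm, hh.2, hh.2.symm])
        (by decide) (by decide) (by decide) (by decide) (by decide)
    rcases n1435 with n | n
    · have := count {(1, 3), (1, 5), (1, 4)} (by simp [n13, n15, n])
      simpa using this
    · have := count {(1, 3), (1, 5), (3, 5)} (by simp [n13, n15, n])
      simpa using this
  · have n14 : ¬ G.Adj (f 1) (f 4) := fun hh => key [0, 5, 4, 1, 2, 3]
      (by simp [a0, a1, a2, a3, a4, a5, a0.symm, a1.symm, a2.symm, a3.symm, a4.symm, a5.symm, hh, hh.symm])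
      (by decide) (by decide) (by decide) (by decide) (by decide)
    have n25 : ¬ G.Adj (f 2) (f 5) := fun hh => key [0, 1, 2, 5, 4, 3]
      (by simp [a0, a1, a2, a3, a4, a5, a0.symm, a1.symm, a2.symm, a3.symm, a4.symm, a5.symm, hh, hh.symm])
      (by decide) (by decide) (by decide) (by decide) (by decide)
    have n2435 : ¬ G.Adj (f 2) (f 4) ∨ ¬ G.Adj (f 3) (f 5) := by
      by_contra! hh
      exact key [0, 1, 2, 4, 5, 3]
        (by simp [a0, a1, a2, a3, a4, a5, a0.symm, a1.symm, a2.symm, a3.symm, a4.symm, a5.symm, hh.1, hh.1.symm, hh.2, hh.2.symm])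
        (by decide) (by decide) (by decide) (by decide) (by decide)
    rcases n2435 with n | n
    · have := count {(1, 4), (2, 5), (2, 4)} (by simp [n14, n25, n])
      simpa using this
    · have := count {(1, 4), (2, 5), (3, 5)} (by simp [n14, n25, n])
      simpa using this

theorem ds_le_of_ear_seven [DecidableEq V] (h : Cyc G f 7) (hN : NoLong G 8) {b : ℕ}
    (hb : b = 2 ∨ b = 3) {Q : List V} (hQ : Conn G (f 0) (f b) Q) (hQ0 : Q ≠ [])
    (hoff : ∀ z ∈ Q, ∀ m, f m ≠ z) : ds G ((Finset.range 7).image f) ≤ 34 := by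
  have a0 : G.Adj (f 0) (f 1) := h.adj 0
  have a1 : G.Adj (f 1) (f 2) := h.adj 1
  have a2 : G.Adj (f 2) (f 3) := h.adj 2
  have a3 : G.Adj (f 3) (f 4) := h.adj 3
  have a4 : G.Adj (f 4) (f 5) := h.adj 4
  have a5 : G.Adj (f 5) (f 6) := h.adj 5
  have a6 : G.Adj (f 0) (f 6) := by have := h.adj 6; rw [h.per 0] at this; exact this.symm
  have key : ∀ l : List ℕ, (l.map f).IsChain G.Adj → l.head? = some 0 → l.getLast? = some b →
      l.Nodup → (∀ x ∈ l, x < 7) → l.length = 7 → False := fun l h1 h2 h3 h4 h5 h6 =>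
    h.no_spanning_path hN hQ hQ0 hoff l h2 h3 h4 h5 h6 h1
  have count := h.ds_add_two_mul_card_le
  rcases hb with rfl | rfl
  · have n13 : ¬ G.Adj (f 1) (f 3) := fun hh => key [0, 6, 5, 4, 3, 1, 2]
      (by simp [a0, a1, a2, a3, a4, a5, a6, a0.symm, a1.symm, a2.symm, a3.symm, a4.symm, a5.symm, a6.symm, hh, hh.symm])
      (by decide) (by decide) (by decide) (by decide) (by decide)
    have n16 : ¬ G.Adj (f 1) (f 6) := fun hh => key [0, 1, 6, 5, 4, 3, 2]
      (by simp [a0, a1, a2, a3, a4, a5, a6, a0.symm, a1.symm, a2.symm, a3.symm, a4.symm, a5.symm, a6.symm, hh, hh.symm])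
      (by decide) (by decide) (by decide) (by decide) (by decide)
    have n1436 : ¬ G.Adj (f 1) (f 4) ∨ ¬ G.Adj (f 3) (f 6) := by
      by_contra! hh
      exact key [0, 1, 4, 5, 6, 3, 2]
        (by simp [a0, a1, a2, a3, a4, a5, a6, a0.symm, a1.symm, a2.symm, a3.symm, a4.symm, a5.symm, a6.symm, hh.1, hh.1.symm, hh.2, hh.2.symm])
        (by decide) (by decide) (by decide) (by decide) (by decide)
    have n1546 : ¬ G.Adj (f 1) (f 5) ∨ ¬ G.Adj (f 4) (f 6) := by
      by_contra! hh
      exact key [0, 1, 5, 6, 4, 3, 2]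
        (by simp [a0, a1, a2, a3, a4, a5, a6, a0.symm, a1.symm, a2.symm, a3.symm, a4.symm, a5.symm, a6.symm, hh.1, hh.1.symm, hh.2, hh.2.symm])
        (by decide) (by decide) (by decide) (by decide) (by decide)
    rcases n1436 with n | n <;> rcases n1546 with n' | n'
    · have := count {(1, 3), (1, 6), (1, 4), (1, 5)} (by simp [n13, n16, n, n'])
      simpa using this
    · have := count {(1, 3), (1, 6), (1, 4), (4, 6)} (by simp [n13, n16, n, n'])
      simpa using this
    · have := count {(1, 3), (1, 6), (3, 6), (1, 5)} (by simp [n13, n16, n, n'])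
      simpa using this
    · have := count {(1, 3), (1, 6), (3, 6), (4, 6)} (by simp [n13, n16, n, n'])
      simpa using this
  · have n14 : ¬ G.Adj (f 1) (f 4) := fun hh => key [0, 6, 5, 4, 1, 2, 3]
      (by simp [a0, a1, a2, a3, a4, a5, a6, a0.symm, a1.symm, a2.symm, a3.symm, a4.symm, a5.symm, a6.symm, hh, hh.symm])
      (by decide) (by decide) (by decide) (by decide) (by decide)
    have n26 : ¬ G.Adj (f 2) (f 6) := fun hh => key [0, 1, 2, 6, 5, 4, 3]
      (by simp [a0, a1, a2, a3, a4, a5, a6, a0.symm, a1.symm, a2.symm, a3.symm, a4.symm, a5.symm, a6.symm, hh, hh.symm])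
      (by decide) (by decide) (by decide) (by decide) (by decide)
    have n2436 : ¬ G.Adj (f 2) (f 4) ∨ ¬ G.Adj (f 3) (f 6) := by
      by_contra! hh
      exact key [0, 1, 2, 4, 5, 6, 3]
        (by simp [a0, a1, a2, a3, a4, a5, a6, a0.symm, a1.symm, a2.symm, a3.symm, a4.symm, a5.symm, a6.symm, hh.1, hh.1.symm, hh.2, hh.2.symm])
        (by decide) (by decide) (by decide) (by decide) (by decide)
    have n2546 : ¬ G.Adj (f 2) (f 5) ∨ ¬ G.Adj (f 4) (f 6) := by
      by_contra! hh
      exact key [0, 1, 2, 5, 6, 4, 3]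
        (by simp [a0, a1, a2, a3, a4, a5, a6, a0.symm, a1.symm, a2.symm, a3.symm, a4.symm, a5.symm, a6.symm, hh.1, hh.1.symm, hh.2, hh.2.symm])
        (by decide) (by decide) (by decide) (by decide) (by decide)
    rcases n2436 with n | n <;> rcases n2546 with n' | n'
    · have := count {(1, 4), (2, 6), (2, 4), (2, 5)} (by simp [n14, n26, n, n'])
      simpa using this
    · have := count {(1, 4), (2, 6), (2, 4), (4, 6)} (by simp [n14, n26, n, n'])
      simpa using this
    · have := count {(1, 4), (2, 6), (3, 6), (2, 5)} (by simp [n14, n26, n, n'])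
      simpa using this
    · have := count {(1, 4), (2, 6), (3, 6), (4, 6)} (by simp [n14, n26, n, n'])
      simpa using this

end Cyc

theorem Conn.subset_of_closed {a b : V} {Q : List V} (hQ : Conn G a b Q) (D : Set V)
    (hD : ∀ z ∈ D, ∀ w, G.Adj z w → w ∈ D ∨ w ∉ Q) {z : V} (hz : z ∈ Q) (hzD : z ∈ D) :
    ∀ w ∈ Q, w ∈ D := by
  obtain ⟨p, q, -, hP, -⟩ := hQ.pth (List.ne_nil_of_mem hz)
  have h1 : Q.IsChain (fun x y => x ∈ D ↔ y ∈ D) := by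
    have := hP.1
    rw [List.isChain_iff_getElem] at this ⊢
    intro i hi
    have h2 := this i hi
    constructor
    · intro h; exact (hD _ h _ h2).resolve_right (by simp)
    · intro h; exact (hD _ h _ h2.symm).resolve_right (by simp)
  have : IsTrans V (fun x y => x ∈ D ↔ y ∈ D) := ⟨fun _ _ _ h h' => h.trans h'⟩
  rw [List.isChain_iff_pairwise] at h1
  intro w hw
  have : Std.Symm (fun x y => x ∈ D ↔ y ∈ D) := ⟨fun _ _ h => h.symm⟩
  have := List.Pairwise.forall_of_forall (R := fun x y => x ∈ D ↔ y ∈ D) (fun _ _ => Iff.rfl) h1 hz hw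
  exact this.1 hzD

/-- A component `{d, e}` completely joined to `{a, b}`. -/
theorem exists_of_twin (hL : Link G) (hN : NoLong G 8) {a b d e : V} (hab : a ≠ b) (hdb : d ≠ b)
    (hea : e ≠ a) (hde : G.Adj d e) (hda : G.Adj d a) (heb : G.Adj e b)
    (hd : ∀ w, G.Adj d w → w = a ∨ w = b ∨ w = e) (he : ∀ w, G.Adj e w → w = a ∨ w = b ∨ w = d) :
    ∃ A : Finset V, A.card ≤ 3 ∧ IsStarForest (G.induce {v : V | v ∉ A}) := by
  classical
  have hp : Pth G b a [b, e, d, a] := by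
    have := hda.ne
    have := hde.ne
    have := heb.ne
    refine ⟨by simp [heb.symm, hde.symm, hda], by simp, by simp, ?_⟩
    simp; grind
  have hmeet : ∀ Q, Conn G a b Q → a ∉ Q → b ∉ Q → d ∈ Q ∨ e ∈ Q → Q.length ≤ 2 := by
    intro Q hQ ha hb hm
    have hsub : ∀ w ∈ Q, w ∈ ({d, e} : Set V) := by
      have hcl : ∀ z ∈ ({d, e} : Set V), ∀ w, G.Adj z w → w ∈ ({d, e} : Set V) ∨ w ∉ Q := by
        rintro z (rfl | rfl) w hw
        · rcases hd w hw with rfl | rfl | rfl <;> simp [*]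
        · rcases he w hw with rfl | rfl | rfl <;> simp [*]
      rcases hm with hm | hm
      · exact hQ.subset_of_closed _ hcl hm (by simp)
      · exact hQ.subset_of_closed _ hcl hm (by simp)
    rw [← List.toFinset_card_of_nodup hQ.2]
    refine (Finset.card_le_card (t := {d, e}) ?_).trans Finset.card_le_two
    intro w hw
    have := hsub w (by simpa using hw)
    simpa using this
  have hmiss : ∀ Q, Conn G a b Q → a ∉ Q → b ∉ Q → d ∉ Q → e ∉ Q → Q.length ≤ 3 := by
    intro Q hQ h1 h2 h3 h4
    have := hN.close hp hQ (by
      intro z hz hz'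
      simp at hz'
      rcases hz' with rfl | rfl | rfl | rfl <;> contradiction)
    simp at this; omega
  refine exists_of_short hL hab ?_ ?_
  · intro Q hQ h1 h2
    by_cases hm : d ∈ Q ∨ e ∈ Q
    · have := hmeet Q hQ h1 h2 hm; omega
    · push Not at hm
      exact hmiss Q hQ h1 h2 hm.1 hm.2
  · intro R R' hR hR' h1 h2 h3 h4 h5 h6
    by_contra! hdis
    obtain ⟨p, q, g1, g2, g3⟩ := hR.pth (by rintro rfl; simp at h5)
    have hp' : Pth G a b (a :: (R ++ [b])) := by
      refine (g2.concat g3 h2).cons g1 ?_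
      simp [h1, hab]
    have := hN.close hp' hR'.symm (by
      intro z hz hz'
      simp at hz hz'
      rcases hz' with rfl | hz' | rfl
      · exact h3 hz
      · exact hdis z hz' hz
      · exact h4 hz)
    simp at this; omega

theorem Cyc.ds_le_of_ear [DecidableEq V] {f : ℕ → V} {c : ℕ} (h : Cyc G f c) (hN : NoLong G (c + 1))
    (hc : c = 6 ∨ c = 7) {i j : ℕ} (hij : i < j) (hj : j < c) {Q : List V} (hQ0 : Q ≠ [])
    (hQ : Conn G (f i) (f j) Q) (hoff : ∀ z ∈ Q, ∀ m, f m ≠ z)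
    (h1 : Q.length + 1 ≤ j - i) (h2 : Q.length + 1 ≤ c - (j - i)) :
    ds G ((Finset.range c).image f) ≤ if c = 6 then 24 else 34 := by
  have hl := List.length_pos_iff.2 hQ0
  have himg : ∀ r, (Finset.range c).image (fun m => f (m + r)) = (Finset.range c).image f := by
    intro r
    ext x
    simp only [Finset.mem_image, Finset.mem_range]
    constructor
    · rintro ⟨m, -, rfl⟩
      exact ⟨_, Nat.mod_lt _ h.pos, h.mod _⟩
    · rintro ⟨m, hm, rfl⟩
      obtain ⟨q, hq⟩ : ∃ q, r ≤ m + q * c := ⟨r, by nlinarith [h.pos]⟩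
      refine ⟨(m + q * c - r) % c, Nat.mod_lt _ h.pos, ?_⟩
      rw [h.eq_iff]
      have : (m + q * c - r) % c + r ≡ m + q * c - r + r [MOD c] :=
        Nat.ModEq.add_right _ (Nat.mod_modEq _ _)
      rw [Nat.sub_add_cancel hq] at this
      refine this.trans ?_
      simp [Nat.ModEq]
  obtain ⟨r, b, hb, hc'⟩ : ∃ r b, (b = 2 ∨ b = 3) ∧ ∃ Q, Q ≠ [] ∧ Conn G (f (0 + r)) (f (b + r)) Q ∧
      (∀ z ∈ Q, ∀ m, f m ≠ z) := by
    by_cases hb : j - i ≤ 3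
    · refine ⟨i, j - i, by omega, Q, hQ0, ?_, hoff⟩
      rw [show j - i + i = j by omega, Nat.zero_add]; exact hQ
    · refine ⟨j, c - (j - i), by omega, Q.reverse, by simpa using hQ0, ?_, by simpa using hoff⟩
      rw [show c - (j - i) + j = i + c by omega, Nat.zero_add, h.per]; exact hQ.symm
  obtain ⟨Q', hQ0', hQ', hoff'⟩ := hc'
  rw [← himg r]
  have hoff'' : ∀ z ∈ Q', ∀ m, f (m + r) ≠ z := fun z hz m => hoff' z hz _
  have hs := h.shift r
  rcases hc with rfl | rfl
  · exact hs.ds_le_of_ear_six hN hb hQ' hQ0' hoff''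
  · exact hs.ds_le_of_ear_seven hN hb hQ' hQ0' hoff''

theorem Cyc.ear_dist {f : ℕ → V} {c : ℕ} (h : Cyc G f c) (hN : NoLong G (c + 1)) {i j : ℕ}
    (hi : i < c) (hj : j < c) (hij : i ≠ j) {Q : List V} (hQ : Conn G (f i) (f j) Q)
    (hoff : ∀ z ∈ Q, ∀ m, f m ≠ z) :
    i + Q.length + 1 ≤ j ∧ j + Q.length + 1 ≤ i + c ∨
      j + Q.length + 1 ≤ i ∧ i + Q.length + 1 ≤ j + c := by
  rcases Nat.lt_or_gt_of_ne hij with hlt | hlt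
  · have h1 := h.ear_le hN (i := i) (j := j) (by omega) (by omega) hQ hoff
    have h2 := h.ear_le' hN (i := i) (j := j) (by omega) (by omega) hQ hoff
    omega
  · have hoff' : ∀ z ∈ Q.reverse, ∀ m, f m ≠ z := by simpa using hoff
    have h1 := h.ear_le hN (i := j) (j := i) (by omega) (by omega) hQ.symm hoff'
    have h2 := h.ear_le' hN (i := j) (j := i) (by omega) (by omega) hQ.symm hoff'
    simp only [List.length_reverse] at h1 h2
    omega

theorem mem_image_cyc [DecidableEq V] {f : ℕ → V} {c : ℕ} (h : Cyc G f c) {x : V} :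
    x ∈ (Finset.range c).image f ↔ ∃ m, f m = x := by
  simp only [Finset.mem_image, Finset.mem_range]
  constructor
  · rintro ⟨m, -, rfl⟩; exact ⟨m, rfl⟩
  · rintro ⟨m, rfl⟩; exact ⟨_, Nat.mod_lt _ h.pos, h.mod _⟩

theorem exists_star_edge {C : Finset V} (h : IsStarForest (G.induce {v : V | v ∉ C}))
    {a b : V} (ha : a ∉ C) (hb : b ∉ C) (hab : G.Adj a b) :
    ∃ x v, (x = a ∧ v = b ∨ x = b ∧ v = a) ∧
      ∀ w, w ∉ C → G.Adj x w → ∀ u, u ∉ C → G.Adj w u → u = x := by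
  obtain ⟨x, hx⟩ := h ⟨a, ha⟩
  have hab' : (G.induce {v : V | v ∉ C}).Adj ⟨a, ha⟩ ⟨b, hb⟩ := hab
  have key : ∀ y : {v : V | v ∉ C}, (G.induce {v : V | v ∉ C}).Reachable y ⟨a, ha⟩ → y = x →
      ∀ w, w ∉ C → G.Adj y w → ∀ u, u ∉ C → G.Adj w u → u = y := by
    rintro y hy rfl w hw hyw u hu hwu
    have hyw' : (G.induce {v : V | v ∉ C}).Adj ⟨w, hw⟩ y := hyw.symm
    have := hx ⟨w, hw⟩ ⟨u, hu⟩ hwu (hyw'.reachable.trans hy)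
    rcases this with h1 | h1
    · exact absurd (congrArg Subtype.val h1) hyw.ne'
    · exact congrArg Subtype.val h1
  rcases hx _ _ hab' (SimpleGraph.Reachable.refl _) with h1 | h1
  · exact ⟨a, b, by simp, key ⟨a, ha⟩ (SimpleGraph.Reachable.refl _) h1⟩
  · exact ⟨b, a, by simp, key ⟨b, hb⟩ hab'.symm.reachable h1⟩

theorem conn_one {a b v : V} (h1 : G.Adj v a) (h2 : G.Adj v b) : Conn G a b [v] := by
  refine ⟨by simp [h1.symm, h2], by simp⟩

theorem conn_two {a b v x : V} (h1 : G.Adj v a) (h : G.Adj v x) (h2 : G.Adj x b) :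
    Conn G a b [v, x] := by
  refine ⟨by simp [h1.symm, h, h2], by simp [h.ne]⟩

theorem Cyc.exists_of_twin [DecidableEq V] (hL : Link G) {f : ℕ → V} {c : ℕ} (h : Cyc G f c)
    (hN : NoLong G (c + 1)) (hc : c = 6 ∨ c = 7)
    (hconn : ∀ a ∈ (Finset.range c).image f, ∀ b ∈ (Finset.range c).image f, a ≠ b →
      ∀ Q, (∀ z ∈ Q, z ∉ (Finset.range c).image f) → Conn G a b Q → Q.length ≤ 2)
    (hstar : IsStarForest (G.induce {v : V | v ∉ (Finset.range c).image f}))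
    (hle : ∀ w, w ∉ (Finset.range c).image f → dg G ((Finset.range c).image f) w ≤ 2)
    {T : Finset V} (hT : ∀ v ∈ T, v ∉ (Finset.range c).image f) (hT0 : T.Nonempty)
    (hd : ∀ v ∈ T, 3 ≤ dg G ((Finset.range c).image f ∪ T) v) :
    ∃ A : Finset V, A.card ≤ 3 ∧ IsStarForest (G.induce {v : V | v ∉ A}) := by
  set C := (Finset.range c).image f with hC
  have hdeg : ∀ v ∈ T, 3 ≤ dg G C v + (nb G T v).card := by
    intro v hv
    refine (hd v hv).trans ?_
    refine le_trans (Finset.card_le_card ?_) (Finset.card_union_le (nb G C v) (nb G T v))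
    intro w hw
    simp only [mem_nb, Finset.mem_union] at hw ⊢
    tauto
  obtain ⟨v₀, hv₀⟩ := hT0
  obtain ⟨u₀, hu₀⟩ : (nb G T v₀).Nonempty := by
    rw [← Finset.card_pos]
    have := hdeg v₀ hv₀
    have := hle v₀ (hT _ hv₀)
    omega
  rw [mem_nb] at hu₀
  obtain ⟨x, v, hxv, hx⟩ := exists_star_edge hstar (hT _ hv₀) (hT _ hu₀.1) hu₀.2
  obtain ⟨hxT, hvT, hadj⟩ : x ∈ T ∧ v ∈ T ∧ G.Adj x v := by
    rcases hxv with ⟨rfl, rfl⟩ | ⟨rfl, rfl⟩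
    · exact ⟨hv₀, hu₀.1, hu₀.2⟩
    · exact ⟨hu₀.1, hv₀, hu₀.2.symm⟩
  have htwo : ∀ y ∈ T, ∀ z, (∀ u, u ∉ C → G.Adj y u → u = z) →
      ∃ i j, i < c ∧ j < c ∧ i ≠ j ∧ nb G C y = {f i, f j} := by
    intro y hy z hz
    have h1 := hdeg y hy
    have h2 := hle y (hT _ hy)
    have h3 : (nb G T y).card ≤ 1 := by
      refine (Finset.card_le_card (t := {z}) ?_).trans (by simp)
      intro u hu
      rw [mem_nb] at hu
      simpa using hz u (hT _ hu.1) hu.2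
    obtain ⟨a, b, hab, hnb⟩ := Finset.card_eq_two.1 (show (nb G C y).card = 2 by
      unfold dg at h1 h2; omega)
    have ha : a ∈ nb G C y := by simp [hnb]
    have hb : b ∈ nb G C y := by simp [hnb]
    rw [mem_nb, hC, Finset.mem_image] at ha hb
    obtain ⟨⟨i, hi, rfl⟩, -⟩ := ha
    obtain ⟨⟨j, hj, rfl⟩, -⟩ := hb
    exact ⟨i, j, by simpa using hi, by simpa using hj, fun h => hab (by rw [h]), hnb⟩
  have hoffv : ∀ u, u ∉ C → G.Adj v u → u = x := fun u hu hvu => hx v (hT _ hvT) hadj u hu hvu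
  obtain ⟨i, j, hi, hj, hij, hnv⟩ := htwo v hvT x hoffv
  have hvi : f i ∈ C ∧ G.Adj v (f i) := mem_nb.1 (by simp [hnv])
  have hvj : f j ∈ C ∧ G.Adj v (f j) := mem_nb.1 (by simp [hnv])
  have hfij : f i ≠ f j := fun he => hij (h.inj _ _ hi hj he)
  have hoffx : ∀ w, w ∉ C → G.Adj x w → w = v := by
    intro w hw hxw
    by_contra hwv
    obtain ⟨a, ha, b, hb, l, hl, hxl, -, -⟩ := hL x {w} {y | y ∈ C} ⟨w, rfl, hxw.ne'⟩
      ⟨f i, hvi.1, fun he => hT _ hxT (he ▸ hvi.1)⟩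
    obtain rfl : a = w := ha
    obtain ⟨y, hyC, hwy⟩ : ∃ y ∈ C, G.Adj a y := by
      obtain ⟨l', rfl⟩ := hl.eq_cons
      rcases l' with _ | ⟨y, l'⟩
      · have := hl.2.2.1
        simp at this
        subst this
        exact absurd hb hw
      · have hay : G.Adj a y := by
          have := hl.1; simp at this; exact this.1
        refine ⟨y, ?_, hay⟩
        by_contra hy
        have := hx a hw hxw y hy hay
        subst this
        simp at hxl
    obtain ⟨z, hzC, hvz, hzy⟩ : ∃ z ∈ C, G.Adj v z ∧ y ≠ z := by
      by_cases hy : y = f i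
      · exact ⟨f j, hvj.1, hvj.2, hy ▸ hfij⟩
      · exact ⟨f i, hvi.1, hvi.2, hy⟩
    have := hconn y hyC z hzC hzy [a, x, v] (by
      simp; exact ⟨hw, hT _ hxT, hT _ hvT⟩) ⟨by simp [hwy.symm, hxw.symm, hadj, hvz], by
      simp [hxw.ne', hadj.ne, hwv]⟩
    simp at this
  obtain ⟨p, q, hp, hq, hpq, hnx⟩ := htwo x hxT v hoffx
  have hxp : f p ∈ C ∧ G.Adj x (f p) := mem_nb.1 (by simp [hnx])
  have hxq : f q ∈ C ∧ G.Adj x (f q) := mem_nb.1 (by simp [hnx])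
  have hov : ∀ m, f m ≠ v := fun m hm => hT _ hvT ((mem_image_cyc h).2 ⟨m, hm⟩)
  have hox : ∀ m, f m ≠ x := fun m hm => hT _ hxT ((mem_image_cyc h).2 ⟨m, hm⟩)
  have d1 := h.ear_dist hN hi hj hij (conn_one hvi.2 hvj.2) (by simpa using hov)
  have d2 := h.ear_dist hN hp hq hpq (conn_one hxp.2 hxq.2) (by simpa using hox)
  have hm2 : ∀ z ∈ [v, x], ∀ m, f m ≠ z := by
    intro z hz; simp at hz; rcases hz with rfl | rfl <;> assumption
  have d3 : i ≠ p → _ := fun hne => h.ear_dist hN hi hp hne (conn_two hvi.2 hadj.symm hxp.2) hm2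
  have d4 : i ≠ q → _ := fun hne => h.ear_dist hN hi hq hne (conn_two hvi.2 hadj.symm hxq.2) hm2
  have d5 : j ≠ p → _ := fun hne => h.ear_dist hN hj hp hne (conn_two hvj.2 hadj.symm hxp.2) hm2
  have d6 : j ≠ q → _ := fun hne => h.ear_dist hN hj hq hne (conn_two hvj.2 hadj.symm hxq.2) hm2
  simp only [List.length_cons, List.length_nil] at d1 d2 d3 d4 d5 d6
  have hpp : p = i ∨ p = j := by
    by_contra hcon
    have d3 := d3 (by omega)
    have d5 := d5 (by omega)
    omega
  have hqq : q = i ∨ q = j := by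
    by_contra hcon
    have d4 := d4 (by omega)
    have d6 := d6 (by omega)
    omega
  have hnx' : ∀ u, G.Adj x u → u ∈ C → u = f i ∨ u = f j := by
    intro u hu huC
    have : u ∈ nb G C x := mem_nb.2 ⟨huC, hu⟩
    rw [hnx] at this
    simp only [Finset.mem_insert, Finset.mem_singleton] at this
    rcases this with rfl | rfl
    · rcases hpp with rfl | rfl <;> simp
    · rcases hqq with rfl | rfl <;> simp
  have hxj : G.Adj x (f j) := by
    rcases hpp with rfl | rfl
    · rcases hqq with rfl | rfl
      · exact absurd rfl hpq
      · exact hxq.2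
    · exact hxp.2
  refine StarStability.exists_of_twin hL (hN.mono (by omega)) hfij (hov j).symm (hox i).symm
    hadj.symm hvi.2 hxj ?_ ?_
  · intro w hw
    by_cases hwC : w ∈ C
    · have : w ∈ nb G C v := mem_nb.2 ⟨hwC, hw⟩
      rw [hnv] at this
      simp only [Finset.mem_insert, Finset.mem_singleton] at this
      exact this.imp_right Or.inl
    · exact Or.inr (Or.inr (hoffv w hwC hw))
  · intro w hw
    by_cases hwC : w ∈ C
    · exact (hnx' w hw hwC).imp_right Or.inl
    · exact Or.inr (Or.inr (hoffx w hwC hw))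

/-- The case of three exceptional vertices. -/
theorem exists_of_three [Fintype V] (hL : Link G) {k : ℕ} (hk : k = 7 ∨ k = 8) (hN : NoLong G k)
    (hn : 9 ≤ Fintype.card V)
    (he : 2 * Fintype.card V + (if k = 7 then 1 else 4) ≤ G.edgeSet.ncard) :
    ∃ A : Finset V, A.card ≤ 3 ∧ IsStarForest (G.induce {v : V | v ∉ A}) := by
  classical
  have hcard : Nat.card V = Fintype.card V := Nat.card_eq_fintype_card
  obtain ⟨f, c, hf, hNc, hc2, hck⟩ := exists_longest hL hN (by omega)
  by_cases hc5 : c ≤ 5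
  · obtain ⟨A, hA, hs⟩ := exists_of_noLong_six hL (hNc.mono (by omega)) (by omega)
    exact ⟨A, by omega, hs⟩
  have hc : c = 6 ∨ c = 7 := by omega
  set C := (Finset.range c).image f with hC
  have hCc : C.card = c := by
    rw [hC, Finset.card_image_of_injOn, Finset.card_range]
    intro i hi j hj hij
    exact hf.inj _ _ (by simpa using hi) (by simpa using hj) hij
  by_cases hle : ∀ w, w ∉ C → dg G C w ≤ 2
  swap
  · push Not at hle
    obtain ⟨w, hw, hd⟩ := hle
    refine exists_of_many_neighbors (t := 3) hL hf hNc (by omega) (by omega) (w := w)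
      (fun i hi => hw ((mem_image_cyc hf).2 ⟨i, hi⟩)) (nb G C w)
      (fun x hx => (mem_nb.1 hx).2.symm) (fun x hx => (mem_image_cyc hf).1 (mem_nb.1 hx).1) hd
  have hconn : ∀ a ∈ C, ∀ b ∈ C, a ≠ b →
      ∀ Q, (∀ z ∈ Q, z ∉ C) → Conn G a b Q → Q.length ≤ 2 := by
    intro a ha b hb hab Q hQ hcn
    rw [hC, Finset.mem_image] at ha hb
    obtain ⟨i, hi, rfl⟩ := ha
    obtain ⟨j, hj, rfl⟩ := hb
    have := hf.ear_dist hNc (by simpa using hi) (by simpa using hj)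
      (fun h => hab (by rw [h])) hcn (fun z hz m hm => hQ z hz ((mem_image_cyc hf).2 ⟨m, hm⟩))
    simp at hi hj
    omega
  have hne : f 0 ≠ f 1 := (hf.adj 0).ne
  have hstar : IsStarForest (G.induce {v : V | v ∉ C}) :=
    isStarForest_of_conn hL C ((mem_image_cyc hf).2 ⟨0, rfl⟩) ((mem_image_cyc hf).2 ⟨1, rfl⟩) hne
      fun Q hQ a ha b hb hab hcn => hconn a ha b hb hab Q hQ hcn
  by_cases hdeg : ∀ T ⊆ Cᶜ, T.Nonempty → ∃ v ∈ T, dg G (C ∪ T) v ≤ 2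
  · exfalso
    have h1 := ds_le_of_degenerate (G := G) Cᶜ disjoint_compl_right hdeg
    rw [Finset.union_compl, ds_univ, Finset.card_compl, hCc] at h1
    obtain ⟨i, j, Q, hij, hj, hQ0, hQ, hoff, e1, e2⟩ := hf.exists_ear hL hNc (by omega)
    have h2 := hf.ds_le_of_ear hNc hc hij hj hQ0 hQ hoff e1 e2
    rw [← hC] at h2
    split_ifs at he h2 <;> omega
  · push Not at hdeg
    obtain ⟨T, hTC, hT0, hT⟩ := hdeg
    exact hf.exists_of_twin hL hNc hc hconn hstar hle
      (fun v hv => Finset.mem_compl.1 (hTC hv)) hT0 (fun v hv => hT v hv)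

/-- A path `f 0, …, f m`. -/
structure Line (G : SimpleGraph V) (f : ℕ → V) (m : ℕ) : Prop where
  adj : ∀ i < m, G.Adj (f i) (f (i + 1))
  inj : ∀ i j, i ≤ m → j ≤ m → f i = f j → i = j

theorem Line.rev {f : ℕ → V} {m : ℕ} (h : Line G f m) : Line G (fun i => f (m - i)) m := by
  refine ⟨fun i hi => ?_, fun i j hi hj he => ?_⟩
  · have := h.adj (m - (i + 1)) (by omega)
    rw [show m - (i + 1) + 1 = m - i by omega] at this
    exact this.symm
  · have := h.inj _ _ (by omega) (by omega) he
    omega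

theorem Line.pth {f : ℕ → V} {m : ℕ} (h : Line G f m) {i j : ℕ} (hi : i ≤ m) (hj : j ≤ m) :
    Pth G (f i) (f j) ((blk i j).map f) := by
  refine pth_blk (fun q hq => h.adj q (by omega)) ?_
  intro a ha b hb
  rw [mem_blk] at ha hb
  exact h.inj a b (by omega) (by omega)

theorem Pth.line {a b : V} {l : List V} (h : Pth G a b l) :
    ∃ f, Line G f (l.length - 1) ∧ f 0 = a ∧ f (l.length - 1) = b ∧
      ∀ x, x ∈ l ↔ ∃ i ≤ l.length - 1, f i = x := by
  have hp := h.length_pos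
  refine ⟨fun i => l.getD i a, ⟨fun i hi => ?_, fun i j hi hj he => ?_⟩, ?_, ?_, ?_⟩
  · have := h.adj_getElem i (by omega)
    simpa [List.getElem?_eq_getElem (show i < l.length by omega),
      List.getElem?_eq_getElem (show i + 1 < l.length by omega)] using this
  · simp only [List.getD_eq_getElem?_getD, List.getElem?_eq_getElem (show i < l.length by omega),
      List.getElem?_eq_getElem (show j < l.length by omega), Option.getD_some] at he
    exact (List.Nodup.getElem_inj_iff h.nodup).1 he
  · obtain ⟨l', rfl⟩ := h.eq_cons; simp
  · have := h.2.2.1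
    rw [List.getLast?_eq_getElem?] at this
    simp [this]
  · intro x
    rw [List.mem_iff_getElem]
    constructor
    · rintro ⟨i, hi, rfl⟩
      exact ⟨i, by omega, by simp [List.getElem?_eq_getElem hi]⟩
    · rintro ⟨i, hi, rfl⟩
      exact ⟨i, by omega, by simp [List.getElem?_eq_getElem (show i < l.length by omega)]⟩

theorem Line.not_adj {f : ℕ → V} {m k : ℕ} (h : Line G f m) (hN : NoLong G k) (hm : k ≤ m + 1) :
    ¬ G.Adj (f m) (f 0) := by
  intro had
  have := hN _ _ _ (h.pth (Nat.zero_le m) le_rfl) had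
  simp [length_blk] at this
  omega

theorem Line.cross {f : ℕ → V} {m k : ℕ} (h : Line G f m) (hN : NoLong G k) {i j : ℕ} (hij : i < j)
    (hj : j ≤ m) (hi : G.Adj (f m) (f i)) (h0 : G.Adj (f 0) (f j)) : m + 2 + i < k + j := by
  have := hN.blocks (u := f) (M := m + 1) (fun a b ha hb => h.inj a b (by omega) (by omega)) (0, i)
    [(m, j)] (by simp; omega) (by
      intro p hp q hq
      simp at hp
      refine h.adj q ?_
      rcases hp with rfl | rfl <;> simp at hq <;> omega)
    (by simpa using hi.symm) (by simp [BlkDisj]; omega) (by simpa using h0.symm)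
  simp [length_blk] at this
  omega

theorem Line.side {f : ℕ → V} {m : ℕ} (h : Line G f m) {I : Finset ℕ}
    (hI : ∀ i ∈ I, 1 ≤ i ∧ G.Adj (f 0) (f i)) {s p : ℕ} (hs : s ∈ I) (hmax : ∀ i ∈ I, i ≤ s)
    (hsm : s ≤ m) (hp : p < s) :
    ∃ l, Pth G (f p) (f s) l ∧ (∀ x ∈ l, ∃ i ≤ s, f i = x) ∧ I.card + 1 ≤ l.length ∧
      I.card + (I.filter (fun q => q + 1 ∉ I)).card ≤ l.length + 1 := by
  classical
  obtain ⟨p', hp', hmin⟩ : ∃ p', (p' ∈ I ∧ p < p') ∧ ∀ q ∈ I, p < q → p' ≤ q := by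
    have hex : ∃ p', p' ∈ I ∧ p < p' := ⟨s, hs, hp⟩
    exact ⟨Nat.find hex, Nat.find_spec hex, fun q hq hpq => Nat.find_min' hex ⟨hq, hpq⟩⟩
  have hps := hmax p' hp'.1
  have hl := (h.pth (i := p) (j := 0) (by omega) (by omega)).append
    (h.pth (i := p') (j := s) (by omega) (by omega)) (hI p' hp'.1).2 (by
      intro x hx hx'
      rw [List.mem_map] at hx hx'
      obtain ⟨a, ha, rfl⟩ := hx
      obtain ⟨b, hb, hab⟩ := hx'
      rw [mem_blk] at ha hb
      have := h.inj b a (by omega) (by omega) hab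
      omega)
  have hlen : ((blk p 0).map f ++ (blk p' s).map f).length = p + 1 + (s + 1 - p') := by
    simp [length_blk]; omega
  have hcov : (Finset.Icc 0 p ∪ Finset.Icc p' s).card = p + 1 + (s + 1 - p') := by
    rw [Finset.card_union_of_disjoint, Nat.card_Icc, Nat.card_Icc]
    · omega
    · rw [Finset.disjoint_left]; intro x; simp; omega
  refine ⟨_, hl, ?_, ?_, ?_⟩
  · intro x hx
    simp only [List.mem_append, List.mem_map, mem_blk] at hx
    rcases hx with ⟨a, ha, rfl⟩ | ⟨a, ha, rfl⟩ <;> exact ⟨a, by omega, rfl⟩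
  · rw [hlen, ← hcov, ← Finset.card_insert_of_notMem (a := 0) (s := I)
      (fun h0 => by have := (hI 0 h0).1; omega)]
    refine Finset.card_le_card fun x hx => ?_
    simp only [Finset.mem_insert, Finset.mem_union, Finset.mem_Icc] at hx ⊢
    rcases hx with rfl | hx
    · omega
    · have := hmin x hx; have := hmax x hx; omega
  · rw [hlen, ← hcov]
    set E := ((I.filter (fun q => q + 1 ∉ I)).erase s).erase p with hE
    have h1 : (I.filter (fun q => q + 1 ∉ I)).card ≤ E.card + 2 := by
      have e1 := Finset.pred_card_le_card_erase (s := I.filter (fun q => q + 1 ∉ I)) (a := s)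
      have e2 := Finset.pred_card_le_card_erase (s := (I.filter (fun q => q + 1 ∉ I)).erase s)
        (a := p)
      rw [← hE] at e2
      omega
    have h2 : (insert 0 I ∪ E.image (· + 1)).card = I.card + 1 + E.card := by
      rw [Finset.card_union_of_disjoint, Finset.card_insert_of_notMem
        (fun h0 => by have := (hI 0 h0).1; omega), Finset.card_image_of_injective _
        (add_left_injective 1)]
      rw [Finset.disjoint_left]
      intro x hx hx'
      simp only [hE, Finset.mem_insert, Finset.mem_image, Finset.mem_erase, Finset.mem_filter]
        at hx hx'
      obtain ⟨q, ⟨-, -, -, hq⟩, rfl⟩ := hx'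
      rcases hx with hx | hx
      · omega
      · exact hq hx
    have h3 : (insert 0 I ∪ E.image (· + 1)).card ≤ (Finset.Icc 0 p ∪ Finset.Icc p' s).card := by
      refine Finset.card_le_card fun x hx => ?_
      simp only [hE, Finset.mem_insert, Finset.mem_image, Finset.mem_erase, Finset.mem_filter,
        Finset.mem_union, Finset.mem_Icc] at hx ⊢
      rcases hx with (rfl | hx) | ⟨q, ⟨hq1, hq2, hq3, hq4⟩, rfl⟩
      · omega
      · have := hmin x hx; have := hmax x hx; omega
      · have := hmin q hq3; have := hmax q hq3; omega
    omega

theorem Pth.exists_inner {a b : V} {l : List V} (h : Pth G a b l) (hab : a ≠ b) :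
    ∃ R, l = a :: (R ++ [b]) ∧ Conn G a b R ∧ a ∉ R ∧ b ∉ R := by
  obtain ⟨l', y, rfl, h1, -, h2⟩ := h.unconcat hab
  obtain ⟨R, rfl⟩ := h1.eq_cons
  have := h.nodup
  have h3 := h1.nodup
  simp at h2 h3
  exact ⟨R, rfl, ⟨h.1, h3.2⟩, h3.1, h2.2⟩

theorem Line.noncross (hL : Link G) {f : ℕ → V} {m k : ℕ} (h : Line G f m) (hN : NoLong G k)
    {I J : Finset ℕ} (hI : ∀ i ∈ I, 1 ≤ i ∧ G.Adj (f 0) (f i))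
    (hJ : ∀ i ∈ J, i < m ∧ G.Adj (f m) (f i)) (hI0 : I.Nonempty) (hJ0 : J.Nonempty)
    (hnc : ∀ p ∈ J, ∀ q ∈ I, q ≤ p) :
    I.card + J.card + 1 < k ∧ I.card + J.card + (I.filter (fun q => q + 1 ∉ I)).card < k + 1 := by
  classical
  set s := I.max' hI0 with hs
  set s' := J.min' hJ0 with hs'
  have hsI : s ∈ I := I.max'_mem hI0
  have hsJ : s' ∈ J := J.min'_mem hJ0
  have hss : s ≤ s' := hnc _ hsJ _ hsI
  have hs1 := (hI s hsI).1
  have hsm := (hJ s' hsJ).1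
  obtain ⟨a₁, a₂, e, U, W, hU, hW, hUW, ⟨i₁, hi₁, rfl⟩, ⟨i₂, hi₂, rfl⟩, h3, ⟨r, hr, rfl⟩, h5, h6,
      h7, h8⟩ := two_paths hL (S := {x | ∃ i, i ≤ s ∧ f i = x})
    (T := {x | ∃ i, (s' ≤ i ∧ i ≤ m) ∧ f i = x})
    (h.pth (i := s) (j := s') (by omega) (by omega)) ⟨s, le_rfl, rfl⟩ ⟨s', by omega, rfl⟩
    (by
      rintro x hx ⟨i, hi, rfl⟩
      simp only [List.mem_map, mem_blk] at hx
      obtain ⟨j, hj, hij⟩ := hx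
      have := h.inj j i (by omega) (by omega) hij
      rw [show i = s by omega])
    (by
      rintro x hx ⟨i, hi, rfl⟩
      simp only [List.mem_map, mem_blk] at hx
      obtain ⟨j, hj, hij⟩ := hx
      have := h.inj j i (by omega) (by omega) hij
      rw [show i = s' by omega])
    ⟨f 0, ⟨0, by omega, rfl⟩, fun he => by have := h.inj _ _ (by omega) (by omega) he; omega⟩
    ⟨f m, ⟨m, by omega, rfl⟩, fun he => by have := h.inj _ _ (by omega) (by omega) he; omega⟩
  have hne : i₁ ≠ i₂ := by
    rintro rfl
    exact hUW _ hU.head_mem hW.head_mem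
  have hrs : r ≠ s' := by
    rintro rfl
    exact hUW _ hU.last_mem hW.last_mem
  have h3' : i₁ = s ∨ i₂ = s := h3.imp (fun he => h.inj _ _ (by omega) (by omega) he)
    (fun he => h.inj _ _ (by omega) (by omega) he)
  obtain ⟨LA, hLA, hLAS, hLA1, hLA2⟩ : ∃ l, Pth G (f i₂) (f i₁) l ∧ (∀ x ∈ l, ∃ i ≤ s, f i = x) ∧
      I.card + 1 ≤ l.length ∧ I.card + (I.filter (fun q => q + 1 ∉ I)).card ≤ l.length + 1 := by
    rcases h3' with rfl | rfl
    · exact h.side hI hsI (fun i hi => I.le_max' i hi) (by omega) (by omega)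
    · obtain ⟨l, g1, g2, g3, g4⟩ := h.side hI hsI (fun i hi => I.le_max' i hi) (by omega)
        (p := i₁) (by omega)
      exact ⟨l.reverse, g1.reverse, by simpa using g2, by simpa using g3, by simpa using g4⟩
  obtain ⟨LB, hLB, hLBT, hLB1⟩ : ∃ l, Pth G (f s') (f r) l ∧ (∀ x ∈ l, ∃ i, (s' ≤ i ∧ i ≤ m) ∧ f i = x) ∧
      J.card + 1 ≤ l.length := by
    obtain ⟨l, g1, g2, g3, -⟩ := h.rev.side (I := J.image (m - ·)) (s := m - s') (p := m - r)
      (by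
        intro i hi
        rw [Finset.mem_image] at hi
        obtain ⟨j, hj, rfl⟩ := hi
        have := hJ j hj
        refine ⟨by omega, ?_⟩
        simpa [show m - (m - j) = j by omega] using this.2)
      (Finset.mem_image_of_mem _ hsJ) (by
        intro i hi
        rw [Finset.mem_image] at hi
        obtain ⟨j, hj, rfl⟩ := hi
        have := J.min'_le j hj
        omega) (by omega) (by omega)
    rw [show m - (m - r) = r by omega, show m - (m - s') = s' by omega] at g1
    rw [Finset.card_image_of_injOn] at g3
    · refine ⟨l.reverse, g1.reverse, ?_, by simpa using g3⟩
      intro x hx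
      obtain ⟨i, hi, rfl⟩ := g2 x (by simpa using hx)
      exact ⟨m - i, by omega, rfl⟩
    · intro i hi j hj hij
      have := (hJ i hi).1
      have := (hJ j hj).1
      simp only at hij
      omega
  obtain ⟨l, rfl⟩ := hLA.eq_concat
  have hP := hLA.splice (x := f i₁) (m := []) hU (by
    intro y hy hy'
    exact h5 y hy' (hLAS y hy))
  obtain ⟨l', hl'⟩ := hP.eq_concat
  rw [hl'] at hP
  have hP2 := hP.splice (m := []) hLB (by
    intro y hy hy'
    rw [← hl'] at hy
    rw [List.mem_append] at hy
    rcases hy with hy | hy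
    · obtain ⟨i, hi, rfl⟩ := hLAS y (by simp [hy])
      obtain ⟨j, hj, hij⟩ := hLBT _ hy'
      have := h.inj j i (by omega) (by omega) hij
      rw [show i = s' by omega]
    · exact h6 y hy (hLBT y hy'))
  have hae : f i₂ ≠ f r := by
    intro he
    have := h.inj _ _ (by omega) (by omega) he
    omega
  obtain ⟨R, rfl, hR, hR1, hR2⟩ := hW.exists_inner hae
  have hfin := hN.close hP2 hR.symm (by
    intro z hz hz'
    rw [List.mem_reverse] at hz
    rw [List.mem_append] at hz'
    rcases hz' with hz' | hz'
    · have : z ∈ l ++ U := by rw [hl']; simp [hz']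
      rw [List.mem_append] at this
      rcases this with h9 | h9
      · have := h7 z (by simp [hz]) (hLAS z (by simp [h9]))
        exact hR1 (this ▸ hz)
      · exact hUW z h9 (by simp [hz])
    · have := h8 z (by simp [hz]) (hLBT z hz')
      exact hR2 (this ▸ hz))
  have hlen := congrArg List.length hl'
  have hU1 := hU.length_pos
  simp only [List.length_append, List.length_cons, List.length_nil] at hfin hlen hLA1 hLA2
  omega

/-- The degree condition on the ends of a long path that forces a long cycle. -/
theorem Line.card_add_card_lt (hL : Link G) {f : ℕ → V} {m k : ℕ} (h : Line G f m)
    (hN : NoLong G k) (hm : k ≤ m + 1) {I J : Finset ℕ}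
    (hI : ∀ i ∈ I, (1 ≤ i ∧ i ≤ m) ∧ G.Adj (f 0) (f i))
    (hJ : ∀ i ∈ J, i < m ∧ G.Adj (f m) (f i)) (hI0 : I.Nonempty) (hJ0 : J.Nonempty) :
    I.card + J.card < k := by
  classical
  by_cases hnc : ∀ p ∈ J, ∀ q ∈ I, q ≤ p
  · have := (h.noncross hL hN (fun i hi => ⟨(hI i hi).1.1, (hI i hi).2⟩) hJ hI0 hJ0 hnc).1
    omega
  push Not at hnc
  obtain ⟨p₀, hp₀, q₀, hq₀, hpq₀⟩ := hnc
  have hex : ∃ d, ∃ p ∈ J, ∃ q ∈ I, p < q ∧ q - p = d := ⟨_, p₀, hp₀, q₀, hq₀, hpq₀, rfl⟩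
  obtain ⟨p, hp, q, hq, hpq, hd⟩ := Nat.find_spec hex
  have hmin : ∀ p' ∈ J, ∀ q' ∈ I, p' < q' → q - p ≤ q' - p' := by
    intro p' hp' q' hq' hlt
    rw [hd]
    exact Nat.find_min' hex ⟨p', hp', q', hq', hlt, rfl⟩
  have hcr := h.cross hN hpq (hI q hq).1.2 (hJ p hp).2 (hI q hq).2
  have hdisj : Disjoint (I.image (· - 1)) J := by
    rw [Finset.disjoint_left]
    intro x hx hxJ
    rw [Finset.mem_image] at hx
    obtain ⟨i, hi, rfl⟩ := hx
    have h1 := hI i hi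
    have := h.cross hN (i := i - 1) (j := i) (by omega) h1.1.2 (hJ _ hxJ).2 h1.2
    omega
  have hc1 : (I.image (· - 1)).card = I.card := by
    refine Finset.card_image_of_injOn fun i hi j hj hij => ?_
    have := (hI i hi).1
    have := (hI j hj).1
    change i - 1 = j - 1 at hij
    omega
  have hsub : I.image (· - 1) ∪ J ⊆ (Finset.range m) \ Finset.Ioo p (q - 1) := by
    intro x hx
    simp only [Finset.mem_union, Finset.mem_image, Finset.mem_sdiff, Finset.mem_range,
      Finset.mem_Ioo] at hx ⊢
    rcases hx with ⟨i, hi, rfl⟩ | hx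
    · have := (hI i hi).1
      have := hmin p hp i hi
      omega
    · have := (hJ x hx).1
      have := hmin x hx q hq
      omega
  have hcard := Finset.card_le_card hsub
  have hq1 := (hI q hq).1
  rw [Finset.card_union_of_disjoint hdisj, hc1, Finset.card_sdiff_of_subset (by
    intro x; simp; omega), Finset.card_range, Nat.card_Ioo] at hcard
  have : 0 < I.card := hI0.card_pos
  omega

theorem Pth.of_le {G' : SimpleGraph V} (hle : G ≤ G') {a b : V} {l : List V} (h : Pth G a b l) :
    Pth G' a b l :=
  ⟨h.1.imp fun _ _ hab => hle hab, h.2⟩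

theorem Link.of_le {G' : SimpleGraph V} (hle : G ≤ G') (h : Link G) : Link G' := by
  intro v S T hS hT
  obtain ⟨a, ha, b, hb, l, hl, h'⟩ := h v S T hS hT
  exact ⟨a, ha, b, hb, l, hl.of_le hle, h'⟩

theorem isStarForest_of_le {G' : SimpleGraph V} (hle : G ≤ G') {S : Set V}
    (h : IsStarForest (G'.induce S)) : IsStarForest (G.induce S) := by
  intro v
  obtain ⟨x, hx⟩ := h v
  have hle' : G.induce S ≤ G'.induce S := fun a b hab => hle hab
  exact ⟨x, fun a b hab hr => hx a b (hle' hab) (hr.mono hle')⟩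

/-- Adding edges until every further edge creates a long cycle. -/
theorem exists_saturated [Finite V] {k : ℕ} (hk : 3 ≤ k) (hN : NoLong G k) :
    ∃ G' : SimpleGraph V, G ≤ G' ∧ NoLong G' k ∧
      ∀ x y, x ≠ y → ¬ G'.Adj x y → ∃ l, Pth G' x y l ∧ k ≤ l.length := by
  obtain ⟨G', hle, hmax⟩ := Finite.exists_le_maximal (p := fun H : SimpleGraph V => NoLong H k) hN
  refine ⟨G', hle, hmax.prop, fun x y hxy hnadj => ?_⟩
  have hlt : ¬ NoLong (G' ⊔ SimpleGraph.edge x y) k := by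
    intro hcon
    have := hmax.le_of_ge hcon le_sup_left
    exact hnadj (this (by simp [SimpleGraph.sup_adj, SimpleGraph.edge_adj, hxy]))
  unfold NoLong at hlt
  push Not at hlt
  obtain ⟨a, b, l, hl, hab, hlen⟩ := hlt
  obtain ⟨f, hf, -⟩ := hl.cyc hab
  set c := l.length
  obtain ⟨i, hi⟩ : ∃ i, ¬ G'.Adj (f i) (f (i + 1)) := by
    by_contra! hcon
    have hp : Pth G' (f 0) (f (c - 1)) ((blk 0 (c - 1)).map f) := by
      refine pth_blk (fun m _ => hcon m) fun p hp q hq => ?_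
      rw [mem_blk] at hp hq
      exact hf.inj p q (by omega) (by omega)
    have hcl := hcon (c - 1)
    rw [show c - 1 + 1 = 0 + c by omega, hf.per] at hcl
    have := hmax.prop _ _ _ hp hcl
    simp [length_blk] at this
    omega
  have hg := hf.shift i
  set g := fun j => f (j + i) with hgdef
  have hi' : ¬ G'.Adj (g 0) (g 1) := by simpa [hgdef, Nat.add_comm] using hi
  have hedge : ∀ j, ¬ G'.Adj (g j) (g (j + 1)) →
      g j = x ∧ g (j + 1) = y ∨ g j = y ∧ g (j + 1) = x := by
    intro j hj
    have := hg.adj j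
    rw [SimpleGraph.sup_adj, SimpleGraph.edge_adj] at this
    exact (this.resolve_left hj).1
  have h01 := hedge 0 hi'
  have hadj : ∀ j, 1 ≤ j → j < c → G'.Adj (g j) (g (j + 1)) := by
    intro j h1 hjc
    by_contra hj
    have e := hedge j hj
    have n0 : g j ≠ g 0 := fun he => by
      have := hg.inj j 0 hjc (by omega) he
      omega
    have n1 : g j = g 1 := by
      rw [Nat.zero_add] at h01
      rcases e with e | e <;> rcases h01 with e' | e'
      · exact absurd (e.1.trans e'.1.symm) n0
      · exact e.1.trans e'.2.symm
      · exact e.1.trans e'.2.symm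
      · exact absurd (e.1.trans e'.1.symm) n0
    have hj1 := hg.inj j 1 hjc (by omega) n1
    subst hj1
    have n2 : g 2 ≠ g 0 := fun he => by
      have := hg.inj 2 0 (by omega) (by omega) he
      omega
    rw [Nat.zero_add] at h01
    rcases e with e | e <;> rcases h01 with e' | e'
    · exact n0 (e.1.trans e'.1.symm)
    · exact n2 (e.2.trans e'.1.symm)
    · exact n2 (e.2.trans e'.1.symm)
    · exact n0 (e.1.trans e'.1.symm)
  have hp : Pth G' (g 1) (g c) ((blk 1 c).map g) := by
    refine pth_blk (fun m hm => hadj m (by omega) (by omega)) fun p hp q hq he => ?_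
    rw [mem_blk] at hp hq
    have h0 : g c = g 0 := by simpa using hg.per 0
    by_cases hpc : p = c
    · by_cases hqc : q = c
      · omega
      · subst hpc
        rw [h0] at he
        have := hg.inj 0 q (by omega) (by omega) he
        omega
    · by_cases hqc : q = c
      · subst hqc
        rw [h0] at he
        have := hg.inj p 0 (by omega) (by omega) he
        omega
      · exact hg.inj p q (by omega) (by omega) he
  have h0 : g c = g 0 := by simpa using hg.per 0
  have hlen' : ((blk 1 c).map g).length = c := by simp [length_blk]; omega
  rw [h0] at hp
  rcases h01 with ⟨e1, e2⟩ | ⟨e1, e2⟩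
  · rw [e1, show g 1 = y from e2] at hp
    exact ⟨_, hp.reverse, by simpa [hlen'] using hlen⟩
  · rw [e1, show g 1 = x from e2] at hp
    exact ⟨_, hp, by simpa [hlen'] using hlen⟩

theorem exists_longest_pth [Finite V] (S T : Set V) {k : ℕ}
    (hex : ∃ x ∈ S, ∃ y ∈ T, ∃ l, Pth G x y l ∧ k ≤ l.length) :
    ∃ x ∈ S, ∃ y ∈ T, ∃ l, Pth G x y l ∧ k ≤ l.length ∧
      ∀ x' ∈ S, ∀ y' ∈ T, ∀ l', Pth G x' y' l' → l'.length ≤ l.length := by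
  classical
  let P := fun n => ∃ x ∈ S, ∃ y ∈ T, ∃ l, Pth G x y l ∧ l.length = n
  have hb : ∀ n, P n → n ≤ Nat.card V := by
    rintro n ⟨x, -, y, -, l, hl, rfl⟩
    have := Fintype.ofFinite V
    rw [Nat.card_eq_fintype_card]
    exact hl.nodup.length_le_card
  obtain ⟨x, hx, y, hy, l, hl, hkl⟩ := hex
  have hP : P (Nat.findGreatest P (Nat.card V)) :=
    Nat.findGreatest_spec (hb _ ⟨x, hx, y, hy, l, hl, rfl⟩) ⟨x, hx, y, hy, l, hl, rfl⟩
  have hmax : ∀ n, P n → n ≤ Nat.findGreatest P (Nat.card V) := fun n hn =>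
    Nat.le_findGreatest (hb n hn) hn
  obtain ⟨x₁, hx₁, y₁, hy₁, l₁, hl₁, hlen⟩ := hP
  refine ⟨x₁, hx₁, y₁, hy₁, l₁, hl₁, ?_, ?_⟩
  · have := hmax _ ⟨x, hx, y, hy, l, hl, rfl⟩
    omega
  · intro x' hx' y' hy' l' hl'
    rw [hlen]
    exact hmax _ ⟨x', hx', y', hy', l', hl', rfl⟩

open Classical in
/-- The positions on `f 0, …, f m` of the neighbours of `v` inside `S`. -/
noncomputable def idx (G : SimpleGraph V) (S : Finset V) (f : ℕ → V) (m : ℕ) (v : V) : Finset ℕ :=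
  (Finset.range (m + 1)).filter fun i => f i ∈ S ∧ G.Adj v (f i)

theorem mem_idx {S : Finset V} {f : ℕ → V} {m : ℕ} {v : V} {i : ℕ} :
    i ∈ idx G S f m v ↔ i ≤ m ∧ f i ∈ S ∧ G.Adj v (f i) := by
  classical
  simp [idx, Nat.lt_succ_iff]

theorem Line.card_idx {S : Finset V} {f : ℕ → V} {m : ℕ} (h : Line G f m) {v : V}
    (hv : ∀ w ∈ S, G.Adj v w → ∃ i ≤ m, f i = w) : (idx G S f m v).card = dg G S v := by
  classical
  unfold dg
  have : nb G S v = (idx G S f m v).image f := by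
    ext w
    simp only [mem_nb, Finset.mem_image, mem_idx]
    constructor
    · rintro ⟨h1, h2⟩
      obtain ⟨i, hi, rfl⟩ := hv w h1 h2
      exact ⟨i, ⟨hi, h1, h2⟩, rfl⟩
    · rintro ⟨i, ⟨-, h1, h2⟩, rfl⟩
      exact ⟨h1, h2⟩
  rw [this, Finset.card_image_of_injOn]
  intro i hi j hj
  exact h.inj i j (mem_idx.1 hi).1 (mem_idx.1 hj).1

theorem Line.dg_add_dg_lt (hL : Link G) {f : ℕ → V} {m k : ℕ} (h : Line G f m)
    (hN : NoLong G k) (hm : k ≤ m + 1) {S T : Finset V}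
    (hS : ∀ w ∈ S, G.Adj (f 0) w → ∃ i ≤ m, f i = w) (hT : ∀ w ∈ T, G.Adj (f m) w → ∃ i ≤ m, f i = w)
    (hS0 : 0 < dg G S (f 0)) (hT0 : 0 < dg G T (f m)) : dg G S (f 0) + dg G T (f m) < k := by
  rw [← h.card_idx hS, ← h.card_idx hT] at *
  refine h.card_add_card_lt hL hN hm ?_ ?_ (Finset.card_pos.1 hS0) (Finset.card_pos.1 hT0)
  · intro i hi
    rw [mem_idx] at hi
    refine ⟨⟨?_, hi.1⟩, hi.2.2⟩
    rcases Nat.eq_zero_or_pos i with rfl | h0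
    · exact absurd rfl hi.2.2.ne
    · exact h0
  · intro i hi
    rw [mem_idx] at hi
    refine ⟨lt_of_le_of_ne hi.1 ?_, hi.2.2⟩
    rintro rfl
    exact absurd rfl hi.2.2.ne

theorem Link.exists_adj (hL : Link G) {v z w : V} (hvz : v ≠ z) (hwv : w ≠ v) (hwz : w ≠ z) :
    ∃ b, G.Adj v b ∧ b ≠ z := by
  obtain ⟨a, rfl, b, rfl, l, hl, hz, -, -⟩ := hL z {v} {w} ⟨v, rfl, hvz⟩ ⟨w, rfl, hwz⟩
  obtain ⟨l', rfl⟩ := hl.eq_cons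
  cases l' with
  | nil =>
    have := hl.2.2.1
    simp at this
    exact absurd this.symm hwv
  | cons y l' =>
    have := hl.1
    simp at this hz
    exact ⟨y, this.1, fun h => hz.2.1 h.symm⟩

theorem Link.two_le_dg [Fintype V] (hL : Link G) (hn : 3 ≤ Fintype.card V) (v : V) :
    2 ≤ dg G Finset.univ v := by
  classical
  have h3 : ∀ a b : V, ∃ c, c ≠ a ∧ c ≠ b := by
    intro a b
    by_contra! hcon
    have : (Finset.univ : Finset V) ⊆ {a, b} := fun c _ => by
      by_cases h : c = a
      · simp [h]
      · simp [hcon c h]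
    have := Finset.card_le_card this
    rw [Finset.card_univ] at this
    have := Finset.card_le_two (a := a) (b := b)
    omega
  obtain ⟨x, hx, -⟩ := h3 v v
  obtain ⟨y, hy, hyx⟩ := h3 v x
  obtain ⟨a, ha, -⟩ := hL.exists_adj hx.symm hy hyx
  obtain ⟨z, hz, hza⟩ := h3 v a
  obtain ⟨b, hb, hba⟩ := hL.exists_adj ha.ne hz hza
  unfold dg
  rw [← Finset.card_pair hba]
  refine Finset.card_le_card fun c hc => ?_
  simp only [Finset.mem_insert, Finset.mem_singleton] at hc
  rcases hc with rfl | rfl <;> simp [mem_nb, ha, hb]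

theorem NoLong.card_lt_of_isClique {k : ℕ} (hN : NoLong G k) {K : Finset V}
    (hK : G.IsClique (K : Set V)) (h2 : 2 ≤ K.card) : K.card < k := by
  classical
  have hlen := K.length_toList
  have hchain : K.toList.IsChain G.Adj := by
    refine List.Pairwise.isChain ?_
    have := K.nodup_toList
    rw [List.Nodup] at this
    refine this.imp_of_mem ?_
    intro a b ha hb hab
    exact hK (by simpa using ha) (by simpa using hb) hab
  have hne : K.toList ≠ [] := by
    intro h
    rw [h] at hlen
    simp at hlen
    omega
  have hp : Pth G (K.toList.head hne) (K.toList.getLast hne) K.toList :=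
    ⟨hchain, List.head?_eq_some_head hne, List.getLast?_eq_some_getLast hne, K.nodup_toList⟩
  rw [← hlen]
  refine hN _ _ _ hp (hK (Finset.mem_coe.2 (Finset.mem_toList.1 (List.getLast_mem hne)))
    (Finset.mem_coe.2 (Finset.mem_toList.1 (List.head_mem hne))) ?_)
  intro he
  obtain ⟨a, l, hl⟩ := List.exists_cons_of_ne_nil hne
  have hnd := K.nodup_toList
  simp only [hl] at he hnd hlen
  cases l with
  | nil => simp at hlen; omega
  | cons b l =>
    simp only [List.head_cons, List.getLast_cons_cons] at he
    rw [List.nodup_cons] at hnd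
    exact hnd.1 (he ▸ List.getLast_mem _)

theorem ds_add_card_le (S : Finset V) : ds G S + S.card ≤ S.card * S.card := by
  have : ∑ v ∈ S, (dg G S v + 1) ≤ ∑ _v ∈ S, S.card := Finset.sum_le_sum fun v hv => dg_lt hv
  rw [Finset.sum_add_distrib] at this
  simpa [ds] using this

theorem dg_of_isClique [DecidableEq V] {K : Finset V} (hK : G.IsClique (K : Set V)) {v : V}
    (hv : v ∈ K) : dg G K v + 1 = K.card := by
  have : nb G K v = K.erase v := by
    ext w
    simp only [mem_nb, Finset.mem_erase]
    exact ⟨fun h => ⟨h.2.ne', h.1⟩, fun h => ⟨h.2, hK hv h.2 h.1.symm⟩⟩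
  unfold dg
  rw [this, Finset.card_erase_of_mem hv]
  have := Finset.card_pos.2 ⟨v, hv⟩
  omega

/-- A maximum clique cannot be extended by vertices of large degree. -/
theorem clique_core [Finite V] (hL : Link G) {k : ℕ} (hN : NoLong G k)
    (hsat : ∀ x y, x ≠ y → ¬ G.Adj x y → ∃ l, Pth G x y l ∧ k ≤ l.length)
    {K U : Finset V} (hK : G.IsClique (K : Set V)) (h2 : 2 ≤ K.card)
    (hmax : ∀ u, u ∉ K → ∃ v ∈ K, ¬ G.Adj u v) (hU : ∃ u ∈ U, u ∉ K)
    (hd : ∀ v ∈ U, v ∉ K → k + 1 ≤ K.card + dg G U v) : False := by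
  classical
  have hKk := hN.card_lt_of_isClique hK h2
  obtain ⟨u, hu, huK⟩ := hU
  obtain ⟨v, hv, huv⟩ := hmax u huK
  obtain ⟨l₀, hl₀, hlen₀⟩ := hsat u v (fun h => huK (h ▸ hv)) huv
  obtain ⟨x, hx, y, hy, l, hl, hkl, hlong⟩ := exists_longest_pth (G := G) (U : Set V) (K : Set V)
    ⟨u, hu, v, hv, l₀, hl₀, hlen₀⟩
  obtain ⟨f, hf, rfl, rfl, hmem⟩ := hl.line
  have hpos := hl.length_pos
  have hxK : f 0 ∉ K := by
    intro hxK
    refine hf.not_adj hN (by omega) (hK hy hxK ?_)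
    intro he
    have := hf.inj _ _ le_rfl (Nat.zero_le _) he
    omega
  have h1 := hd _ hx hxK
  have h3 := dg_of_isClique hK hy
  have := hf.dg_add_dg_lt hL hN (by omega) (S := U) (T := K) ?_ ?_ (by omega) (by omega)
  · omega
  · intro w hw hadj
    by_contra hcon
    rw [← hmem] at hcon
    have := hlong w hw _ hy _ (hl.cons hadj.symm hcon)
    simp at this
  · intro w hw hadj
    by_contra hcon
    rw [← hmem] at hcon
    have := hlong _ hx w hw _ (hl.concat hadj hcon)
    simp at this

/-- `S` spans more edges than the extremal number. -/
def Big (G : SimpleGraph V) (t k : ℕ) (S : Finset V) : Prop :=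
  2 * t * S.card + 6 * k < ds G S + t * t + 2 * S.card + 11 * t

theorem clique_bound {b t k r p n : ℕ} (hb2 : 2 ≤ b) (hbt : b + 2 ≤ t) (hkr : k = r + b)
    (hk : k = 2 * t + 1 ∨ k = 2 * t + 2) (hn : 3 * t ≤ n) (hp : n = r + p) :
    2 * b * p + r * r + 2 * (r + p) + t * t + 11 * t ≤ 2 * t * (r + p) + 6 * k + r := by
  obtain ⟨d, rfl⟩ := Nat.exists_eq_add_of_le hbt
  obtain ⟨e, rfl⟩ := Nat.exists_eq_add_of_le hb2
  obtain ⟨s, rfl⟩ := Nat.exists_eq_add_of_le hn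
  rcases hk with hk | hk
  · obtain rfl : r = 7 + e + 2 * d := by omega
    obtain rfl : p = 5 + 2 * e + d + s := by omega
    rw [hk]
    refine le_of_le_of_eq (Nat.le_add_right _
      (4 + 5 * d + 4 * e + 2 * s + 4 * e * d + d * d + 2 * d * s)) ?_
    ring
  · obtain rfl : r = 8 + e + 2 * d := by omega
    obtain rfl : p = 4 + 2 * e + d + s := by omega
    rw [hk]
    refine le_of_le_of_eq (Nat.le_add_right _
      (d + 4 * e + 2 * s + 4 * e * d + d * d + 2 * d * s)) ?_
    ring

theorem Big.card_lt_of_isClique [Fintype V] (hL : Link G) {t k : ℕ} (hN : NoLong G k) (ht : 4 ≤ t)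
    (hk : k = 2 * t + 1 ∨ k = 2 * t + 2) (hn : 3 * t ≤ Fintype.card V)
    (hsat : ∀ x y, x ≠ y → ¬ G.Adj x y → ∃ l, Pth G x y l ∧ k ≤ l.length)
    (hbig : Big G t k Finset.univ) {W : Finset V} (hW : G.IsClique (W : Set V)) :
    W.card + t < k + 2 := by
  classical
  by_contra! hcon
  obtain ⟨K, hKm, hKmax⟩ := Finset.exists_max_image
    (Finset.univ.filter fun K : Finset V => G.IsClique (K : Set V)) Finset.card
    ⟨W, by simpa using hW⟩
  have hK : G.IsClique (K : Set V) := by simpa using hKm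
  have hWK : W.card ≤ K.card := hKmax W (by simpa using hW)
  have hKk := hN.card_lt_of_isClique hK (by omega)
  have hmax : ∀ u, u ∉ K → ∃ v ∈ K, ¬ G.Adj u v := by
    intro u hu
    by_contra! hall
    have hins : G.IsClique ((insert u K : Finset V) : Set V) := by
      rw [Finset.coe_insert, SimpleGraph.isClique_insert]
      exact ⟨hK, fun b hb _ => hall b hb⟩
    have := hKmax (insert u K) (by simpa using hins)
    rw [Finset.card_insert_of_notMem hu] at this
    omega
  by_cases hr : K.card + 1 = k
  · obtain ⟨u, hu⟩ : ∃ u, u ∉ K := by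
      by_contra! hall
      have : K.card = Fintype.card V := by
        rw [← Finset.card_univ]; congr 1; ext u; simp [hall]
      omega
    refine clique_core (U := Finset.univ) hL hN hsat hK (by omega) hmax ⟨u, by simp, hu⟩ ?_
    intro v _ _
    have := hL.two_le_dg (by omega) v
    omega
  · by_cases hdeg : ∀ T ⊆ Kᶜ, T.Nonempty → ∃ v ∈ T, dg G (K ∪ T) v ≤ k - K.card
    · have h1 := ds_le_of_degenerate (G := G) Kᶜ disjoint_compl_right hdeg
      rw [Finset.union_compl, Finset.card_compl] at h1
      have h2 := ds_add_card_le (G := G) K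
      unfold Big at hbig
      rw [Finset.card_univ] at hbig
      obtain ⟨b, hb⟩ : ∃ b, k = K.card + b := ⟨k - K.card, by omega⟩
      obtain ⟨p, hp⟩ : ∃ p, Fintype.card V = K.card + p := ⟨Fintype.card V - K.card, by omega⟩
      rw [hp] at h1 hbig
      rw [show k - K.card = b by omega, show K.card + p - K.card = p by omega] at h1
      set r := K.card
      have hb2 : 2 ≤ b := by omega
      have hbt : b + 2 ≤ t := by omega
      have key := clique_bound (n := r + p) hb2 hbt hb (by omega) (by omega) rfl
      omega
    · push Not at hdeg
      obtain ⟨T, hTK, ⟨u, hu⟩, hT⟩ := hdeg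
      have hTK' : ∀ v ∈ T, v ∉ K := fun v hv => by simpa using hTK hv
      refine clique_core (U := K ∪ T) hL hN hsat hK (by omega) hmax
        ⟨u, by simp [hu], hTK' u hu⟩ ?_
      intro v hv hvK
      have hvT : v ∈ T := by simpa [hvK] using hv
      have := hT v hvT
      omega

theorem Big.card_ge {t k : ℕ} (hk : k = 2 * t + 1 ∨ k = 2 * t + 2) {W : Finset V}
    (hW : Big G t k W) (h3 : t ≤ W.card + 3) : k + 2 ≤ W.card + t := by
  by_contra! hcon
  have h1 := ds_add_card_le (G := G) W
  unfold Big at hW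
  obtain ⟨d, hd⟩ : ∃ d : ℤ, (W.card : ℤ) = t + d := ⟨W.card - t, by ring⟩
  have hd1 : -3 ≤ d := by omega
  zify at h1 hW
  rw [hd] at h1 hW
  rcases hk with rfl | rfl
  · have hd2 : d ≤ 2 := by omega
    push_cast at hW
    interval_cases d <;> nlinarith
  · have hd2 : d ≤ 3 := by omega
    push_cast at hW
    interval_cases d <;> nlinarith

theorem dg_add_dg_sdiff [DecidableEq V] {S W : Finset V} (hS : S ⊆ W) (v : V) :
    dg G S v + dg G (W \ S) v = dg G W v := by
  unfold dg
  rw [← Finset.card_union_of_disjoint]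
  · congr 1
    ext w
    simp only [Finset.mem_union, mem_nb, Finset.mem_sdiff]
    constructor
    · rintro (⟨h, h'⟩ | ⟨⟨h, -⟩, h'⟩)
      · exact ⟨hS h, h'⟩
      · exact ⟨h, h'⟩
    · rintro ⟨h, h'⟩
      by_cases hw : w ∈ S
      · exact Or.inl ⟨hw, h'⟩
      · exact Or.inr ⟨⟨h, hw⟩, h'⟩
  · rw [Finset.disjoint_left]
    intro w hw hw'
    rw [mem_nb] at hw hw'
    exact (Finset.mem_sdiff.1 hw'.1).2 hw.1

theorem ds_add_ds_sdiff [DecidableEq V] {S W : Finset V} (hS : S ⊆ W) :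
    ds G W + ds G S = ds G (W \ S) + 2 * ∑ v ∈ S, dg G W v := by
  induction S using Finset.induction_on with
  | empty => simp [ds]
  | insert v S hv ih =>
    have hS' : S ⊆ W := fun x hx => hS (Finset.mem_insert_of_mem hx)
    have hvW : v ∈ W := hS (Finset.mem_insert_self _ _)
    have h1 := ih hS'
    have h2 := ds_insert (G := G) hv
    have h3 := ds_erase (G := G) (S := W \ S) (v := v) (Finset.mem_sdiff.2 ⟨hvW, hv⟩)
    have h4 := dg_add_dg_sdiff (G := G) hS' v
    have h5 : W \ insert v S = (W \ S).erase v := by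
      ext x
      simp only [Finset.mem_sdiff, Finset.mem_insert, Finset.mem_erase]
      tauto
    rw [Finset.sum_insert hv, h5]
    omega

/-- `W` is a smallest vertex set spanning more edges than the extremal number. -/
structure MinBig (G : SimpleGraph V) (t k : ℕ) (W : Finset V) : Prop where
  big : Big G t k W
  card : t ≤ W.card + 3
  min : ∀ U, Big G t k U → t ≤ U.card + 3 → W.card ≤ U.card

theorem exists_minBig {t k : ℕ} {S : Finset V} (hS : Big G t k S) (h3 : t ≤ S.card + 3) :
    ∃ W, MinBig G t k W := by
  classical
  have hex : ∃ n, ∃ U, Big G t k U ∧ t ≤ U.card + 3 ∧ U.card = n := ⟨_, S, hS, h3, rfl⟩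
  obtain ⟨W, hW, hW3, hWn⟩ := Nat.find_spec hex
  exact ⟨W, hW, hW3, fun U hU hU3 => hWn ▸ Nat.find_min' hex ⟨U, hU, hU3, rfl⟩⟩

theorem MinBig.card_ge {t k : ℕ} (hk : k = 2 * t + 1 ∨ k = 2 * t + 2) {W : Finset V}
    (h : MinBig G t k W) : k + 2 ≤ W.card + t :=
  h.big.card_ge hk h.card

theorem MinBig.le_dg {t k : ℕ} (hk : k = 2 * t + 1 ∨ k = 2 * t + 2) {W : Finset V}
    (h : MinBig G t k W) {v : V} (hv : v ∈ W) : t ≤ dg G W v := by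
  classical
  by_contra! hcon
  have h1 := ds_erase (G := G) hv
  have h2 := Finset.card_erase_add_one hv
  have h3 := h.card_ge hk
  have hb := h.big
  have := h.min (W.erase v) ?_ (by omega)
  · omega
  · unfold Big at hb ⊢
    rw [← h2] at hb
    rw [Nat.mul_add, Nat.mul_add] at hb
    omega

theorem degree_bound {r f N t w k q : ℕ} (hf : 2 ≤ f) (hN : f + 3 ≤ N) (ht : t = r + f)
    (hw : w = N + r) (hk : 2 * t + 1 ≤ k)
    (hq : q + 12 * t + 6 ≤ 2 * f + 6 * k) :
    t * N + q + r * w + t * t + 2 * w + 11 * t ≤ 2 * t * w + 6 * k + r := by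
  obtain ⟨x, rfl⟩ := Nat.exists_eq_add_of_le hf
  obtain ⟨y, rfl⟩ := Nat.exists_eq_add_of_le hN
  obtain ⟨z, rfl⟩ := Nat.exists_eq_add_of_le hk
  subst ht hw
  obtain ⟨p, hp⟩ : ∃ p, q + p = 4 + 2 * x + 6 * z := ⟨4 + 2 * x + 6 * z - q, by omega⟩
  refine le_of_le_of_eq (Nat.le_add_right _ (p + x * y)) ?_
  linear_combination hp

theorem MinBig.exists_leaf {t k : ℕ} (hk : k = 2 * t + 1 ∨ k = 2 * t + 2) {W : Finset V}
    (h : MinBig G t k W) {S : Finset V} (hS : S ⊆ W) (hne : S.Nonempty)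
    (hd : ∀ v ∈ S, dg G W v = t) : ∃ v ∈ S, dg G S v ≤ 1 := by
  classical
  by_contra! hcon
  have h1 := ds_add_ds_sdiff (G := G) hS
  rw [Finset.sum_congr rfl hd, Finset.sum_const, smul_eq_mul] at h1
  have h2 : S.card * 2 ≤ ds G S := by
    have := Finset.sum_le_sum (s := S) (f := fun _ => 2) (g := dg G S) fun v hv => hcon v hv
    simpa [ds] using this
  have h3 := Finset.card_sdiff_add_card_eq_card hS
  have hpos := hne.card_pos
  have hb := h.big
  have hbig : Big G t k (W \ S) := by
    unfold Big at hb ⊢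
    rw [← h3, Nat.mul_add, Nat.mul_add] at hb
    have : 2 * (S.card * t) = 2 * t * S.card := by ring
    omega
  by_cases hr : t ≤ (W \ S).card + 3
  · have := h.min _ hbig hr
    omega
  · have hge := h.card_ge hk
    have h5 : ds G W = ∑ v ∈ W \ S, dg G W v + ∑ v ∈ S, dg G W v := (Finset.sum_sdiff hS).symm
    rw [Finset.sum_congr rfl hd, Finset.sum_const, smul_eq_mul] at h5
    have h6 : ∑ v ∈ W \ S, (dg G W v + 1) ≤ ∑ _v ∈ W \ S, W.card :=
      Finset.sum_le_sum fun v hv => dg_lt (Finset.mem_sdiff.1 hv).1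
    rw [Finset.sum_add_distrib, Finset.sum_const, Finset.sum_const, smul_eq_mul, smul_eq_mul,
      mul_one] at h6
    have := degree_bound (r := (W \ S).card) (f := t - (W \ S).card) (N := S.card) (t := t)
      (w := W.card) (k := k) (q := 0) (by omega) (by omega) (by omega) (by omega) (by omega) (by omega)
    unfold Big at hb
    have : S.card * t = t * S.card := by ring
    omega

theorem exists_of_closed_pth (hL : Link G) {t k : ℕ} (hN : NoLong G k) (ht : 2 ≤ t)
    (hk : k = 2 * t + 1 ∨ k = 2 * t + 2) {a b w : V} {l : List V} (hl : Pth G a b l)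
    (hba : G.Adj b a) (hlen : l.length + 1 = k) (hw : w ∉ l) {W : Finset V} (hdg : t ≤ dg G W w)
    (hWl : ∀ z ∈ W, G.Adj w z → z ∈ l) :
    ∃ A : Finset V, A.card ≤ t ∧ IsStarForest (G.induce {v : V | v ∉ A}) := by
  obtain ⟨g, hg, hmem⟩ := hl.cyc hba
  refine exists_of_many_neighbors hL hg (hlen ▸ hN) ht (by omega) (w := w) ?_ (nb G W w) ?_ ?_ hdg
  · intro i hi
    refine hw ((hmem w).2 ⟨i % l.length, Nat.mod_lt _ hg.pos, ?_⟩)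
    rw [← hi]
    exact hg.mod i
  · exact fun x hx => (mem_nb.1 hx).2.symm
  · intro x hx
    rw [mem_nb] at hx
    obtain ⟨i, -, hi⟩ := (hmem x).1 (hWl x hx.1 hx.2)
    exact ⟨i, hi⟩

/-- A longest path among those with both ends in `W`. -/
structure MaxLine (G : SimpleGraph V) (W : Finset V) (f : ℕ → V) (m : ℕ) : Prop where
  line : Line G f m
  left : f 0 ∈ W
  right : f m ∈ W
  max : ∀ x ∈ W, ∀ y ∈ W, ∀ l, Pth G x y l → l.length ≤ m + 1

namespace MaxLine

variable {W : Finset V} {f : ℕ → V} {m k t : ℕ}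

theorem rev (h : MaxLine G W f m) : MaxLine G W (fun i => f (m - i)) m :=
  ⟨h.line.rev, by simpa using h.right, by simpa using h.left, h.max⟩

theorem mem_left (h : MaxLine G W f m) {w : V} (hw : w ∈ W) (ha : G.Adj (f 0) w) :
    ∃ i ≤ m, f i = w := by
  by_contra! hcon
  have := h.max w hw _ h.right _ ((h.line.pth (Nat.zero_le m) le_rfl).cons ha.symm ?_)
  · simp [length_blk] at this
  · simp only [List.mem_map, mem_blk, not_exists, not_and]
    intro i hi
    exact hcon i (by omega)

theorem mem_right (h : MaxLine G W f m) {w : V} (hw : w ∈ W) (ha : G.Adj (f m) w) :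
    ∃ i ≤ m, f i = w := by
  obtain ⟨i, hi, he⟩ := h.rev.mem_left hw (by simpa using ha)
  exact ⟨m - i, by omega, he⟩

theorem dg_add_dg_lt (h : MaxLine G W f m) (hL : Link G) (hN : NoLong G k) (hm : k ≤ m + 1)
    (ht : 0 < t) (hd : ∀ v ∈ W, t ≤ dg G W v) : dg G W (f 0) + dg G W (f m) < k :=
  h.line.dg_add_dg_lt hL hN hm (fun _ => h.mem_left) (fun _ => h.mem_right)
    (ht.trans_le (hd _ h.left)) (ht.trans_le (hd _ h.right))

theorem exists_of_first (h : MaxLine G W f m) (hL : Link G) (hN : NoLong G k) (ht : 2 ≤ t)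
    (hk : k = 2 * t + 1 ∨ k = 2 * t + 2) (hm : m + 1 = k) (hd : ∀ v ∈ W, t ≤ dg G W v)
    (h1 : G.Adj (f m) (f 1)) :
    ∃ A : Finset V, A.card ≤ t ∧ IsStarForest (G.induce {v : V | v ∉ A}) := by
  refine exists_of_closed_pth hL hN ht hk (h.line.pth (i := 1) (j := m) (by omega) le_rfl) h1
    (by simp [length_blk]; omega) (w := f 0) ?_ (hd _ h.left) ?_
  · simp only [List.mem_map, mem_blk, not_exists, not_and]
    intro i hi he
    have := h.line.inj i 0 (by omega) (by omega) he
    omega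
  · intro z hz ha
    obtain ⟨i, hi, rfl⟩ := h.mem_left hz ha
    refine List.mem_map_of_mem ?_
    rw [mem_blk]
    rcases Nat.eq_zero_or_pos i with rfl | h0
    · exact absurd rfl ha.ne
    · omega

theorem exists_of_middle (h : MaxLine G W f m) (hL : Link G) (hN : NoLong G k) (ht : 2 ≤ t)
    (hk : k = 2 * t + 1 ∨ k = 2 * t + 2) (hm : m + 1 = k) (hd : ∀ v ∈ W, t ≤ dg G W v)
    {q : ℕ} (hq : q + 2 ≤ m) (h1 : G.Adj (f m) (f q)) (h2 : G.Adj (f 0) (f (q + 2)))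
    (hqW : f (q + 1) ∈ W) :
    ∃ A : Finset V, A.card ≤ t ∧ IsStarForest (G.induce {v : V | v ∉ A}) := by
  have hinj := h.line.inj
  have hdis : ∀ i ≤ m, ∀ a b, a ≤ m → b ≤ m → i ∉ blk a b → f i ∉ (blk a b).map f := by
    intro i hi a b ha hb hn hmem
    obtain ⟨x, hx, he⟩ := List.mem_map.1 hmem
    have hx' := mem_blk.1 hx
    exact hn (hinj x i (by omega) hi he ▸ hx)
  have hp := (h.line.pth (i := 0) (j := q) (by omega) (by omega)).append
    (h.line.pth (i := m) (j := q + 2) le_rfl hq) h1.symm (by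
      intro x hx
      obtain ⟨i, hi, rfl⟩ := List.mem_map.1 hx
      rw [mem_blk] at hi
      exact hdis i (by omega) _ _ (by omega) (by omega) (by rw [mem_blk]; omega))
  refine exists_of_closed_pth hL hN ht hk hp h2.symm (by simp [length_blk]; omega)
    (w := f (q + 1)) ?_ (hd _ hqW) ?_
  · rw [List.mem_append, not_or]
    exact ⟨hdis _ (by omega) _ _ (by omega) (by omega) (by rw [mem_blk]; omega),
      hdis _ (by omega) _ _ (by omega) (by omega) (by rw [mem_blk]; omega)⟩
  · intro z hz ha
    have hzm : ∃ i ≤ m, f i = z := by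
      by_contra! hcon
      have hz' : ∀ a b, a ≤ m → b ≤ m → z ∉ (blk a b).map f := by
        intro a b ha hb hmem
        obtain ⟨x, hx, he⟩ := List.mem_map.1 hmem
        rw [mem_blk] at hx
        exact hcon x (by omega) he
      have hp' := ((h.line.pth (i := q + 1) (j := m) (by omega) le_rfl).append
        (h.line.pth (i := q) (j := 0) (by omega) (by omega)) h1 (by
          intro x hx
          obtain ⟨i, hi, rfl⟩ := List.mem_map.1 hx
          rw [mem_blk] at hi
          exact hdis i (by omega) _ _ (by omega) (by omega) (by rw [mem_blk]; omega))).cons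
        ha.symm (by
          rw [List.mem_append, not_or]
          exact ⟨hz' _ _ (by omega) (by omega), hz' _ _ (by omega) (by omega)⟩)
      have := h.max _ hz _ h.left _ hp'
      simp [length_blk] at this
      omega
    obtain ⟨i, hi, rfl⟩ := hzm
    have hne : i ≠ q + 1 := by
      rintro rfl
      exact absurd rfl ha.ne
    rw [List.mem_append]
    by_cases hiq : i ≤ q
    · exact Or.inl (List.mem_map_of_mem (by rw [mem_blk]; omega))
    · exact Or.inr (List.mem_map_of_mem (by rw [mem_blk]; omega))

end MaxLine

open Classical in
/-- The vertices of `W` adjacent to all other vertices of `W`. -/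
noncomputable def dom (G : SimpleGraph V) (W : Finset V) : Finset V :=
  W.filter fun v => ∀ w ∈ W, w ≠ v → G.Adj v w

theorem mem_dom {W : Finset V} {v : V} :
    v ∈ dom G W ↔ v ∈ W ∧ ∀ w ∈ W, w ≠ v → G.Adj v w := by
  classical
  simp [dom]

theorem dom_subset {W : Finset V} : dom G W ⊆ W := fun _ hv => (mem_dom.1 hv).1

theorem MinBig.card_dom [DecidableEq V] {t k : ℕ} (hk : k = 2 * t + 1 ∨ k = 2 * t + 2) {W : Finset V}
    (h : MinBig G t k W)
    (hsum : ∀ x ∈ W, ∀ y ∈ W, x ≠ y → ¬ G.Adj x y → dg G W x + dg G W y < k)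
    {x y : V} (hx : x ∈ W) (hy : y ∈ W) (hxy : x ≠ y) (hn : ¬ G.Adj x y) :
    (dom G W).card ≤ t ∧ t ≤ (dom G W).card + 1 ∧
      ((dom G W).card + 1 = t → 7 ≤ (W \ dom G W).card) := by
  have hdeg : ∀ v ∈ W, t ≤ dg G W v := fun v hv => h.le_dg hk hv
  have hsub : ∀ v ∈ W, v ∉ dom G W → (dom G W).card ≤ dg G W v := by
    intro v hv hvd
    refine Finset.card_le_card fun w hw => mem_nb.2 ⟨dom_subset hw, ?_⟩
    exact ((mem_dom.1 hw).2 v hv (fun he => hvd (he ▸ hw))).symm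
  have hxd : x ∉ dom G W := fun hd => hn ((mem_dom.1 hd).2 y hy hxy.symm)
  have hyd : y ∉ dom G W := fun hd => hn ((mem_dom.1 hd).2 x hx hxy).symm
  have hst : (dom G W).card ≤ t := by
    have := hsum x hx y hy hxy hn
    have := hsub x hx hxd
    have := hsub y hy hyd
    omega
  have hF : ∀ v ∈ W \ dom G W, t + dg G W v < k := by
    intro v hv
    rw [Finset.mem_sdiff, mem_dom] at hv
    push Not at hv
    obtain ⟨hvW, hv⟩ := hv
    obtain ⟨u, hu, huv, hna⟩ := hv hvW
    have := hsum v hvW u hu huv.symm hna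
    have := hdeg u hu
    omega
  set Q := (W \ dom G W).filter fun v => dg G W v = t + 1 with hQdef
  have hQ : Q.card = 0 ∨ k = 2 * t + 2 ∧ (dom G W).card + Q.card ≤ t + 2 := by
    rcases Q.eq_empty_or_nonempty with he | ⟨v, hv⟩
    · simp [he]
    · right
      have hQm : ∀ u ∈ Q, u ∈ W ∧ u ∉ dom G W ∧ dg G W u = t + 1 := by
        intro u hu
        rw [hQdef, Finset.mem_filter, Finset.mem_sdiff] at hu
        exact ⟨hu.1.1, hu.1.2, hu.2⟩
      obtain ⟨hvW, hvd, hvt⟩ := hQm v hv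
      have := hF v (Finset.mem_sdiff.2 ⟨hvW, hvd⟩)
      refine ⟨by omega, ?_⟩
      have hss : (dom G W ∪ Q).erase v ⊆ nb G W v := by
        intro u hu
        rw [Finset.mem_erase, Finset.mem_union] at hu
        rw [mem_nb]
        rcases hu with ⟨hne, hu | hu⟩
        · exact ⟨dom_subset hu, ((mem_dom.1 hu).2 v hvW hne.symm).symm⟩
        · obtain ⟨huW, -, hut⟩ := hQm u hu
          refine ⟨huW, ?_⟩
          by_contra hna
          have := hsum v hvW u huW hne.symm hna
          omega
      have hc := Finset.card_le_card hss
      have hdis : Disjoint (dom G W) Q := by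
        rw [Finset.disjoint_left]
        exact fun u hu hu' => (hQm u hu').2.1 hu
      rw [Finset.card_erase_of_mem (Finset.mem_union_right _ hv),
        Finset.card_union_of_disjoint hdis] at hc
      unfold dg at hvt
      omega
  have h1 : ds G W = ∑ v ∈ W \ dom G W, dg G W v + ∑ v ∈ dom G W, dg G W v :=
    (Finset.sum_sdiff dom_subset).symm
  have h2 : ∑ v ∈ dom G W, (dg G W v + 1) ≤ ∑ _v ∈ dom G W, W.card :=
    Finset.sum_le_sum fun v hv => dg_lt (dom_subset hv)
  rw [Finset.sum_add_distrib, Finset.sum_const, Finset.sum_const, smul_eq_mul, smul_eq_mul,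
    mul_one] at h2
  have h3 : ∑ v ∈ W \ dom G W, dg G W v ≤
      ∑ v ∈ W \ dom G W, (t + if dg G W v = t + 1 then 1 else 0) := by
    refine Finset.sum_le_sum fun v hv => ?_
    have := hF v hv
    split_ifs <;> omega
  rw [Finset.sum_add_distrib, Finset.sum_const, smul_eq_mul, ← Finset.card_filter, ← hQdef] at h3
  have h4 := Finset.card_sdiff_add_card_eq_card (dom_subset (G := G) (W := W))
  have h5 := h.card_ge hk
  have hb := h.big
  unfold Big at hb
  set s := (dom G W).card
  set N := (W \ dom G W).card
  have e1 : N * t = t * N := Nat.mul_comm _ _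
  refine ⟨hst, ?_, ?_⟩
  · by_contra! hcon
    have := degree_bound (r := s) (f := t - s) (N := N) (t := t) (w := W.card) (k := k)
      (q := Q.card) (by omega) (by omega) (by omega) (by omega) (by omega) (by omega)
    omega
  · intro hs
    rw [← h4, ← hs] at hb
    rw [← h4] at h2
    rw [← hs] at h3
    have e2 : 2 * (s + 1) * (N + s) = 2 * (s * N) + 2 * N + 2 * (s * s) + 2 * s := by ring
    have e3 : s * (N + s) = s * N + s * s := by ring
    have e4 : N * (s + 1) = s * N + N := by ring
    have e5 : (s + 1) * (s + 1) = s * s + 2 * s + 1 := by ring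
    rw [e2, e5] at hb
    rw [e3] at h2
    rw [e4] at h3
    omega

theorem card_le_of_sparse {I : Finset ℕ} {m : ℕ} (hI : ∀ i ∈ I, 1 < i ∧ i + 1 < m)
    (hs : ∀ i ∈ I, i + 1 ∉ I) (hm : 2 ≤ m) : 2 * I.card + 2 ≤ m := by
  have hd : Disjoint I (I.image (· + 1)) := by
    rw [Finset.disjoint_left]
    intro i hi hi'
    obtain ⟨j, hj, rfl⟩ := Finset.mem_image.1 hi'
    exact hs j hj hi
  have hsub : I ∪ I.image (· + 1) ⊆ Finset.Ico 2 m := by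
    intro i hi
    rw [Finset.mem_Ico]
    rcases Finset.mem_union.1 hi with hi | hi
    · have := hI i hi
      omega
    · obtain ⟨j, hj, rfl⟩ := Finset.mem_image.1 hi
      have := hI j hj
      omega
  have := Finset.card_le_card hsub
  rw [Finset.card_union_of_disjoint hd, Finset.card_image_of_injective _ (add_left_injective 1),
    Nat.card_Ico] at this
  omega

theorem card_add_card_le_of_sparse {I : Finset ℕ} {m : ℕ} (hI : ∀ i ∈ I, 1 < i ∧ i + 1 < m)
    (hs : ∀ i ∈ I, i + 1 ∉ I) (hm : 1 ≤ m) :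
    2 * I.card + (I.filter fun i => i + 2 ∉ I).card + 1 ≤ m := by
  set R := I.filter fun i => i + 2 ∉ I with hR
  have hd : Disjoint I (I.image (· + 1)) := by
    rw [Finset.disjoint_left]
    intro i hi hi'
    obtain ⟨j, hj, rfl⟩ := Finset.mem_image.1 hi'
    exact hs j hj hi
  have hd' : Disjoint (I ∪ I.image (· + 1)) (R.image (· + 2)) := by
    rw [Finset.disjoint_left]
    intro i hi hi'
    obtain ⟨j, hj, rfl⟩ := Finset.mem_image.1 hi'
    rw [hR, Finset.mem_filter] at hj
    rcases Finset.mem_union.1 hi with hi | hi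
    · exact hj.2 hi
    · obtain ⟨p, hp, he⟩ := Finset.mem_image.1 hi
      obtain rfl : p = j + 1 := by omega
      exact hs j hj.1 hp
  have hsub : (I ∪ I.image (· + 1)) ∪ R.image (· + 2) ⊆ Finset.Icc 2 m := by
    intro i hi
    rw [Finset.mem_Icc]
    rcases Finset.mem_union.1 hi with hi | hi
    · rcases Finset.mem_union.1 hi with hi | hi
      · have := hI i hi
        omega
      · obtain ⟨j, hj, rfl⟩ := Finset.mem_image.1 hi
        have := hI j hj
        omega
    · obtain ⟨j, hj, rfl⟩ := Finset.mem_image.1 hi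
      have := hI j (Finset.mem_filter.1 hj).1
      omega
  have := Finset.card_le_card hsub
  rw [Finset.card_union_of_disjoint hd', Finset.card_union_of_disjoint hd,
    Finset.card_image_of_injective _ (add_left_injective 1),
    Finset.card_image_of_injective _ (add_left_injective 2), Nat.card_Icc] at this
  omega

theorem Line.update [DecidableEq V] {f : ℕ → V} {m p : ℕ} (h : Line G f m) {w : V}
    (hw : ∀ i ≤ m, f i ≠ w) (h0 : 0 < p) (h1 : G.Adj (f (p - 1)) w) (h2 : G.Adj w (f (p + 1))) :
    Line G (Function.update f p w) m := by
  refine ⟨fun i hi => ?_, fun i j hi hj he => ?_⟩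
  · by_cases hip : i = p
    · subst hip
      rw [Function.update_self, Function.update_of_ne (by omega)]
      exact h2
    · rw [Function.update_of_ne hip]
      by_cases hip' : i + 1 = p
      · rw [hip', Function.update_self, show i = p - 1 by omega]
        exact h1
      · rw [Function.update_of_ne hip']
        exact h.adj i hi
  · by_cases hip : i = p <;> by_cases hjp : j = p
    · omega
    · subst hip
      rw [Function.update_self, Function.update_of_ne hjp] at he
      exact absurd he.symm (hw j hj)
    · subst hjp
      rw [Function.update_self, Function.update_of_ne hip] at he
      exact absurd he (hw i hi)
    · rw [Function.update_of_ne hip, Function.update_of_ne hjp] at he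
      exact h.inj i j hi hj he

theorem MinBig.exists_of_pth_le (hL : Link G) {t k : ℕ} (hN : NoLong G k) (ht : 4 ≤ t)
    (hk : k = 2 * t + 1 ∨ k = 2 * t + 2) {W : Finset V} (hW : MinBig G t k W)
    (hsat : ∀ x y, x ≠ y → ¬ G.Adj x y → ∃ l, Pth G x y l ∧ k ≤ l.length)
    (hmax : ∀ x ∈ W, ∀ y ∈ W, ∀ l, Pth G x y l → l.length ≤ k)
    {x y : V} (hx : x ∈ W) (hy : y ∈ W) (hxy : x ≠ y) (hn : ¬ G.Adj x y) :
    ∃ A : Finset V, A.card ≤ t ∧ IsStarForest (G.induce {v : V | v ∉ A}) := by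
  classical
  have hdeg : ∀ v ∈ W, t ≤ dg G W v := fun v hv => hW.le_dg hk hv
  obtain ⟨m, hm⟩ : ∃ m, m + 1 = k := ⟨k - 1, by omega⟩
  have hline : ∀ x ∈ W, ∀ y ∈ W, x ≠ y → ¬ G.Adj x y →
      ∃ f, MaxLine G W f m ∧ f 0 = x ∧ f m = y := by
    intro x hx y hy hxy hn
    obtain ⟨l, hl, hlen⟩ := hsat x y hxy hn
    have := hmax x hx y hy l hl
    obtain ⟨f, hf, rfl, rfl, -⟩ := hl.line
    have hlm : l.length - 1 = m := by omega
    rw [hlm] at hf hy ⊢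
    exact ⟨f, ⟨hf, hx, hy, hm ▸ hmax⟩, rfl, rfl⟩
  have hsum : ∀ x ∈ W, ∀ y ∈ W, x ≠ y → ¬ G.Adj x y → dg G W x + dg G W y < k := by
    intro x hx y hy hxy hn
    obtain ⟨f, hf, rfl, rfl⟩ := hline x hx y hy hxy hn
    exact hf.dg_add_dg_lt hL hN hm.ge (by omega) hdeg
  obtain ⟨hs1, hs2, hs3⟩ := hW.card_dom hk hsum hx hy hxy hn
  have hxd : x ∉ dom G W := fun hd => hn ((mem_dom.1 hd).2 y hy hxy.symm)
  have hyd : y ∉ dom G W := fun hd => hn ((mem_dom.1 hd).2 x hx hxy).symm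
  obtain ⟨f, hf, rfl, rfl⟩ := hline x hx y hy hxy hn
  have hdl : ∀ v ∈ dom G W, G.Adj (f 0) v := fun v hv =>
    ((mem_dom.1 hv).2 _ hx fun he => hxd (he ▸ hv)).symm
  have hdr : ∀ v ∈ dom G W, G.Adj (f m) v := fun v hv =>
    ((mem_dom.1 hv).2 _ hy fun he => hyd (he ▸ hv)).symm
  set I := idx G (dom G W) f m (f 0) with hIdef
  have hIm : ∀ i, i ∈ I ↔ i ≤ m ∧ f i ∈ dom G W := by
    intro i
    rw [hIdef, mem_idx]
    exact ⟨fun h => ⟨h.1, h.2.1⟩, fun h => ⟨h.1, h.2, hdl _ h.2⟩⟩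
  have hIc : I.card = (dom G W).card := by
    rw [hIdef, hf.line.card_idx fun w hw ha => hf.mem_left (dom_subset hw) ha, dg]
    congr 1
    ext v
    rw [mem_nb]
    exact ⟨fun h => h.1, fun h => ⟨h, hdl v h⟩⟩
  have hsp : ∀ i ∈ I, i + 1 ∉ I := by
    intro i hi hi'
    have := hf.line.cross hN (i := i) (j := i + 1) (by omega) ((hIm _).1 hi').1
      (hdr _ ((hIm _).1 hi).2) (hdl _ ((hIm _).1 hi').2)
    omega
  by_cases h1 : 1 ∈ I
  · exact hf.exists_of_first hL hN (by omega) hk hm hdeg (hdr _ ((hIm _).1 h1).2)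
  by_cases hlast : m - 1 ∈ I
  · refine hf.rev.exists_of_first hL hN (by omega) hk hm hdeg ?_
    simpa using hdl _ ((hIm _).1 hlast).2
  have hI : ∀ i ∈ I, 1 < i ∧ i + 1 < m := by
    intro i hi
    have h' := (hIm i).1 hi
    have c0 : i ≠ 0 := fun h => hxd (h ▸ h'.2)
    have cm : i ≠ m := fun h => hyd (h ▸ h'.2)
    have c1 : i ≠ 1 := fun h => h1 (h ▸ hi)
    have cl : i ≠ m - 1 := fun h => hlast (h ▸ hi)
    omega
  have hc1 := card_le_of_sparse hI hsp (by omega)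
  have hc2 := card_add_card_le_of_sparse hI hsp (by omega)
  have hN7 := hs3 (by omega)
  have hc3 := Finset.card_filter_add_card_filter_not (s := I) (fun i => i + 2 ∈ I)
  by_cases hmid : ∃ q ∈ I.filter (fun i => i + 2 ∈ I), f (q + 1) ∈ W
  · obtain ⟨q, hq, hqW⟩ := hmid
    rw [Finset.mem_filter, hIm, hIm] at hq
    exact hf.exists_of_middle hL hN (by omega) hk hm hdeg hq.2.1 (hdr _ hq.1.2) (hdl _ hq.2.2) hqW
  push Not at hmid
  set M := I.filter (fun i => i + 2 ∈ I) with hM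
  set J := (Finset.range (m + 1)).filter (fun i => f i ∈ W \ dom G W) with hJ
  have hJc : J.card + I.card + M.card ≤ m + 1 := by
    have hd1 : Disjoint J I := by
      rw [Finset.disjoint_left]
      intro i hi hi'
      rw [hJ, Finset.mem_filter, Finset.mem_sdiff] at hi
      exact hi.2.2 ((hIm i).1 hi').2
    have hd2 : Disjoint (J ∪ I) (M.image (· + 1)) := by
      rw [Finset.disjoint_left]
      intro i hi hi'
      obtain ⟨q, hq, rfl⟩ := Finset.mem_image.1 hi'
      rcases Finset.mem_union.1 hi with hi | hi
      · rw [hJ, Finset.mem_filter, Finset.mem_sdiff] at hi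
        exact hmid q hq hi.2.1
      · exact hsp q (Finset.mem_filter.1 hq).1 hi
    have hsub : (J ∪ I) ∪ M.image (· + 1) ⊆ Finset.range (m + 1) := by
      intro i hi
      rw [Finset.mem_range]
      rcases Finset.mem_union.1 hi with hi | hi
      · rcases Finset.mem_union.1 hi with hi | hi
        · simpa using (Finset.mem_filter.1 hi).1
        · have := hI i hi
          omega
      · obtain ⟨q, hq, rfl⟩ := Finset.mem_image.1 hi
        have := hI q (Finset.mem_filter.1 hq).1
        omega
    have := Finset.card_le_card hsub
    rwa [Finset.card_union_of_disjoint hd2, Finset.card_union_of_disjoint hd1,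
      Finset.card_image_of_injective _ (add_left_injective 1), Finset.card_range] at this
  obtain ⟨w, hw, hwf⟩ : ∃ w ∈ W \ dom G W, ∀ i ≤ m, f i ≠ w := by
    by_contra! hcon
    have hsub : W \ dom G W ⊆ J.image f := by
      intro v hv
      obtain ⟨i, hi, rfl⟩ := hcon v hv
      exact Finset.mem_image_of_mem f (Finset.mem_filter.2 ⟨by simp; omega, hv⟩)
    have := (Finset.card_le_card hsub).trans Finset.card_image_le
    omega
  obtain ⟨q, hq⟩ : M.Nonempty := by
    rw [← Finset.card_pos]
    omega
  rw [hM, Finset.mem_filter, hIm, hIm] at hq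
  have hwd : ∀ v ∈ dom G W, G.Adj v w := fun v hv =>
    (mem_dom.1 hv).2 w (Finset.mem_sdiff.1 hw).1 fun he => (Finset.mem_sdiff.1 hw).2 (he ▸ hv)
  have hne : q + 1 ≠ m := by omega
  have hg : MaxLine G W (Function.update f (q + 1) w) m := by
    refine ⟨hf.line.update hwf (by omega) (hwd _ hq.1.2) (hwd _ hq.2.2).symm, ?_, ?_, hf.max⟩
    · rw [Function.update_of_ne (by omega)]
      exact hx
    · rw [Function.update_of_ne hne.symm]
      exact hy
  refine hg.exists_of_middle (q := q) hL hN (by omega) hk hm hdeg hq.2.1 ?_ ?_ ?_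
  · rw [Function.update_of_ne hne.symm, Function.update_of_ne (by omega)]
    exact hdr _ hq.1.2
  · rw [Function.update_of_ne (by omega), Function.update_of_ne (by omega)]
    exact hdl _ hq.2.2
  · rw [Function.update_self]
    exact (Finset.mem_sdiff.1 hw).1

theorem card_starts_add_card_pairs (I : Finset ℕ) (h0 : 0 ∉ I) :
    (I.filter fun q => q - 1 ∉ I).card + (I.filter fun q => q + 1 ∈ I).card = I.card := by
  have h1 := Finset.card_filter_add_card_filter_not (s := I) (fun q => q - 1 ∈ I)
  have h2 : (I.filter fun q => q + 1 ∈ I).card = (I.filter fun q => q - 1 ∈ I).card := by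
    refine Finset.card_bij (fun q _ => q + 1) ?_ ?_ ?_
    · intro q hq
      rw [Finset.mem_filter] at hq ⊢
      exact ⟨hq.2, by simpa using hq.1⟩
    · intro a _ b _ h
      omega
    · intro b hb
      rw [Finset.mem_filter] at hb
      have hb0 : b ≠ 0 := fun h => h0 (h ▸ hb.1)
      refine ⟨b - 1, Finset.mem_filter.2 ⟨hb.2, ?_⟩, by omega⟩
      rw [show b - 1 + 1 = b by omega]
      exact hb.1
  omega

theorem card_add_card_le_of_cross {I J : Finset ℕ} {m k c : ℕ} (hm : k ≤ m) (hmk : m + 2 = k + c)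
    (hI : ∀ i ∈ I, 1 ≤ i ∧ i ≤ m) (hJ : ∀ j ∈ J, j < m)
    (hgap : ∀ p ∈ J, ∀ q ∈ I, p < q → p + c + 1 ≤ q) (hcr : ∃ p ∈ J, ∃ q ∈ I, p < q) :
    I.card + (I.card + J.card) ≤ (I.filter fun q => q + 1 ∈ I).card + k + 1 := by
  obtain ⟨q, ⟨hq, p, hp, hpq⟩, hqmin⟩ : ∃ q, (q ∈ I ∧ ∃ p ∈ J, p < q) ∧
      ∀ q', q' ∈ I → (∃ p ∈ J, p < q') → q ≤ q' := by
    have hex : ∃ q, q ∈ I ∧ ∃ p ∈ J, p < q := by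
      obtain ⟨p, hp, q, hq, hpq⟩ := hcr
      exact ⟨q, hq, p, hp, hpq⟩
    exact ⟨Nat.find hex, Nat.find_spec hex, fun q' h1 h2 => Nat.find_min' hex ⟨h1, h2⟩⟩
  have hpq' := hgap p hp q hq hpq
  have hlow : ∀ q' ∈ I, q' < q → q' ≤ p := by
    intro q' h1 h2
    by_contra! h3
    have := hqmin q' h1 ⟨p, hp, h3⟩
    omega
  have hIne : I.Nonempty := ⟨q, hq⟩
  set a := I.min' hIne
  have ha : ∀ i ∈ I, a ≤ i := fun i hi => I.min'_le i hi
  have ha1 := (hI a (I.min'_mem hIne)).1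
  set St := I.filter fun q => q - 1 ∉ I with hSt
  have hst := card_starts_add_card_pairs I fun h => by have := (hI 0 h).1; omega
  rw [← hSt] at hst
  set X := ((St.erase q).erase a).image (· - 2) with hX
  have hXm : ∀ s ∈ (St.erase q).erase a, s ∈ I ∧ s - 1 ∉ I ∧ s ≠ q ∧ a + 2 ≤ s := by
    intro s hs
    rw [Finset.mem_erase, Finset.mem_erase, hSt, Finset.mem_filter] at hs
    obtain ⟨h1, h2, h3, h4⟩ := hs
    refine ⟨h3, h4, h2, ?_⟩
    have := ha s h3
    have : s - 1 ≠ a := fun h => h4 (h ▸ I.min'_mem hIne)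
    omega
  have hXc : St.card ≤ X.card + 2 := by
    rw [hX, Finset.card_image_of_injOn]
    · have h1 := Finset.pred_card_le_card_erase (s := St) (a := q)
      have h2 := Finset.pred_card_le_card_erase (s := St.erase q) (a := a)
      omega
    · intro x hx y hy hxy
      have := (hXm x hx).2.2.2
      have := (hXm y hy).2.2.2
      change x - 2 = y - 2 at hxy
      omega
  have hIc : (I.image (· - 1)).card = I.card := by
    rw [Finset.card_image_of_injOn]
    intro x hx y hy hxy
    have := (hI x hx).1
    have := (hI y hy).1
    change x - 1 = y - 1 at hxy
    omega
  have hd1 : Disjoint (I.image (· - 1)) J := by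
    rw [Finset.disjoint_left]
    intro z hz hz'
    obtain ⟨x, hx, rfl⟩ := Finset.mem_image.1 hz
    have h1 := (hI x hx).1
    have := hgap _ hz' x hx (by omega)
    omega
  have hd2 : Disjoint (I.image (· - 1) ∪ J) (Finset.Icc (q - c) (q - 2)) := by
    rw [Finset.disjoint_left]
    intro z hz hz'
    rw [Finset.mem_Icc] at hz'
    rcases Finset.mem_union.1 hz with hz | hz
    · obtain ⟨x, hx, rfl⟩ := Finset.mem_image.1 hz
      have h1 := (hI x hx).1
      have := hlow x hx (by omega)
      omega
    · have := hgap z hz q hq (by omega)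
      omega
  have hd3 : Disjoint ((I.image (· - 1) ∪ J) ∪ Finset.Icc (q - c) (q - 2)) X := by
    rw [Finset.disjoint_right]
    intro z hz hz'
    obtain ⟨s, hs, rfl⟩ := Finset.mem_image.1 hz
    obtain ⟨h1, h2, h3, h4⟩ := hXm s hs
    rcases Finset.mem_union.1 hz' with hz' | hz'
    · rcases Finset.mem_union.1 hz' with hz' | hz'
      · obtain ⟨x, hx, he⟩ := Finset.mem_image.1 hz'
        have := (hI x hx).1
        change x - 1 = s - 2 at he
        exact h2 (by rwa [show s - 1 = x by omega])
      · have := hgap _ hz' s h1 (by omega)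
        omega
    · change s - 2 ∈ _ at hz'
      rw [Finset.mem_Icc] at hz'
      have := hlow s h1 (by omega)
      omega
  have hsub : ((I.image (· - 1) ∪ J) ∪ Finset.Icc (q - c) (q - 2)) ∪ X ⊆ Finset.range m := by
    intro z hz
    rw [Finset.mem_range]
    rcases Finset.mem_union.1 hz with hz | hz
    · rcases Finset.mem_union.1 hz with hz | hz
      · rcases Finset.mem_union.1 hz with hz | hz
        · obtain ⟨x, hx, rfl⟩ := Finset.mem_image.1 hz
          have := hI x hx
          omega
        · exact hJ z hz
      · rw [Finset.mem_Icc] at hz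
        have := hI q hq
        omega
    · obtain ⟨s, hs, rfl⟩ := Finset.mem_image.1 hz
      have := hI s (hXm s hs).1
      have := (hXm s hs).2.2.2
      omega
  have := Finset.card_le_card hsub
  rw [Finset.card_union_of_disjoint hd3, Finset.card_union_of_disjoint hd2,
    Finset.card_union_of_disjoint hd1, hIc, Nat.card_Icc, Finset.card_range] at this
  omega

theorem eq_of_gaps {a b : Fin 4 → ℕ} {c : ℕ} (hc : 2 ≤ c)
  (a01 : a 0 < a 1) (a12 : a 1 < a 2) (a23 : a 2 < a 3)
  (b01 : b 0 < b 1) (b12 : b 1 < b 2) (b23 : b 2 < b 3)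
  (ha : a 1 = a 0 + 1 → a 2 ≠ a 1 + 1) (ha' : a 1 = a 0 + 1 → a 3 ≠ a 2 + 1) (ha'' : a 2 = a 1 + 1 → a 3 ≠ a 2 + 1)
  (hb : b 1 = b 0 + 1 → b 2 ≠ b 1 + 1) (hb' : b 1 = b 0 + 1 → b 3 ≠ b 2 + 1) (hb'' : b 2 = b 1 + 1 → b 3 ≠ b 2 + 1)
  (h1 : 1 ≤ a 0) (h2 : 2 ≤ b 0) (h3 : a 3 ≤ c + 6) (h4 : b 3 ≤ c + 7)
  (hg : ∀ i j, b j < a i → b j + c + 1 ≤ a i) (hcr : b 0 < a 3) :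
  c = 2 ∧ a 0 = 1 ∧ a 1 = 2 ∧ a 2 = 5 ∧ a 3 = 8 ∧ b 0 = 2 ∧ b 1 = 5 ∧ b 2 = 8 ∧ b 3 = 9 := by
  have g03 := hg 3 0 hcr
  have g : ∀ i j, a i ≤ b j ∨ b j + c + 1 ≤ a i := fun i j => by
    rcases le_or_gt (a i) (b j) with h | h
    · exact Or.inl h
    · exact Or.inr (hg i j h)
  clear hg
  rcases g 0 0 with h | h <;> rcases g 1 0 with h | h <;> rcases g 2 0 with h | h <;>
  rcases g 0 1 with h | h <;> try omega
  all_goals rcases g 1 1 with h | h <;> rcases g 2 1 with h | h <;> rcases g 3 1 with h | h <;> try omega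
  all_goals rcases g 1 2 with h | h <;> rcases g 2 2 with h | h <;> rcases g 3 2 with h | h <;> try omega

namespace MaxLine

variable {W : Finset V} {f : ℕ → V} {m k t : ℕ}

theorem rotate (h : MaxLine G W f m) {q : ℕ} (hq : q + 1 ≤ m) (ha : G.Adj (f 0) (f (q + 1)))
    (hqW : f q ∈ W) : ∃ g, MaxLine G W g m ∧ g 0 = f q ∧ g m = f m := by
  have hp := (h.line.pth (i := q) (j := 0) (by omega) (by omega)).append
    (h.line.pth (i := q + 1) (j := m) hq le_rfl) ha (by
      intro x hx hx'
      obtain ⟨i, hi, rfl⟩ := List.mem_map.1 hx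
      obtain ⟨j, hj, he⟩ := List.mem_map.1 hx'
      rw [mem_blk] at hi hj
      have := h.line.inj j i (by omega) (by omega) he
      omega)
  obtain ⟨g, hg, h0, h1, -⟩ := hp.line
  have hlen : ((blk q 0).map f ++ (blk (q + 1) m).map f).length - 1 = m := by
    simp [length_blk]
    omega
  rw [hlen] at hg h1
  exact ⟨g, ⟨hg, h0 ▸ hqW, h1 ▸ h.right, h.max⟩, h0, h1⟩

theorem rotate_right (h : MaxLine G W f m) {q : ℕ} (hq : q < m) (ha : G.Adj (f m) (f q))
    (hqW : f (q + 1) ∈ W) : ∃ g, MaxLine G W g m ∧ g 0 = f 0 ∧ g m = f (q + 1) := by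
  obtain ⟨g, hg, h0, h1⟩ := h.rev.rotate (q := m - (q + 1)) (by omega)
    (by rw [show m - (m - (q + 1) + 1) = q by omega]; simpa using ha)
    (by rw [show m - (m - (q + 1)) = q + 1 by omega]; exact hqW)
  refine ⟨_, hg.rev, ?_, ?_⟩
  · simpa using h1
  · rw [show m - (m - (q + 1)) = q + 1 by omega] at h0
    simpa using h0

theorem card_idx_left (h : MaxLine G W f m) : (idx G W f m (f 0)).card = dg G W (f 0) :=
  h.line.card_idx fun _ hw ha => h.mem_left hw ha

theorem card_idx_right (h : MaxLine G W f m) : (idx G W f m (f m)).card = dg G W (f m) :=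
  h.line.card_idx fun _ hw ha => h.mem_right hw ha

theorem pos_of_mem_left (_h : MaxLine G W f m) {i : ℕ} (hi : i ∈ idx G W f m (f 0)) : 1 ≤ i := by
  rcases Nat.eq_zero_or_pos i with rfl | h0
  · exact absurd rfl (mem_idx.1 hi).2.2.ne
  · exact h0

theorem lt_of_mem_right (_h : MaxLine G W f m) {i : ℕ} (hi : i ∈ idx G W f m (f m)) : i < m := by
  refine lt_of_le_of_ne (mem_idx.1 hi).1 ?_
  rintro rfl
  exact absurd rfl (mem_idx.1 hi).2.2.ne

theorem card_pairs_left (h : MaxLine G W f m) {E : Finset V}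
    (hE : ∀ v ∈ W, (∃ g, MaxLine G W g m ∧ g 0 = v ∧ g m = f m) → v ∈ E) :
    ((idx G W f m (f 0)).filter fun q => q + 1 ∈ idx G W f m (f 0)).card ≤ dg G E (f 0) := by
  refine Finset.card_le_card_of_injOn f ?_ ?_
  · intro q hq
    rw [Finset.mem_coe, Finset.mem_filter, mem_idx, mem_idx] at hq
    exact Finset.mem_coe.2 (mem_nb.2 ⟨hE _ hq.1.2.1 (h.rotate hq.2.1 hq.2.2.2 hq.1.2.1), hq.1.2.2⟩)
  · intro p hp q hq he
    rw [Finset.mem_coe, Finset.mem_filter, mem_idx] at hp hq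
    exact h.line.inj p q hp.1.1 hq.1.1 he

theorem card_pairs_right (h : MaxLine G W f m) {E : Finset V}
    (hE : ∀ v ∈ W, (∃ g, MaxLine G W g m ∧ g 0 = f 0 ∧ g m = v) → v ∈ E) :
    ((idx G W f m (f m)).filter fun q => q + 1 ∈ idx G W f m (f m)).card ≤ dg G E (f m) := by
  refine Finset.card_le_card_of_injOn (fun q => f (q + 1)) ?_ ?_
  · intro q hq
    rw [Finset.mem_coe, Finset.mem_filter, mem_idx, mem_idx] at hq
    exact Finset.mem_coe.2 (mem_nb.2 ⟨hE _ hq.2.2.1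
      (h.rotate_right (by omega) hq.1.2.2 hq.2.2.1), hq.2.2.2⟩)
  · intro p hp q hq he
    rw [Finset.mem_coe, Finset.mem_filter, mem_idx, mem_idx] at hp hq
    have := h.line.inj _ _ hp.2.1 hq.2.1 he
    omega

end MaxLine

/-- A longest path whose ends have few neighbours that could replace them. -/
theorem MinBig.exists_good_line (hL : Link G) {t k m : ℕ} (hN : NoLong G k) (ht : 4 ≤ t)
    (hk : k = 2 * t + 1 ∨ k = 2 * t + 2) {W : Finset V} (hW : MinBig G t k W) (hm : k ≤ m)
    (hex : ∃ f, MaxLine G W f m) :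
    ∃ f, MaxLine G W f m ∧ dg G W (f 0) = t ∧
      ((idx G W f m (f 0)).filter fun q => q + 1 ∈ idx G W f m (f 0)).card ≤ 1 ∧
      (dg G W (f m) = t + 1 ∧ k = 2 * t + 2 ∨ dg G W (f m) = t ∧
        ((idx G W f m (f m)).filter fun q => q + 1 ∈ idx G W f m (f m)).card ≤ 1) := by
  classical
  have hdeg : ∀ v ∈ W, t ≤ dg G W v := fun v hv => hW.le_dg hk hv
  have hsum : ∀ f, MaxLine G W f m → dg G W (f 0) + dg G W (f m) < k := fun f hf =>
    hf.dg_add_dg_lt hL hN (by omega) (by omega) hdeg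
  by_cases hodd : ∃ f, MaxLine G W f m ∧ dg G W (f 0) = t ∧ dg G W (f m) = t + 1
  · set E := W.filter fun v => dg G W v = t ∧ ∃ f, MaxLine G W f m ∧ f 0 = v ∧ dg G W (f m) = t + 1
      with hE
    have hne : E.Nonempty := by
      obtain ⟨f, hf, h1, h2⟩ := hodd
      exact ⟨f 0, Finset.mem_filter.2 ⟨hf.left, h1, f, hf, rfl, h2⟩⟩
    obtain ⟨x, hx, hx1⟩ := hW.exists_leaf hk (Finset.filter_subset _ _) hne
      fun v hv => (Finset.mem_filter.1 hv).2.1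
    obtain ⟨-, hxt, f, hf, rfl, hy⟩ := Finset.mem_filter.1 hx
    refine ⟨f, hf, hxt, (hf.card_pairs_left ?_).trans hx1, Or.inl ⟨hy, ?_⟩⟩
    · rintro v hv ⟨g, hg, rfl, h1⟩
      rw [← h1] at hy
      refine Finset.mem_filter.2 ⟨hv, ?_, g, hg, rfl, hy⟩
      have := hsum g hg
      have := hdeg _ hv
      omega
    · have := hsum f hf
      omega
  · have heven : ∀ f, MaxLine G W f m → dg G W (f 0) = t ∧ dg G W (f m) = t := by
      intro f hf
      have h1 := hsum f hf
      have h2 := hdeg _ hf.left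
      have h3 := hdeg _ hf.right
      have h4 : ¬ (dg G W (f 0) = t ∧ dg G W (f m) = t + 1) := fun h => hodd ⟨f, hf, h⟩
      have h5 : ¬ (dg G W (f m) = t ∧ dg G W (f 0) = t + 1) := fun h =>
        hodd ⟨_, hf.rev, by simpa using h⟩
      omega
    set E := W.filter fun v => ∃ f, MaxLine G W f m ∧ f 0 = v with hE
    have hne : E.Nonempty := by
      obtain ⟨f, hf⟩ := hex
      exact ⟨f 0, Finset.mem_filter.2 ⟨hf.left, f, hf, rfl⟩⟩
    obtain ⟨x, hx, hx1⟩ := hW.exists_leaf hk (Finset.filter_subset _ _) hne fun v hv => by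
      obtain ⟨-, f, hf, rfl⟩ := Finset.mem_filter.1 hv
      exact (heven f hf).1
    set Y := W.filter fun v => ∃ f, MaxLine G W f m ∧ f 0 = x ∧ f m = v with hY
    have hneY : Y.Nonempty := by
      obtain ⟨-, f, hf, rfl⟩ := Finset.mem_filter.1 hx
      exact ⟨f m, Finset.mem_filter.2 ⟨hf.right, f, hf, rfl, rfl⟩⟩
    obtain ⟨y, hy, hy1⟩ := hW.exists_leaf hk (Finset.filter_subset _ _) hneY fun v hv => by
      obtain ⟨-, f, hf, -, rfl⟩ := Finset.mem_filter.1 hv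
      exact (heven f hf).2
    obtain ⟨-, f, hf, rfl, rfl⟩ := Finset.mem_filter.1 hy
    refine ⟨f, hf, (heven f hf).1, (hf.card_pairs_left ?_).trans hx1,
      Or.inr ⟨(heven f hf).2, (hf.card_pairs_right ?_).trans hy1⟩⟩
    · rintro v hv ⟨g, hg, rfl, -⟩
      exact Finset.mem_filter.2 ⟨hv, g, hg, rfl⟩
    · rintro v hv hg
      exact Finset.mem_filter.2 ⟨hv, hg⟩

theorem Line.mono {f : ℕ → V} {m m' : ℕ} (h : Line G f m) (hm : m' ≤ m) : Line G f m' :=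
  ⟨fun i hi => h.adj i (by omega), fun i j hi hj => h.inj i j (by omega) (by omega)⟩

theorem eq_of_four {I J : Finset ℕ} {c : ℕ} (hc : 2 ≤ c) (hI4 : I.card = 4) (hJ4 : J.card = 4)
    (hI1 : (I.filter fun q => q + 1 ∈ I).card ≤ 1) (hJ1 : (J.filter fun q => q + 1 ∈ J).card ≤ 1)
    (hI : ∀ i ∈ I, 1 ≤ i ∧ i ≤ c + 6) (hJ : ∀ j ∈ J, 2 ≤ j ∧ j ≤ c + 7)
    (hgap : ∀ p ∈ J, ∀ q ∈ I, p < q → p + c + 1 ≤ q) (hcr : ∃ p ∈ J, ∃ q ∈ I, p < q) :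
    c = 2 ∧ I = {1, 2, 5, 8} ∧ J = {2, 5, 8, 9} := by
  have hpair : ∀ S : Finset ℕ, (S.filter fun q => q + 1 ∈ S).card ≤ 1 → ∀ p ∈ S, ∀ q ∈ S,
      p < q → p + 1 ∈ S → q + 1 ∉ S := by
    intro S hS p hp q hq hpq hp1 hq1
    have := Finset.card_le_one.1 hS p (Finset.mem_filter.2 ⟨hp, hp1⟩) q
      (Finset.mem_filter.2 ⟨hq, hq1⟩)
    omega
  set a := I.orderEmbOfFin hI4 with ha
  set b := J.orderEmbOfFin hJ4 with hb
  have haI : ∀ i, a i ∈ I := I.orderEmbOfFin_mem hI4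
  have hbJ : ∀ i, b i ∈ J := J.orderEmbOfFin_mem hJ4
  have ham : ∀ i j, i < j → a i < a j := fun i j h => a.strictMono h
  have hbm : ∀ i j, i < j → b i < b j := fun i j h => b.strictMono h
  have key : ∀ S : Finset ℕ, (S.filter fun q => q + 1 ∈ S).card ≤ 1 → ∀ s : Fin 4 → ℕ,
      (∀ i, s i ∈ S) → ∀ i i' j j', s i < s j → s i' = s i + 1 → s j' ≠ s j + 1 := by
    intro S hS s hs i i' j j' hij h1 h2
    exact hpair S hS _ (hs i) _ (hs j) hij (h1 ▸ hs i') (h2 ▸ hs j')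
  have hab : b 0 < a 3 := by
    obtain ⟨p, hp, q, hq, hpq⟩ := hcr
    have hr1 : q ∈ Set.range a := by rw [ha, Finset.range_orderEmbOfFin]; exact hq
    have hr2 : p ∈ Set.range b := by rw [hb, Finset.range_orderEmbOfFin]; exact hp
    obtain ⟨i, rfl⟩ := hr1
    obtain ⟨j, rfl⟩ := hr2
    have h1 : a i ≤ a 3 := a.monotone (Fin.le_last i)
    have h2 : b 0 ≤ b j := b.monotone (Fin.zero_le j)
    omega
  obtain ⟨h0, h1, h2, h3, h4, h5, h6, h7, h8⟩ := eq_of_gaps (a := a) (b := b) hc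
    (ham 0 1 (by decide)) (ham 1 2 (by decide)) (ham 2 3 (by decide))
    (hbm 0 1 (by decide)) (hbm 1 2 (by decide)) (hbm 2 3 (by decide))
    (key I hI1 a haI 0 1 1 2 (ham 0 1 (by decide))) (key I hI1 a haI 0 1 2 3 (ham 0 2 (by decide)))
    (key I hI1 a haI 1 2 2 3 (ham 1 2 (by decide)))
    (key J hJ1 b hbJ 0 1 1 2 (hbm 0 1 (by decide))) (key J hJ1 b hbJ 0 1 2 3 (hbm 0 2 (by decide)))
    (key J hJ1 b hbJ 1 2 2 3 (hbm 1 2 (by decide)))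
    (hI _ (haI 0)).1 (hJ _ (hbJ 0)).1 (hI _ (haI 3)).2 (hJ _ (hbJ 3)).2
    (fun i j => hgap _ (hbJ j) _ (haI i)) hab
  refine ⟨h0, (Finset.eq_of_subset_of_card_le ?_ (by rw [hI4]; decide)).symm,
    (Finset.eq_of_subset_of_card_le ?_ (by rw [hJ4]; decide)).symm⟩
  · intro x hx
    simp only [Finset.mem_insert, Finset.mem_singleton] at hx
    rcases hx with rfl | rfl | rfl | rfl
    exacts [h1 ▸ haI 0, h2 ▸ haI 1, h3 ▸ haI 2, h4 ▸ haI 3]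
  · intro x hx
    simp only [Finset.mem_insert, Finset.mem_singleton] at hx
    rcases hx with rfl | rfl | rfl | rfl
    exacts [h5 ▸ hbJ 0, h6 ▸ hbJ 1, h7 ▸ hbJ 2, h8 ▸ hbJ 3]

theorem MaxLine.swap_first {W : Finset V} {f : ℕ → V} (h : MaxLine G W f 10) (hN : NoLong G 10)
    (hdeg : ∀ v ∈ W, 4 ≤ dg G W v) (h2 : G.Adj (f 0) (f 2)) (h1 : f 1 ∈ W)
    (hr : ∀ i ∈ ({2, 5, 8, 9} : Finset ℕ), G.Adj (f 10) (f i)) :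
    G.Adj (f 1) (f 5) ∧ G.Adj (f 1) (f 8) := by
  set g : ℕ → V := fun i => if i = 0 then f 1 else if i = 1 then f 0 else f i with hg
  have g2 : ∀ i, 2 ≤ i → g i = f i := by
    intro i hi
    simp only [hg]
    rw [if_neg (by omega), if_neg (by omega)]
  have hgl : MaxLine G W g 10 := by
    refine ⟨⟨fun i hi => ?_, fun i j hi hj he => ?_⟩, by simpa [hg] using h1, ?_, h.max⟩
    · by_cases hi0 : i = 0
      · subst hi0
        simpa [hg] using (h.line.adj 0 (by omega)).symm
      by_cases hi1 : i = 1
      · subst hi1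
        simpa [hg] using h2
      · rw [g2 i (by omega), g2 (i + 1) (by omega)]
        exact h.line.adj i hi
    · have key : ∀ i ≤ 10, ∃ s ≤ 10, g i = f s ∧ (i = 0 ∧ s = 1 ∨ i = 1 ∧ s = 0 ∨ 2 ≤ i ∧ s = i) := by
        intro i hi
        rcases (by omega : i = 0 ∨ i = 1 ∨ 2 ≤ i) with rfl | rfl | h'
        · exact ⟨1, by omega, by simp [hg], by omega⟩
        · exact ⟨0, by omega, by simp [hg], by omega⟩
        · exact ⟨i, hi, g2 i h', by omega⟩
      obtain ⟨s, hs, e1, c1⟩ := key i hi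
      obtain ⟨s', hs', e2, c2⟩ := key j hj
      have := h.line.inj s s' hs hs' (by rw [← e1, ← e2, he])
      omega
    · rw [g2 10 (by omega)]
      exact h.right
  have hsub : idx G W g 10 (g 0) ⊆ {1, 2, 5, 8} := by
    intro q hq
    have h0 := hgl.pos_of_mem_left hq
    rw [mem_idx] at hq
    have hcr : ∀ p ∈ ({2, 5, 8, 9} : Finset ℕ), p < q → 2 + p < q := by
      intro p hp hpq
      have hp2 : 2 ≤ p := by
        simp only [Finset.mem_insert, Finset.mem_singleton] at hp
        omega
      have := hgl.line.cross hN hpq hq.1 (by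
        rw [g2 p hp2, g2 10 (by omega)]
        exact hr p hp) hq.2.2
      omega
    have c1 := hcr 2 (by decide)
    have c2 := hcr 5 (by decide)
    have c3 := hcr 8 (by decide)
    have := hq.1
    simp only [Finset.mem_insert, Finset.mem_singleton]
    omega
  have heq := Finset.eq_of_subset_of_card_le hsub (by
    rw [hgl.card_idx_left]
    exact hdeg _ hgl.left)
  have h5 : 5 ∈ idx G W g 10 (g 0) := by rw [heq]; decide
  have h8 : 8 ∈ idx G W g 10 (g 0) := by rw [heq]; decide
  exact ⟨by simpa [hg] using (mem_idx.1 h5).2.2, by simpa [hg] using (mem_idx.1 h8).2.2⟩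

theorem MinBig.exists_line_ten (hL : Link G) {t k m : ℕ} (hN : NoLong G k) (ht : 4 ≤ t)
    (hk : k = 2 * t + 1 ∨ k = 2 * t + 2) {W : Finset V} (hW : MinBig G t k W) (hm : k ≤ m)
    (hex : ∃ f, MaxLine G W f m) :
    t = 4 ∧ k = 10 ∧ ∃ f, Line G f 10 ∧ ∀ i ∈ ({0, 1, 9, 10} : Finset ℕ),
      ∀ j ∈ ({2, 5, 8} : Finset ℕ), G.Adj (f i) (f j) := by
  have hdeg : ∀ v ∈ W, t ≤ dg G W v := fun v hv => hW.le_dg hk hv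
  obtain ⟨f, hf, hd0, hI1, halt⟩ := hW.exists_good_line hL hN ht hk hm hex
  obtain ⟨c, hc⟩ : ∃ c, m + 2 = k + c := ⟨m + 2 - k, by omega⟩
  have hIc := hf.card_idx_left
  have hJc := hf.card_idx_right
  set I := idx G W f m (f 0) with hI
  set J := idx G W f m (f m) with hJ
  have hdm := hdeg _ hf.right
  have hIb : ∀ i ∈ I, 1 ≤ i ∧ i + 2 ≤ m := by
    intro i hi
    have h1 := hf.pos_of_mem_left hi
    rw [hI, mem_idx] at hi
    refine ⟨h1, ?_⟩
    by_contra! hcon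
    exact (hf.line.mono hi.1).not_adj hN (by omega) hi.2.2.symm
  have hJb : ∀ j ∈ J, 2 ≤ j ∧ j + 1 ≤ m := by
    intro j hj
    have h1 := hf.lt_of_mem_right hj
    rw [hJ, mem_idx] at hj
    refine ⟨?_, h1⟩
    by_contra! hcon
    refine (hf.line.rev.mono (show m - j ≤ m by omega)).not_adj hN (by omega) ?_
    rw [show m - (m - j) = j by omega]
    simpa using hj.2.2.symm
  have hgap : ∀ p ∈ J, ∀ q ∈ I, p < q → p + c + 1 ≤ q := by
    intro p hp q hq hpq
    rw [hJ, mem_idx] at hp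
    rw [hI, mem_idx] at hq
    have := hf.line.cross hN hpq hq.1 hp.2.2 hq.2.2
    omega
  have hcr : ∃ p ∈ J, ∃ q ∈ I, p < q := by
    by_contra! hcon
    have h1 := (hf.line.noncross hL hN (I := I) (J := J)
      (fun i hi => ⟨(hIb i hi).1, (mem_idx.1 hi).2.2⟩)
      (fun i hi => ⟨(hJb i hi).2, (mem_idx.1 hi).2.2⟩)
      (Finset.card_pos.1 (by omega)) (Finset.card_pos.1 (by omega)) hcon).2
    have h2 := Finset.card_filter_add_card_filter_not (s := I) (fun i => i + 1 ∈ I)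
    omega
  have hcount := card_add_card_le_of_cross hm hc
    (fun i hi => ⟨(hIb i hi).1, by have := (hIb i hi).2; omega⟩) (fun j hj => (hJb j hj).2) hgap hcr
  have ht4 : t = 4 := by omega
  have hk10 : k = 10 := by omega
  subst ht4 hk10
  have hJ1 : dg G W (f m) = 4 ∧ (J.filter fun q => q + 1 ∈ J).card ≤ 1 := by
    rcases halt with h | h
    · omega
    · exact h
  obtain ⟨rfl, hI', hJ'⟩ := eq_of_four (I := I) (J := J) (c := c) (by omega) (by omega) (by omega)
    hI1 hJ1.2 (fun i hi => ⟨(hIb i hi).1, by have := (hIb i hi).2; omega⟩)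
    (fun j hj => ⟨(hJb j hj).1, by have := (hJb j hj).2; omega⟩) hgap hcr
  obtain rfl : m = 10 := by omega
  have hIa : ∀ i ∈ ({1, 2, 5, 8} : Finset ℕ), f i ∈ W ∧ G.Adj (f 0) (f i) := by
    intro i hi
    rw [← hI', hI, mem_idx] at hi
    exact hi.2
  have hJa : ∀ i ∈ ({2, 5, 8, 9} : Finset ℕ), f i ∈ W ∧ G.Adj (f 10) (f i) := by
    intro i hi
    rw [← hJ', hJ, mem_idx] at hi
    exact hi.2
  have hl := hf.swap_first hN hdeg (hIa 2 (by decide)).2 (hIa 1 (by decide)).1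
    fun i hi => (hJa i hi).2
  have hr := hf.rev.swap_first hN hdeg (hJa 8 (by decide)).2 (hJa 9 (by decide)).1 (by
    intro i hi
    have hi' : 10 - i ∈ ({1, 2, 5, 8} : Finset ℕ) := by
      simp only [Finset.mem_insert, Finset.mem_singleton] at hi ⊢
      omega
    simpa using (hIa _ hi').2)
  refine ⟨rfl, rfl, f, hf.line, ?_⟩
  intro i hi j hj
  simp only [Finset.mem_insert, Finset.mem_singleton] at hi hj
  rcases hi with rfl | rfl | rfl | rfl
  · rcases hj with rfl | rfl | rfl <;> exact (hIa _ (by decide)).2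
  · rcases hj with rfl | rfl | rfl
    · exact hf.line.adj 1 (by omega)
    · exact hl.1
    · exact hl.2
  · rcases hj with rfl | rfl | rfl
    · exact hr.2
    · exact hr.1
    · exact (hf.line.adj 8 (by omega)).symm
  · rcases hj with rfl | rfl | rfl <;> exact (hJa _ (by decide)).2

/-- The graph on `0, …, 10` formed by a path with `0, 1, 9, 10` joined to `2, 5, 8`. -/
abbrev ThetaAdj (i j : ℕ) : Prop :=
  i + 1 = j ∨ j + 1 = i ∨ i ∈ [0, 1, 9, 10] ∧ j ∈ [2, 5, 8] ∨ j ∈ [0, 1, 9, 10] ∧ i ∈ [2, 5, 8]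

/-- The components left after deleting `2, 5, 8`. -/
def thetaPart : ℕ → ℕ
  | 0 => 0 | 1 => 0 | 3 => 1 | 4 => 1 | 6 => 2 | 7 => 2 | 9 => 3 | 10 => 3 | _ => 4

/-- Long paths between different components. -/
def thetaLong : List (List ℕ) :=
  [[3, 2, 9, 10, 5, 6, 7, 8, 1, 0], [3, 2, 9, 10, 5, 6, 7, 8, 0, 1],
    [4, 3, 2, 9, 5, 6, 7, 8, 1, 0], [4, 3, 2, 9, 5, 6, 7, 8, 0, 1],
    [6, 5, 4, 3, 2, 9, 10, 8, 1, 0], [6, 5, 4, 3, 2, 9, 10, 8, 0, 1],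
    [6, 7, 8, 0, 1, 2, 9, 5, 4, 3], [6, 5, 0, 1, 8, 9, 10, 2, 3, 4],
    [7, 6, 5, 4, 3, 2, 9, 8, 1, 0], [7, 6, 5, 4, 3, 2, 9, 8, 0, 1],
    [7, 6, 5, 0, 1, 8, 9, 10, 2, 3], [7, 6, 5, 0, 1, 8, 9, 2, 3, 4],
    [9, 2, 3, 4, 5, 6, 7, 8, 1, 0], [9, 2, 3, 4, 5, 6, 7, 8, 0, 1],
    [9, 2, 0, 1, 8, 7, 6, 5, 4, 3], [9, 5, 6, 7, 8, 0, 1, 2, 3, 4],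
    [9, 2, 3, 4, 5, 0, 1, 8, 7, 6], [9, 8, 0, 1, 2, 3, 4, 5, 6, 7],
    [10, 2, 3, 4, 5, 6, 7, 8, 1, 0], [10, 2, 3, 4, 5, 6, 7, 8, 0, 1],
    [10, 2, 0, 1, 8, 7, 6, 5, 4, 3], [10, 5, 6, 7, 8, 0, 1, 2, 3, 4],
    [10, 2, 3, 4, 5, 0, 1, 8, 7, 6], [10, 8, 0, 1, 2, 3, 4, 5, 6, 7]]

/-- Paths between `2, 5, 8` that avoid a component. -/
def thetaShort : List (List ℕ) :=
  [[2, 9, 10, 8, 7, 6, 5], [2, 0, 1, 8, 7, 6, 5],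
    [2, 0, 1, 8, 9, 10, 5], [2, 3, 4, 5, 6, 7, 8],
    [2, 0, 1, 5, 6, 7, 8], [2, 0, 1, 5, 9, 10, 8],
    [5, 4, 3, 2, 9, 10, 8], [5, 4, 3, 2, 0, 1, 8],
    [5, 0, 1, 2, 9, 10, 8]]

theorem thetaLong_valid : ∀ L ∈ thetaLong, L.IsChain ThetaAdj ∧ L.Nodup ∧ (∀ x ∈ L, x ≤ 10) ∧
    10 ≤ L.length := by
  decide +kernel

theorem thetaShort_valid : ∀ L ∈ thetaShort, L.IsChain ThetaAdj ∧ L.Nodup ∧ (∀ x ∈ L, x ≤ 10) ∧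
    7 ≤ L.length := by
  decide +kernel

theorem exists_thetaLong : ∀ i < 11, ∀ j < 11,
    thetaPart i = 4 ∨ thetaPart j = 4 ∨ thetaPart i = thetaPart j ∨
      ∃ L ∈ thetaLong, (L.head? = some i ∧ L.getLast? = some j ∨
        L.head? = some j ∧ L.getLast? = some i) := by
  decide +kernel

theorem exists_thetaShort : ∀ p < 4, ∀ i ∈ [2, 5, 8], ∀ j ∈ [2, 5, 8], i ≠ j →
    ∃ L ∈ thetaShort, (∀ x ∈ L, thetaPart x ≠ p) ∧ (L.head? = some i ∧ L.getLast? = some j ∨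
      L.head? = some j ∧ L.getLast? = some i) := by
  decide +kernel

theorem Line.theta_adj {f : ℕ → V} (h : Line G f 10) (hB : ∀ i ∈ ({0, 1, 9, 10} : Finset ℕ),
      ∀ j ∈ ({2, 5, 8} : Finset ℕ), G.Adj (f i) (f j)) {i j : ℕ} (hi : i ≤ 10) (hj : j ≤ 10)
    (hij : ThetaAdj i j) : G.Adj (f i) (f j) := by
  rcases hij with rfl | rfl | ⟨h1, h2⟩ | ⟨h1, h2⟩
  · exact h.adj i (by omega)
  · exact (h.adj j (by omega)).symm
  · exact hB i (by simpa using h1) j (by simpa using h2)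
  · exact (hB j (by simpa using h1) i (by simpa using h2)).symm

theorem Line.theta_pth {f : ℕ → V} (h : Line G f 10) (hB : ∀ i ∈ ({0, 1, 9, 10} : Finset ℕ),
      ∀ j ∈ ({2, 5, 8} : Finset ℕ), G.Adj (f i) (f j)) {L : List ℕ} (hc : L.IsChain ThetaAdj)
    (hn : L.Nodup) (hb : ∀ x ∈ L, x ≤ 10) {i j : ℕ}
    (hij : L.head? = some i ∧ L.getLast? = some j ∨ L.head? = some j ∧ L.getLast? = some i) :
    ∃ l, Pth G (f i) (f j) l ∧ l.length = L.length ∧ ∀ x ∈ l, ∃ q ∈ L, f q = x := by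
  have hch : (L.map f).IsChain G.Adj := by
    rw [List.isChain_map, List.isChain_iff_getElem]
    rw [List.isChain_iff_getElem] at hc
    intro q hq
    exact h.theta_adj hB (hb _ (List.getElem_mem _)) (hb _ (List.getElem_mem _)) (hc q hq)
  have hnd : (L.map f).Nodup := hn.map_on fun x hx y hy => h.inj x y (hb x hx) (hb y hy)
  have hm : ∀ x ∈ L.map f, ∃ q ∈ L, f q = x := fun x hx => List.mem_map.1 hx
  rcases hij with ⟨h1, h2⟩ | ⟨h1, h2⟩
  · exact ⟨L.map f, ⟨hch, by simp [h1], by simp [h2], hnd⟩, by simp, hm⟩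
  · have hp : Pth G (f j) (f i) (L.map f) := ⟨hch, by simp [h1], by simp [h2], hnd⟩
    exact ⟨_, hp.reverse, by simp, fun x hx => hm x (List.mem_reverse.1 hx)⟩

theorem thetaPart_eq_four {i : ℕ} (hi : i ≤ 10) : thetaPart i = 4 ↔ i = 2 ∨ i = 5 ∨ i = 8 := by
  interval_cases i <;> decide

theorem thetaPart_le (i : ℕ) : thetaPart i ≤ 4 := by
  unfold thetaPart
  split <;> omega

theorem Line.isStarForest_of_theta (hL : Link G) (hN : NoLong G 10) {f : ℕ → V} (h : Line G f 10)
    (hB : ∀ i ∈ ({0, 1, 9, 10} : Finset ℕ), ∀ j ∈ ({2, 5, 8} : Finset ℕ), G.Adj (f i) (f j)) :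
    ∃ A : Finset V, A.card ≤ 4 ∧ IsStarForest (G.induce {v : V | v ∉ A}) := by
  classical
  refine ⟨{f 2, f 5, f 8}, Finset.card_le_three.trans (by omega),
    isStarForest_of_conn hL _ (α := f 2) (β := f 5) (by simp) (by simp) ?_ ?_⟩
  · intro he
    have := h.inj 2 5 (by omega) (by omega) he
    omega
  intro Q hQA a ha b hb hab hQ
  by_contra! hlen
  have hpart : ∀ i ≤ 10, f i ∈ Q → thetaPart i ≠ 4 := by
    intro i hi hiQ h4
    refine hQA _ hiQ ?_
    rcases (thetaPart_eq_four hi).1 h4 with rfl | rfl | rfl <;> simp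
  obtain ⟨p, hp4, hp⟩ : ∃ p < 4, ∀ i ≤ 10, f i ∈ Q → thetaPart i = p := by
    by_contra! hcon
    obtain ⟨i, hi, hiQ, -⟩ := hcon 0 (by omega)
    obtain ⟨l₁, y, l₂, rfl, ⟨i, hi, rfl⟩, hl₁⟩ :=
      (split_first (fun x => ∃ i ≤ 10, f i = x) Q).resolve_left fun hno => hno _ hiQ ⟨i, hi, rfl⟩
    have hi4 := hpart i hi (by simp)
    obtain ⟨j, hj, hjQ, hji⟩ := hcon (thetaPart i) (by
      have := thetaPart_le i
      omega)
    have hj2 : f j ∈ l₂ := by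
      rcases List.mem_append.1 hjQ with hj1 | hj1
      · exact absurd ⟨j, hj, rfl⟩ (hl₁ _ hj1)
      · rcases List.mem_cons.1 hj1 with he | hj1
        · exact absurd (congrArg thetaPart (h.inj j i hj hi he)) hji
        · exact hj1
    obtain ⟨m₁, y, m₂, rfl, ⟨j, hj, hji, rfl⟩, hm₁⟩ :=
      (split_first (fun x => ∃ j ≤ 10, thetaPart j ≠ thetaPart i ∧ f j = x) l₂).resolve_left
        fun hno => hno _ hj2 ⟨j, hj, hji, rfl⟩
    obtain ⟨R₁, z, R₂, hR, ⟨s, hs, rfl⟩, hR₂⟩ :=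
      (split_last (fun x => ∃ i ≤ 10, f i = x) (f i :: m₁)).resolve_left
        fun hno => hno (f i) (by simp) ⟨i, hi, rfl⟩
    have hsi : thetaPart s = thetaPart i := by
      have hmem : f s ∈ f i :: m₁ := by simp [hR]
      rcases List.mem_cons.1 hmem with he | hmem
      · rw [h.inj s i hs hi he]
      · by_contra hne
        exact hm₁ _ hmem ⟨s, hs, hne, rfl⟩
    have hQ' : l₁ ++ f i :: (m₁ ++ f j :: m₂) = (l₁ ++ R₁) ++ f s :: (R₂ ++ f j :: m₂) := by
      have : l₁ ++ f i :: (m₁ ++ f j :: m₂) = l₁ ++ (f i :: m₁) ++ f j :: m₂ := by simp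
      rw [this, hR]
      simp
    have hconn : Conn G (f s) (f j) R₂ := by
      rw [hQ'] at hQ
      exact hQ.split.2.split.1
    obtain ⟨L, hLm, hLe⟩ := (((exists_thetaLong j (by omega) s (by omega)).resolve_left
      (hpart j hj (by simp))).resolve_left (hsi ▸ hi4)).resolve_left (hsi ▸ hji)
    obtain ⟨v1, v2, v3, v4⟩ := thetaLong_valid L hLm
    obtain ⟨l, hl, hll, hlm⟩ := h.theta_pth hB v1 v2 v3 hLe
    have := hN.close hl hconn fun z hz hzl => by
      obtain ⟨q, hq, rfl⟩ := hlm z hzl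
      exact hR₂ _ hz ⟨q, v3 q hq, rfl⟩
    omega
  have hrep : ∀ x ∈ ({f 2, f 5, f 8} : Finset V), ∃ i ∈ [2, 5, 8], f i = x := by
    intro x hx
    simp only [Finset.mem_insert, Finset.mem_singleton] at hx
    rcases hx with rfl | rfl | rfl
    · exact ⟨2, by simp, rfl⟩
    · exact ⟨5, by simp, rfl⟩
    · exact ⟨8, by simp, rfl⟩
  obtain ⟨i, hi, rfl⟩ := hrep a ha
  obtain ⟨j, hj, rfl⟩ := hrep b hb
  obtain ⟨L, hLm, hLp, hLe⟩ := exists_thetaShort p hp4 j hj i hi (by rintro rfl; exact hab rfl)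
  obtain ⟨v1, v2, v3, v4⟩ := thetaShort_valid L hLm
  obtain ⟨l, hl, hll, hlm⟩ := h.theta_pth hB v1 v2 v3 hLe
  have := hN.close hl hQ fun z hz hzl => by
    obtain ⟨q, hq, rfl⟩ := hlm z hzl
    exact hLp q hq (hp q (v3 q hq) hz)
  omega

theorem Big.exists_of_saturated [Fintype V] (hL : Link G) {t k : ℕ} (hN : NoLong G k) (ht : 4 ≤ t)
    (hk : k = 2 * t + 1 ∨ k = 2 * t + 2) (hn : 3 * t ≤ Fintype.card V)
    (hsat : ∀ x y, x ≠ y → ¬ G.Adj x y → ∃ l, Pth G x y l ∧ k ≤ l.length)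
    (hbig : Big G t k Finset.univ) :
    ∃ A : Finset V, A.card ≤ t ∧ IsStarForest (G.induce {v : V | v ∉ A}) := by
  obtain ⟨W, hW⟩ := exists_minBig hbig (by rw [Finset.card_univ]; omega)
  have hncl : ¬ G.IsClique (W : Set V) := fun hcl => by
    have := hbig.card_lt_of_isClique hL hN ht hk hn hsat hcl
    have := hW.card_ge hk
    omega
  obtain ⟨x, hx, y, hy, hxy, hnadj⟩ : ∃ x ∈ W, ∃ y ∈ W, x ≠ y ∧ ¬ G.Adj x y := by
    by_contra! hcon
    exact hncl fun x hx y hy hxy => hcon x hx y hy hxy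
  obtain ⟨l, hl, hlk⟩ := hsat x y hxy hnadj
  obtain ⟨a, ha, b, hb, p, hp, hpk, hpmax⟩ :=
    exists_longest_pth (W : Set V) (W : Set V) ⟨x, hx, y, hy, l, hl, hlk⟩
  by_cases hle : p.length ≤ k
  · exact hW.exists_of_pth_le hL hN ht hk hsat
      (fun x hx y hy l hl => (hpmax x hx y hy l hl).trans hle) hx hy hxy hnadj
  · obtain ⟨f, hf, hf0, hf1, -⟩ := hp.line
    obtain ⟨rfl, rfl, g, hg, hB⟩ := hW.exists_line_ten hL hN ht hk
      (m := p.length - 1) (by omega) ⟨f, hf, hf0 ▸ ha, hf1 ▸ hb, fun x hx y hy l hl => by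
        have := hpmax x hx y hy l hl
        omega⟩
    exact hg.isStarForest_of_theta hL hN hB

theorem Big.exists_of_univ [Fintype V] (hL : Link G) {t k : ℕ} (hN : NoLong G k) (ht : 4 ≤ t)
    (hk : k = 2 * t + 1 ∨ k = 2 * t + 2) (hn : 3 * t ≤ Fintype.card V)
    (hbig : Big G t k Finset.univ) :
    ∃ A : Finset V, A.card ≤ t ∧ IsStarForest (G.induce {v : V | v ∉ A}) := by
  obtain ⟨G', hle, hN', hsat⟩ := exists_saturated (by omega) hN
  have hbig' : Big G' t k Finset.univ := by
    unfold Big at hbig ⊢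
    rw [ds_univ] at hbig ⊢
    have := Set.ncard_le_ncard (SimpleGraph.edgeSet_mono hle) (Set.toFinite _)
    omega
  obtain ⟨A, hA, hs⟩ := hbig'.exists_of_saturated (hL.of_le hle) hN' ht hk hn hsat
  exact ⟨A, hA, isStarForest_of_le hle hs⟩

theorem big_univ [Fintype V] {t k : ℕ} (ht : 2 ≤ t) (hk : k = 2 * t + 1 ∨ k = 2 * t + 2)
    (hn : 3 * t ≤ Fintype.card V)
    (he : (k - t + 1).choose 2 + (t - 1) * (Fintype.card V - k + t - 1) < G.edgeSet.ncard) :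
    Big G t k Finset.univ := by
  unfold Big
  rw [ds_univ, Finset.card_univ]
  generalize G.edgeSet.ncard = e at *
  generalize Fintype.card V = n at *
  have hd : (k - t + 1).choose 2 * 2 = (k - t + 1) * (k - t) := by
    rw [Nat.choose_two_right]
    exact Nat.div_mul_cancel (Nat.even_mul_pred_self _).two_dvd
  generalize (k - t + 1).choose 2 = c at *
  obtain ⟨s, rfl⟩ : ∃ s, t = s + 2 := ⟨t - 2, by omega⟩
  obtain ⟨r, rfl⟩ : ∃ r, n = k + r := ⟨n - k, by omega⟩
  rcases hk with rfl | rfl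
  · rw [show 2 * (s + 2) + 1 - (s + 2) = s + 3 by omega] at hd
    rw [show s + 2 - 1 = s + 1 by omega,
      show 2 * (s + 2) + 1 + r - (2 * (s + 2) + 1) + (s + 2) - 1 = r + s + 1 by omega] at he
    nlinarith
  · rw [show 2 * (s + 2) + 2 - (s + 2) = s + 4 by omega] at hd
    rw [show s + 2 - 1 = s + 1 by omega,
      show 2 * (s + 2) + 2 + r - (2 * (s + 2) + 2) + (s + 2) - 1 = r + s + 1 by omega] at he
    nlinarith

end StarStability

open StarStability in
/-- Stability of the Erdős–Gallai theorem: let `t ≥ 2`, `n ≥ 3t`, and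
`k ∈ {2t+1, 2t+2}`.  If `G` is a 2-connected `n`-vertex graph with no cycle of
length at least `k` and with more than `h(n,k,t-1) = C(k-t+1,2) + (t-1)(n-k+t-1)`
edges, then some set `A` of at most `t` vertices is such that `G - A` is a star
forest. -/
theorem stmt_19 {V : Type*} [Fintype V] [DecidableEq V] (G : SimpleGraph V)
    (n t k : ℕ) (hn : Fintype.card V = n) (ht : 2 ≤ t) (hnt : 3 * t ≤ n)
    (hk : k = 2 * t + 1 ∨ k = 2 * t + 2) (h2 : TwoConnected G)
    (hcyc : ∀ (u : V) (c : G.Walk u u), c.IsCycle → c.length < k)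
    (he : (k - t + 1).choose 2 + (t - 1) * (n - k + t - 1) < G.edgeSet.ncard) :
    ∃ A : Finset V, A.card ≤ t ∧ IsStarForest (G.induce {v : V | v ∉ A}) := by
  subst hn
  have hL := link_of_twoConnected h2
  have hN : NoLong G k := noLong_of_isCycle (by omega) hcyc
  obtain rfl | rfl | ht4 : t = 2 ∨ t = 3 ∨ 4 ≤ t := by omega
  · exact exists_of_noLong_six hL (hN.mono (by omega)) (by rw [Nat.card_eq_fintype_card]; omega)
  · refine exists_of_three hL (by omega) hN (by omega) ?_
    rcases hk with rfl | rfl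
    · norm_num [Nat.choose] at he ⊢
      omega
    · norm_num [Nat.choose] at he ⊢
      omega
  · exact (big_univ ht hk hnt he).exists_of_univ hL hN ht4 hk hnt
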